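/- arXiv:1810.10562 — 2 statements merged into one kernel-verified Lean document; each statement's English description precedes it below -/
import Mathlib

section
/- The set of tame integral SL₃-friezes of width 3 is finite and has exactly 868 elements. -/
/-- The domain of an SL₃-frieze of width `w`: pairs `(i,j)` with `-3 ≤ j - i ≤ w + 2`. -/
def SL3Dom (w : ℕ) : Type :=
  {p : ℤ × ℤ // -3 ≤ p.2 - p.1 ∧ p.2 - p.1 ≤ (w : ℤ) + 2}

/-- Entry `F(i,j)` of a function on the strip, extended by the junk value `0` outside. -/
def extF (w : ℕ) (F : SL3Dom w → ℤ) (i j : ℤ) : ℤ :=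
  if h : -3 ≤ j - i ∧ j - i ≤ (w : ℤ) + 2 then F ⟨(i, j), h⟩ else 0

/-- `F` is a tame integral SL₃-frieze of width `w`. -/
def IsSL3Frieze (w : ℕ) (F : SL3Dom w → ℤ) : Prop :=
  (∀ i j : ℤ, (j - i = -3 ∨ j - i = -2 ∨ j - i = (w : ℤ) + 1 ∨ j - i = (w : ℤ) + 2) →
    extF w F i j = 0) ∧
  (∀ i j : ℤ, (j - i = -1 ∨ j - i = (w : ℤ)) → extF w F i j = 1) ∧
  (∀ i j : ℤ, 0 ≤ j - i → j - i ≤ (w : ℤ) - 1 → 1 ≤ extF w F i j) ∧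
  (∀ i j : ℤ, -1 ≤ j - i → j - i ≤ (w : ℤ) →
    Matrix.det (Matrix.of fun a b : Fin 3 =>
      extF w F (i + ((a : ℕ) : ℤ)) (j + ((b : ℕ) : ℤ))) = 1) ∧
  (∀ i j : ℤ, 0 ≤ j - i → j - i ≤ (w : ℤ) - 1 →
    Matrix.det (Matrix.of fun a b : Fin 4 =>
      extF w F (i + ((a : ℕ) : ℤ)) (j + ((b : ℕ) : ℤ))) = 0)

/-- Entry of the frieze with diagonals `a, b, c` in row `i`, at distance `d` from the diagonal. -/
def ent (a b c : ℤ → ℤ) (i d : ℤ) : ℤ :=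
  if d = -1 then 1 else if d = 0 then a i else if d = 1 then b i else if d = 2 then c i
  else if d = 3 then 1 else 0

theorem det4 (f : Fin 4 → Fin 4 → ℤ) :
    Matrix.det (Matrix.of f) =
      f 0 0 * (f 1 1 * (f 2 2 * f 3 3 - f 2 3 * f 3 2) - f 1 2 * (f 2 1 * f 3 3 - f 2 3 * f 3 1)
        + f 1 3 * (f 2 1 * f 3 2 - f 2 2 * f 3 1))
      - f 0 1 * (f 1 0 * (f 2 2 * f 3 3 - f 2 3 * f 3 2) - f 1 2 * (f 2 0 * f 3 3 - f 2 3 * f 3 0)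
        + f 1 3 * (f 2 0 * f 3 2 - f 2 2 * f 3 0))
      + f 0 2 * (f 1 0 * (f 2 1 * f 3 3 - f 2 3 * f 3 1) - f 1 1 * (f 2 0 * f 3 3 - f 2 3 * f 3 0)
        + f 1 3 * (f 2 0 * f 3 1 - f 2 1 * f 3 0))
      - f 0 3 * (f 1 0 * (f 2 1 * f 3 2 - f 2 2 * f 3 1) - f 1 1 * (f 2 0 * f 3 2 - f 2 2 * f 3 0)
        + f 1 2 * (f 2 0 * f 3 1 - f 2 1 * f 3 0)) := by
  rw [Matrix.det_succ_row_zero]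
  simp [Fin.sum_univ_succ, Matrix.det_fin_three, Fin.succAbove]
  ring

/-- The polynomial form of the frieze conditions. -/
structure Diag (a b c : ℤ → ℤ) : Prop where
  pa : ∀ i, 1 ≤ a i
  pb : ∀ i, 1 ≤ b i
  pc : ∀ i, 1 ≤ c i
  d0 : ∀ i, a i * (a (i+1) * a (i+2) - b (i+1)) - b i * a (i+2) + c i = 1
  d1 : ∀ i, b i * (b (i+1) * b (i+2) - c (i+1) * a (i+2)) - c i * (a (i+1) * b (i+2) - c (i+1))
    + (a (i+1) * a (i+2) - b (i+1)) = 1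
  d2 : ∀ i, c i * (c (i+1) * c (i+2) - b (i+2)) - (b (i+1) * c (i+2) - a (i+2)) = 1
  e0 : ∀ i, Matrix.det !![a i, b i, c i, 1; 1, a (i+1), b (i+1), c (i+1);
    0, 1, a (i+2), b (i+2); 0, 0, 1, a (i+3)] = 0
  e1 : ∀ i, Matrix.det !![b i, c i, 1, 0; a (i+1), b (i+1), c (i+1), 1;
    1, a (i+2), b (i+2), c (i+2); 0, 1, a (i+3), b (i+3)] = 0
  e2 : ∀ i, Matrix.det !![c i, 1, 0, 0; b (i+1), c (i+1), 1, 0;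
    a (i+2), b (i+2), c (i+2), 1; 1, a (i+3), b (i+3), c (i+3)] = 0

theorem ent_shift {F : SL3Dom 3 → ℤ} {a b c : ℤ → ℤ}
    (h : ∀ i j, extF 3 F i j = ent a b c i (j - i)) (i k : ℤ) (x y : ℕ) :
    extF 3 F (i + (x : ℤ)) (i + k + (y : ℤ)) = ent a b c (i + x) (k + y - x) := by
  rw [h]; congr 1; ring

theorem frieze_iff (F : SL3Dom 3 → ℤ) (a b c : ℤ → ℤ)
    (h : ∀ i j, extF 3 F i j = ent a b c i (j - i)) : IsSL3Frieze 3 F ↔ Diag a b c := by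
  have hs := ent_shift h
  have key3 : ∀ i k : ℤ, Matrix.det (Matrix.of fun x y : Fin 3 =>
      extF 3 F (i + ((x : ℕ) : ℤ)) (i + k + ((y : ℕ) : ℤ))) =
      Matrix.det (Matrix.of fun x y : Fin 3 =>
        ent a b c (i + ((x : ℕ) : ℤ)) (k + ((y : ℕ) : ℤ) - ((x : ℕ) : ℤ))) := by
    intro i k
    simp only [hs]
  have key4 : ∀ i k : ℤ, Matrix.det (Matrix.of fun x y : Fin 4 =>
      extF 3 F (i + ((x : ℕ) : ℤ)) (i + k + ((y : ℕ) : ℤ))) =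
      Matrix.det (Matrix.of fun x y : Fin 4 =>
        ent a b c (i + ((x : ℕ) : ℤ)) (k + ((y : ℕ) : ℤ) - ((x : ℕ) : ℤ))) := by
    intro i k
    simp only [hs]
  constructor
  · rintro ⟨-, -, h3, h4, h5⟩
    refine ⟨fun i => ?_, fun i => ?_, fun i => ?_, fun i => ?_, fun i => ?_, fun i => ?_,
      fun i => ?_, fun i => ?_, fun i => ?_⟩
    · have := h3 i i (by simp) (by simp)
      rw [h] at this
      simpa [ent] using this
    · have := h3 i (i+1) (by simp) (by simp)
      rw [h] at this
      simpa [ent] using this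
    · have := h3 i (i+2) (by simp) (by norm_num)
      rw [h] at this
      simpa [ent] using this
    · have := h4 i (i+0) (by simp) (by simp)
      rw [key3, Matrix.det_fin_three] at this
      simp [ent] at this
      linarith
    · have := h4 i (i+1) (by simp) (by simp)
      rw [key3, Matrix.det_fin_three] at this
      simp [ent] at this
      linarith
    · have := h4 i (i+2) (by simp) (by simp)
      rw [key3, Matrix.det_fin_three] at this
      simp [ent] at this
      linarith
    · have := h5 i (i+0) (by simp) (by simp)
      rw [key4, det4] at this
      rw [det4]
      simp [ent] at this ⊢
      linarith
    · have := h5 i (i+1) (by simp) (by simp)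
      rw [key4, det4] at this
      rw [det4]
      simp [ent] at this ⊢
      linarith
    · have := h5 i (i+2) (by simp) (by simp)
      rw [key4, det4] at this
      rw [det4]
      simp [ent] at this ⊢
      linarith
  · intro g
    refine ⟨?_, ?_, ?_, ?_, ?_⟩
    · intro i j hij
      rw [h]
      rcases hij with e | e | e | e <;> rw [e] <;> simp [ent]
    · intro i j hij
      rw [h]
      rcases hij with e | e <;> rw [e] <;> simp [ent]
    · intro i j h1 h2
      rw [h]
      have : j - i = 0 ∨ j - i = 1 ∨ j - i = 2 := by push_cast at h2; omega
      rcases this with e | e | e <;> rw [e] <;> simp [ent, g.pa, g.pb, g.pc]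
    · intro i j h1 h2
      obtain ⟨k, rfl⟩ : ∃ k, j = i + k := ⟨j - i, by ring⟩
      have : k = -1 ∨ k = 0 ∨ k = 1 ∨ k = 2 ∨ k = 3 := by push_cast at h2; omega
      rw [key3, Matrix.det_fin_three]
      rcases this with rfl | rfl | rfl | rfl | rfl <;> simp [ent]
      · linarith [g.d0 i]
      · linarith [g.d1 i]
      · linarith [g.d2 i]
    · intro i j h1 h2
      obtain ⟨k, rfl⟩ : ∃ k, j = i + k := ⟨j - i, by ring⟩
      have : k = 0 ∨ k = 1 ∨ k = 2 := by push_cast at h2; omega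
      rw [key4, det4]
      rcases this with rfl | rfl | rfl
      · have := g.e0 i
        rw [det4] at this
        simp [ent] at this ⊢
        linarith
      · have := g.e1 i
        rw [det4] at this
        simp [ent] at this ⊢
        linarith
      · have := g.e2 i
        rw [det4] at this
        simp [ent] at this ⊢
        linarith

/-- Propagation of a linear dependency. -/
theorem propag (p0 p1 p2 p3 q0 q1 q2 q3 r0 r1 r2 r3 s0 s1 s2 s3 α β : ℤ)
    (hp : p0 - β * p1 + α * p2 - p3 = 0) (hq : q0 - β * q1 + α * q2 - q3 = 0)
    (hr : r0 - β * r1 + α * r2 - r3 = 0)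
    (h3 : p0 * (q1 * r2 - q2 * r1) - p1 * (q0 * r2 - q2 * r0) + p2 * (q0 * r1 - q1 * r0) = 1)
    (h4 : Matrix.det !![p0, p1, p2, p3; q0, q1, q2, q3; r0, r1, r2, r3; s0, s1, s2, s3] = 0) :
    s0 - β * s1 + α * s2 - s3 = 0 := by
  obtain rfl : p3 = p0 - β * p1 + α * p2 := by linarith
  obtain rfl : q3 = q0 - β * q1 + α * q2 := by linarith
  obtain rfl : r3 = r0 - β * r1 + α * r2 := by linarith
  rw [det4] at h4
  simp at h4
  linear_combination (-(s0 - β * s1 + α * s2 - s3)) * h3 - h4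

/-- The quadratic relations of a frieze. -/
structure FRel (A B D : ℤ → ℤ) : Prop where
  pA : ∀ i, 1 ≤ A i
  pB : ∀ i, 1 ≤ B i
  pD : ∀ i, 1 ≤ D i
  perA : ∀ i, A (i+7) = A i
  perB : ∀ i, B (i+7) = B i
  perD : ∀ i, D (i+7) = D i
  R1 : ∀ i, A i * A (i+1) = B i + D (i+1)
  R2 : ∀ i, B i * B (i+1) = B (i+4) + D (i+5) * A (i+1)
  R3 : ∀ i, D (i+4) * D (i+5) = B i + A (i+4)
  S1 : ∀ i, A (i+3) * D (i+5) - D (i+3) * B i + A i = 1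
  S2 : ∀ i, D (i+6) = A (i+3) * B (i+1) - D (i+3) * A (i+1) + 1

theorem Diag.frel {a b c : ℤ → ℤ} (g : Diag a b c) : FRel a b (fun i => c (i+2)) := by
  -- column dependencies
  have C : ∀ i, 1 - c i * a (i+3) + (c i * c (i+1) - b (i+1)) * b (i+3) - c (i+3) = 0 ∧
      0 - c i * 1 + (c i * c (i+1) - b (i+1)) * a (i+4) - b (i+4) = 0 ∧
      0 - c i * 0 + (c i * c (i+1) - b (i+1)) * 1 - a (i+5) = 0 := by
    intro i
    have r0 : c i - c i * 1 + (c i * c (i+1) - b (i+1)) * 0 - 0 = 0 := by ring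
    have r1 : b (i+1) - c i * c (i+1) + (c i * c (i+1) - b (i+1)) * 1 - 0 = 0 := by ring
    have r2 : a (i+2) - c i * b (i+2) + (c i * c (i+1) - b (i+1)) * c (i+2) - 1 = 0 := by
      linear_combination g.d2 i
    have r3 := propag _ _ _ _ _ _ _ _ _ _ _ _ _ _ _ _ _ _ r0 r1 r2
      (by linear_combination g.d2 i) (g.e2 i)
    have x1 := g.d1 (i+1)
    have y1 := g.e1 (i+1)
    have x0 := g.d0 (i+2)
    have y0 := g.e0 (i+2)
    simp only [add_assoc] at x1 y1 x0 y0
    norm_num at x1 y1 x0 y0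
    have r4 := propag _ _ _ _ _ _ _ _ _ _ _ _ _ _ _ _ _ _ r1 r2 r3
      (by linear_combination x1) y1
    have r5 := propag _ _ _ _ _ _ _ _ _ _ _ _ _ _ _ _ _ _ r2 r3 r4
      (by linear_combination x0) y0
    exact ⟨r3, r4, r5⟩
  -- row dependencies
  have R : ∀ i, 0 - a i * 1 + (a i * a (i+1) - b i) * c (i+2) - b (i+3) = 0 ∧
      0 - a i * 0 + (a i * a (i+1) - b i) * 1 - c (i+3) = 0 := by
    intro i
    have r0 : a i - a i * 1 + (a i * a (i+1) - b i) * 0 - 0 = 0 := by ring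
    have r1 : b i - a i * a (i+1) + (a i * a (i+1) - b i) * 1 - 0 = 0 := by ring
    have r2 : c i - a i * b (i+1) + (a i * a (i+1) - b i) * a (i+2) - 1 = 0 := by
      linear_combination g.d0 i
    have r3 := propag _ _ _ _ _ _ _ _ _ _ _ _ 1 (c (i+1)) (b (i+2)) (a (i+3)) _ _ r0 r1 r2
      (by linear_combination g.d0 i) (by have := g.e0 i; rw [det4] at this ⊢; simp at this ⊢; linarith)
    have r4 := propag _ _ _ _ _ _ _ _ _ _ _ _ 0 1 (c (i+2)) (b (i+3)) _ _ r1 r2 r3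
      (by linear_combination g.d1 i) (by have := g.e1 i; rw [det4] at this ⊢; simp at this ⊢; linarith)
    have r5 := propag _ _ _ _ _ _ _ _ _ _ _ _ 0 0 1 (c (i+3)) _ _ r2 r3 r4
      (by linear_combination g.d2 i) (by have := g.e2 i; rw [det4] at this ⊢; simp at this ⊢; linarith)
    exact ⟨r4, r5⟩
  have R1 : ∀ i, a i * a (i+1) = b i + c (i+3) := fun i => by linarith [(R i).2]
  have R3 : ∀ i, c i * c (i+1) = b (i+1) + a (i+5) := fun i => by linarith [(C i).2.2]
  have perA : ∀ i, a (i+7) = a i := by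
    intro i
    have h1 := (R i).1
    have h2 := R1 i
    have h3 := R3 (i+2)
    simp only [add_assoc] at h3
    norm_num at h3
    linear_combination h1 + h2 * (-c (i+2)) - h3
  have perC : ∀ i, c (i+7) = c i := by
    intro i
    have h1 := (C i).2.1
    have h2 := R3 i
    have h3 := R1 (i+4)
    simp only [add_assoc] at h3
    norm_num at h3
    linear_combination h1 - h2 * a (i+4) - h3
  have perB : ∀ i, b (i+7) = b i := by
    intro i
    have h1 := R1 i
    have h3 := R1 (i+7)
    have e1 : i + 7 + 1 = (i + 1) + 7 := by ring
    have e2 : i + 7 + 3 = (i + 3) + 7 := by ring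
    rw [e1, e2, perA, perA, perC] at h3
    linarith
  have S1 : ∀ i, a (i+3) * c (i+7) - c (i+5) * b i + a i = 1 := by
    intro i
    have r2 : c i - a i * b (i+1) + (a i * a (i+1) - b i) * a (i+2) - 1 = 0 := by
      linear_combination g.d0 i
    have h1 := g.d2 (i+5)
    have h2 := R3 (i+5)
    have p1 := perA i
    have p2 := perB i
    have p3 := perC i
    have p4 := perA (i+3)
    simp only [add_assoc] at h1 h2 p4
    norm_num at h1 h2 p4
    rw [p4] at h2
    rw [p1, p2] at h1
    linear_combination h1 - h2 * c (i+7)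
  have S2 : ∀ i, c (i+8) = a (i+3) * b (i+1) - c (i+5) * a (i+1) + 1 := by
    intro i
    have h1 := (C (i+5)).1
    have h2 := R3 (i+5)
    have p1 := perA (i+1)
    have p2 := perB (i+1)
    have p4 := perA (i+3)
    simp only [add_assoc] at h1 h2 p1 p2 p4
    norm_num at h1 h2 p1 p2 p4
    rw [p4] at h2
    rw [p1, p2] at h1
    linear_combination -h1 - (-h2) * b (i+1)
  refine ⟨g.pa, g.pb, fun i => g.pc _, perA, perB, ?_, ?_, ?_, ?_, ?_, ?_⟩
  · intro i
    show c (i+7+2) = c (i+2)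
    rw [← perC (i+2)]; congr 1; ring
  · intro i
    have := R1 i
    simp only [add_assoc]
    norm_num
    linarith
  · intro i
    simp only [add_assoc]
    norm_num
    have s := S1 (i+1)
    have t0 := R3 (i+6)
    have t1 := R3 (i+7)
    have t2 := R1 (i+4)
    have p1 := perA (i+4)
    have p2 := perA (i+5)
    have p3 := perB (i)
    have p4 := perB (i+1)
    simp only [add_assoc] at s t0 t1 t2 p1 p2 p3 p4
    norm_num at s t0 t1 t2 p1 p2 p3 p4
    rw [p1, p3] at t0
    rw [p2, p4] at t1
    linear_combination (-b (i+1)) * t0 - c (i+7) * s + a (i+4) * t1 + t2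
  · intro i
    have t0 := R3 (i+6)
    have p1 := perA (i+4)
    have p3 := perB (i)
    simp only [add_assoc] at t0 p1 ⊢
    norm_num at t0 p1 ⊢
    rw [p1, p3] at t0
    exact t0
  · intro i
    have := S1 i
    simp only [add_assoc]
    norm_num
    linarith
  · intro i
    have := S2 i
    simp only [add_assoc]
    norm_num
    linarith
theorem FRel.W1 {A B D : ℤ → ℤ} (h : FRel A B D) (i : ℤ) :
    B i * B (i+2) - 1 = D (i+4) * A (i+5) * D (i+7) - D (i+4) - D (i+7) := by
  have h1 := h.S1 (i+2)
  have h2 := h.R3 i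
  have h3 := h.S2 (i+1)
  simp only [add_assoc] at h1 h2 h3
  norm_num at h1 h2 h3
  linear_combination (-D (i+4)) * h1 - B (i+2) * h2 + h3

theorem FRel.W2 {A B D : ℤ → ℤ} (h : FRel A B D) (i : ℤ) :
    B i * B (i+2) - 1 = A i * D (i+2) * A (i+3) - A i - A (i+3) := by
  have h1 := h.S2 (i-1)
  have h2 := h.R1 (i+2)
  have h3 := h.S1 i
  have e1 : i - 1 + 6 = i + 5 := by ring
  have e2 : i - 1 + 3 = i + 2 := by ring
  have e3 : i - 1 + 1 = i := by ring
  have e4 : i + 2 + 1 = i + 3 := by ring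
  rw [e1, e2, e3] at h1
  rw [e4] at h2
  linear_combination (-A (i+3)) * h1 - B i * h2 + h3

theorem FRel.W3 {A B D : ℤ → ℤ} (h : FRel A B D) (i : ℤ) :
    (B i * B (i+2) - 1) * (B (i+2) * B (i+4) - 1) =
      1 + (A i * D (i+2) - 1) * (D (i+4) * A (i+5) - 1) * B (i+2) := by
  have hW := h.W1 i
  have h1 := h.S1 (i+4)
  have h2 := h.perA i
  have h3 := h.perD (i+2)
  have h4 := h.R1 (i+4)
  have h5 := h.R3 (i+7)
  have h6 := h.perD (i+4)
  have h7 := h.perD (i+5)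
  have h8 := h.perA (i+4)
  have h9 := h.perB i
  have h5' := h.R3 i
  simp only [add_assoc] at h1 h3 h4 h5 h6 h7 h8
  norm_num at h1 h3 h4 h5 h6 h7 h8
  rw [h2, h3] at h1
  linear_combination (B (i+2) * B (i+4)) * hW - B (i+2) * (D (i+4) * A (i+5) - 1) * h1
    + B (i+2) * D (i+4) * h4 + B (i+2) * h5'

/-- The central cluster variables. -/
def zz (B : ℤ → ℤ) (n : ℤ) : ℤ := B (n+3) * B (n+5) - 1

structure ZRel (A B D Z : ℤ → ℤ) : Prop where
  ZE : ∀ n, D n * A (n+1) * D (n+3) = Z n + D n + D (n+3)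
  ZQ : ∀ n, A (n+3) * D (n+5) * A (n+6) = Z n + A (n+3) + A (n+6)
  ZZ : ∀ n, Z n * Z (n+5) = 1 + (A (n+1) * D (n+3) - 1) * (D (n+5) * A (n+6) - 1) * B (n+3)
  BB : ∀ n, B (n+3) * B (n+5) = 1 + Z n
  pZ : ∀ n, 1 ≤ Z n
  pE : ∀ n, 1 ≤ D n * A (n+1) - 1
  pQ : ∀ n, 1 ≤ A n * D (n+2) - 1
  perZ : ∀ n, Z (n+7) = Z n

theorem FRel.zrel {A B D : ℤ → ℤ} (h : FRel A B D) : ZRel A B D (zz B) := by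
  have perZ : ∀ n, zz B (n+7) = zz B n := by
    intro n
    unfold zz
    rw [← h.perB (n+3), ← h.perB (n+5)]
    ring_nf
  have BB : ∀ n, B (n+3) * B (n+5) = 1 + zz B n := fun n => by unfold zz; ring
  have ZE : ∀ n, D n * A (n+1) * D (n+3) = zz B n + D n + D (n+3) := by
    intro n
    have h1 := h.W1 (n+3)
    have h2 := h.perD n
    have h3 := h.perA (n+1)
    have h4 := h.perD (n+3)
    simp only [add_assoc] at h1 h3 h4
    norm_num at h1 h3 h4
    rw [h2, h3, h4] at h1
    unfold zz
    linarith
  have ZQ : ∀ n, A (n+3) * D (n+5) * A (n+6) = zz B n + A (n+3) + A (n+6) := by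
    intro n
    have h1 := h.W2 (n+3)
    simp only [add_assoc] at h1
    norm_num at h1
    unfold zz
    linarith
  have ZZ : ∀ n, zz B n * zz B (n+5) =
      1 + (A (n+1) * D (n+3) - 1) * (D (n+5) * A (n+6) - 1) * B (n+3) := by
    intro n
    have h1 := h.W3 (n+1)
    have h2 := h.perB (n+1)
    have h3 := h.perB (n+3)
    simp only [add_assoc] at h1 h2 h3
    norm_num at h1 h2 h3
    unfold zz
    simp only [add_assoc]
    norm_num
    rw [h2, h3]
    linarith
  have pZ0 : ∀ n, 0 ≤ zz B n := by
    intro n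
    have := mul_le_mul (h.pB (n+3)) (h.pB (n+5)) (by norm_num) (by linarith [h.pB (n+3)])
    linarith [BB n]
  have pE0 : ∀ n, 0 ≤ D n * A (n+1) - 1 := by
    intro n
    have := mul_le_mul (h.pD n) (h.pA (n+1)) (by norm_num) (by linarith [h.pD n])
    linarith
  have pQ0 : ∀ n, 0 ≤ A n * D (n+2) - 1 := by
    intro n
    have := mul_le_mul (h.pA n) (h.pD (n+2)) (by norm_num) (by linarith [h.pA n])
    linarith
  have pZ : ∀ n, 1 ≤ zz B n := by
    intro n
    have h1 := ZZ n
    have h2 := pQ0 (n+1)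
    have h3 := pE0 (n+5)
    have h4 := h.pB (n+3)
    simp only [add_assoc] at h2 h3
    norm_num at h2 h3
    have h5 : 0 ≤ (A (n+1) * D (n+3) - 1) * (D (n+5) * A (n+6) - 1) * B (n+3) := by
      apply mul_nonneg (mul_nonneg _ _) <;> linarith
    rcases (pZ0 n).eq_or_lt with h6 | h6
    · rw [← h6] at h1
      linarith
    · exact h6
  have EQ : ∀ n, (D n * A (n+1) - 1) * (A (n+1) * D (n+3) - 1) = 1 + A (n+1) * zz B n :=
    fun n => by linear_combination A (n+1) * ZE n
  have QE : ∀ n, (A (n+3) * D (n+5) - 1) * (D (n+5) * A (n+6) - 1) = 1 + D (n+5) * zz B n :=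
    fun n => by linear_combination D (n+5) * ZQ n
  refine ⟨ZE, ZQ, ZZ, BB, pZ, ?_, ?_, perZ⟩
  · intro n
    have h1 := EQ n
    have h2 : 0 < A (n+1) * zz B n := mul_pos (by linarith [h.pA (n+1)]) (by linarith [pZ n])
    rcases (pE0 n).eq_or_lt with h6 | h6
    · rw [← h6] at h1
      linarith
    · exact h6
  · intro n
    have h1 := EQ (n-1)
    have e1 : n - 1 + 1 = n := by ring
    have e2 : n - 1 + 3 = n + 2 := by ring
    rw [e1, e2] at h1
    have h2 : 0 < A n * zz B (n-1) := mul_pos (by linarith [h.pA n]) (by linarith [pZ (n-1)])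
    rcases (pQ0 n).eq_or_lt with h6 | h6
    · rw [← h6] at h1
      linarith
    · exact h6

theorem sum_shift (f : ℤ → ℝ) (hf : ∀ n, f (n+7) = f n) (k : ℕ) :
    ∑ n ∈ Finset.range 7, f ((n : ℤ) + k) = ∑ n ∈ Finset.range 7, f (n : ℤ) := by
  induction k with
  | zero => simp
  | succ k ih =>
    rw [← ih]
    have h0 := hf k
    simp only [Finset.sum_range_succ, Finset.sum_range_zero]
    push_cast
    ring_nf at h0 ⊢
    rw [h0]

theorem log_numeric : 2 * Real.log (28/13) + 11 * Real.log (13/12) + 6 * Real.log (144/143) <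
    Real.log 12 := by
  have e : 2 * Real.log (28/13) + 11 * Real.log (13/12) + 6 * Real.log (144/143) =
      Real.log ((28/13)^2 * (13/12)^11 * (144/143)^6) := by
    rw [Real.log_mul (by positivity) (by positivity), Real.log_mul (by positivity) (by positivity),
      Real.log_pow, Real.log_pow, Real.log_pow]
    norm_num
  rw [e]
  apply Real.log_lt_log (by positivity)
  norm_num

theorem exists_small {A B D : ℤ → ℤ} (h : FRel A B D) : ∃ n : ℕ, n < 7 ∧ zz B n ≤ 11 := by
  by_contra hcon
  push Not at hcon
  obtain ⟨ZE, ZQ, ZZ, BB, pZ, pE, pQ, perZ⟩ := h.zrel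
  have hZ : ∀ n ∈ Finset.range 7, (12 : ℝ) ≤ (zz B (n : ℤ) : ℝ) := by
    intro n hn
    have := hcon n (Finset.mem_range.1 hn)
    exact_mod_cast this
  set Z := zz B with hZdef
  have zall : ∀ n : ℤ, 12 ≤ Z n := by
    have step : ∀ k : ℕ, ∀ m : ℤ, Z (m + 7 * k) = Z m := by
      intro k
      induction k with
      | zero => simp
      | succ k ih =>
        intro m
        rw [← ih m, ← perZ (m + 7 * k)]
        push_cast
        ring_nf
    intro n
    have h1 : Z n = Z (n % 7) := by
      rcases le_or_gt 0 (n / 7) with hq | hq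
      · rw [← step (n / 7).toNat (n % 7), Int.toNat_of_nonneg hq]
        congr 1; omega
      · rw [← step (-(n / 7)).toNat n, Int.toNat_of_nonneg (by omega)]
        congr 1; omega
    have h2 := hcon (n % 7).toNat (by omega)
    rw [Int.toNat_of_nonneg (by omega)] at h2
    rw [h1]
    exact h2
  -- logarithms
  let lA : ℤ → ℝ := fun n => Real.log (A n)
  let lB : ℤ → ℝ := fun n => Real.log (B n)
  let lD : ℤ → ℝ := fun n => Real.log (D n)
  let lZ : ℤ → ℝ := fun n => Real.log (Z n)
  let lE : ℤ → ℝ := fun n => Real.log ((D n * A (n+1) - 1 : ℤ) : ℝ)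
  let lQ : ℤ → ℝ := fun n => Real.log ((A n * D (n+2) - 1 : ℤ) : ℝ)
  have rA : ∀ n, (1 : ℝ) ≤ A n := fun n => by exact_mod_cast h.pA n
  have rB : ∀ n, (1 : ℝ) ≤ B n := fun n => by exact_mod_cast h.pB n
  have rD : ∀ n, (1 : ℝ) ≤ D n := fun n => by exact_mod_cast h.pD n
  have rZ : ∀ n, (12 : ℝ) ≤ Z n := fun n => by exact_mod_cast zall n
  have rE : ∀ n, (1 : ℝ) ≤ ((D n * A (n+1) - 1 : ℤ) : ℝ) := fun n => by exact_mod_cast pE n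
  have rQ : ∀ n, (1 : ℝ) ≤ ((A n * D (n+2) - 1 : ℤ) : ℝ) := fun n => by exact_mod_cast pQ n
  have tQ : ∀ n, ((A n * D (n+2) - 1 : ℤ) : ℝ) = A n * D (n+2) - 1 := fun n => by push_cast; ring
  have tE : ∀ n, ((D n * A (n+1) - 1 : ℤ) : ℝ) = D n * A (n+1) - 1 := fun n => by push_cast; ring
  have EQ : ∀ n, ((D n * A (n+1) - 1 : ℤ) : ℝ) * ((A (n+1) * D (n+1+2) - 1 : ℤ) : ℝ)
      = 1 + A (n+1) * Z n := by
    intro n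
    have e : n + 1 + 2 = n + 3 := by ring
    rw [e]
    have : (D n * A (n+1) - 1) * (A (n+1) * D (n+3) - 1) = 1 + A (n+1) * Z n := by
      linear_combination A (n+1) * ZE n
    exact_mod_cast this
  have QE : ∀ n, ((A (n+3) * D (n+3+2) - 1 : ℤ) : ℝ) * ((D (n+5) * A (n+5+1) - 1 : ℤ) : ℝ)
      = 1 + D (n+5) * Z n := by
    intro n
    have e : n + 3 + 2 = n + 5 := by ring
    have e' : n + 5 + 1 = n + 6 := by ring
    rw [e, e']
    have : (A (n+3) * D (n+5) - 1) * (D (n+5) * A (n+6) - 1) = 1 + D (n+5) * Z n := by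
      linear_combination D (n+5) * ZQ n
    exact_mod_cast this
  have ZZr : ∀ n, (Z n : ℝ) * Z (n+5) = 1 + ((A (n+1) * D (n+1+2) - 1 : ℤ) : ℝ) *
      ((D (n+5) * A (n+5+1) - 1 : ℤ) : ℝ) * B (n+3) := by
    intro n
    have e : n + 1 + 2 = n + 3 := by ring
    have e' : n + 5 + 1 = n + 6 := by ring
    rw [e, e']
    exact_mod_cast ZZ n
  have BBr : ∀ n, (B (n+3) : ℝ) * B (n+5) = 1 + Z n := fun n => by exact_mod_cast BB n
  have n0 : ∀ {x : ℝ}, 1 ≤ x → x ≠ 0 := fun hx => by linarith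
  have n12 : ∀ {x : ℝ}, 12 ≤ x → x ≠ 0 := fun hx => by linarith
  have I1 : ∀ n, lD n + 2 * lA (n+1) + lD (n+3) ≤ lE n + lQ (n+1) + Real.log (28/13) := by
    intro n
    have hl : lD n + 2 * lA (n+1) + lD (n+3) =
        Real.log ((D n * A (n+1)) * (A (n+1) * D (n+3))) := by
      rw [Real.log_mul (mul_ne_zero (n0 (rD _)) (n0 (rA _)))
        (mul_ne_zero (n0 (rA _)) (n0 (rD _))), Real.log_mul (n0 (rD _)) (n0 (rA _)),
        Real.log_mul (n0 (rA _)) (n0 (rD _))]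
      simp only [lD, lA]
      ring
    have hr : lE n + lQ (n+1) + Real.log (28/13) =
        Real.log (((D n * A (n+1) - 1 : ℤ) : ℝ) * ((A (n+1) * D (n+1+2) - 1 : ℤ) : ℝ)
          * (28/13)) := by
      rw [Real.log_mul (mul_ne_zero (n0 (rE _)) (n0 (rQ _))) (by norm_num),
        Real.log_mul (n0 (rE _)) (n0 (rQ _))]
    rw [hl, hr]
    have pD0 := rD n
    have pD3 := rD (n+3)
    have pA1 := rA (n+1)
    apply Real.log_le_log (by positivity)
    have hE := rE n
    have hQ := rQ (n+1)
    have hEQ := EQ n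
    have hAZ : 12 ≤ (A (n+1) : ℝ) * Z n := by nlinarith [rZ n]
    have e : n + 1 + 2 = n + 3 := by ring
    have t1 : (D n : ℝ) * A (n+1) = ((D n * A (n+1) - 1 : ℤ) : ℝ) + 1 := by rw [tE]; ring
    have t2 : (A (n+1) : ℝ) * D (n+3) = ((A (n+1) * D (n+1+2) - 1 : ℤ) : ℝ) + 1 := by
      rw [tQ, e]; ring
    rw [t1, t2]
    nlinarith
  have I2 : ∀ n, lE n + lQ (n+1) ≤ lA (n+1) + lZ n + Real.log (13/12) := by
    intro n
    have hl : lE n + lQ (n+1) = Real.log (1 + A (n+1) * Z n) := by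
      rw [← EQ, Real.log_mul (n0 (rE _)) (n0 (rQ _))]
    have hr : lA (n+1) + lZ n + Real.log (13/12) = Real.log (A (n+1) * Z n * (13/12)) := by
      rw [Real.log_mul (mul_ne_zero (n0 (rA _)) (n12 (rZ _))) (by norm_num),
        Real.log_mul (n0 (rA _)) (n12 (rZ _))]
    rw [hl, hr]
    have hAZ : 12 ≤ (A (n+1) : ℝ) * Z n := by nlinarith [rZ n, rA (n+1)]
    exact Real.log_le_log (by linarith) (by linarith)
  have I3 : ∀ n, lQ (n+3) + lE (n+5) ≤ lD (n+5) + lZ n + Real.log (13/12) := by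
    intro n
    have hl : lQ (n+3) + lE (n+5) = Real.log (1 + D (n+5) * Z n) := by
      rw [← QE, Real.log_mul (n0 (rQ _)) (n0 (rE _))]
    have hr : lD (n+5) + lZ n + Real.log (13/12) = Real.log (D (n+5) * Z n * (13/12)) := by
      rw [Real.log_mul (mul_ne_zero (n0 (rD _)) (n12 (rZ _))) (by norm_num),
        Real.log_mul (n0 (rD _)) (n12 (rZ _))]
    rw [hl, hr]
    have hAZ : 12 ≤ (D (n+5) : ℝ) * Z n := by nlinarith [rZ n, rD (n+5)]
    exact Real.log_le_log (by linarith) (by linarith)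
  have I4 : ∀ n, lZ n + lZ (n+5) ≤ lQ (n+1) + lE (n+5) + lB (n+3) + Real.log (144/143) := by
    intro n
    have hz := ZZr n
    have hl : lZ n + lZ (n+5) = Real.log (Z n * Z (n+5)) := by
      rw [Real.log_mul (n12 (rZ _)) (n12 (rZ _))]
    have hr : lQ (n+1) + lE (n+5) + lB (n+3) + Real.log (144/143) =
        Real.log (((A (n+1) * D (n+1+2) - 1 : ℤ) : ℝ) *
      ((D (n+5) * A (n+5+1) - 1 : ℤ) : ℝ) * B (n+3) * (144/143)) := by
      rw [Real.log_mul (mul_ne_zero (mul_ne_zero (n0 (rQ _)) (n0 (rE _))) (n0 (rB _)))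
        (by norm_num), Real.log_mul (mul_ne_zero (n0 (rQ _)) (n0 (rE _))) (n0 (rB _)),
        Real.log_mul (n0 (rQ _)) (n0 (rE _))]
    rw [hl, hr]
    have hAZ : 144 ≤ (Z n : ℝ) * Z (n+5) := by nlinarith [rZ n, rZ (n+5)]
    exact Real.log_le_log (by linarith) (by linarith)
  have I5 : ∀ n, lB (n+3) + lB (n+5) ≤ lZ n + Real.log (13/12) := by
    intro n
    have hl : lB (n+3) + lB (n+5) = Real.log (1 + Z n) := by
      rw [← BBr, Real.log_mul (n0 (rB _)) (n0 (rB _))]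
    have hr : lZ n + Real.log (13/12) = Real.log (Z n * (13/12)) := by
      rw [Real.log_mul (n12 (rZ _)) (by norm_num)]
    rw [hl, hr]
    exact Real.log_le_log (by linarith [rZ n]) (by linarith [rZ n])
  have I6 : ∀ n, Real.log 12 ≤ lZ n := fun n => Real.log_le_log (by norm_num) (rZ n)
  have perlA : ∀ n, lA (n+7) = lA n := fun n => by simp only [lA, h.perA]
  have perlB : ∀ n, lB (n+7) = lB n := fun n => by simp only [lB, h.perB]
  have perlD : ∀ n, lD (n+7) = lD n := fun n => by simp only [lD, h.perD]
  have perlZ : ∀ n, lZ (n+7) = lZ n := fun n => by simp only [lZ, perZ]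
  have perlE : ∀ n, lE (n+7) = lE n := fun n => by
    have e : n + 7 + 1 = n + 1 + 7 := by ring
    simp only [lE, e, h.perA, h.perD]
  have perlQ : ∀ n, lQ (n+7) = lQ n := fun n => by
    have e : n + 7 + 2 = n + 2 + 7 := by ring
    simp only [lQ, e, h.perA, h.perD]
  have J1 := Finset.sum_le_sum fun (n : ℕ) (_ : n ∈ Finset.range 7) => I1 n
  have J2 := Finset.sum_le_sum fun (n : ℕ) (_ : n ∈ Finset.range 7) => I2 n
  have J3 := Finset.sum_le_sum fun (n : ℕ) (_ : n ∈ Finset.range 7) => I3 n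
  have J4 := Finset.sum_le_sum fun (n : ℕ) (_ : n ∈ Finset.range 7) => I4 n
  have J5 := Finset.sum_le_sum fun (n : ℕ) (_ : n ∈ Finset.range 7) => I5 n
  have J6 := Finset.sum_le_sum fun (n : ℕ) (_ : n ∈ Finset.range 7) => I6 n
  have cA1 := sum_shift lA perlA 1
  have cD3 := sum_shift lD perlD 3
  have cD5 := sum_shift lD perlD 5
  have cQ1 := sum_shift lQ perlQ 1
  have cQ3 := sum_shift lQ perlQ 3
  have cE5 := sum_shift lE perlE 5
  have cZ5 := sum_shift lZ perlZ 5
  have cB3 := sum_shift lB perlB 3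
  have cB5 := sum_shift lB perlB 5
  push_cast at cA1 cD3 cD5 cQ1 cQ3 cE5 cZ5 cB3 cB5
  simp only [Finset.sum_add_distrib, ← Finset.mul_sum, Finset.sum_const, Finset.card_range,
    nsmul_eq_mul, cA1, cD3, cD5, cQ1, cQ3, cE5, cZ5, cB3, cB5] at J1 J2 J3 J4 J5 J6
  have := log_numeric
  push_cast at J1 J2 J3 J4 J5 J6
  linarith
/-- All triples `(p,q,r)` with `p q r = z + p + r` and `p, q ≤ 13`. -/
def triples (z : ℕ) : List (ℕ × ℕ × ℕ) :=
  (List.range 14).flatMap fun p => (List.range 14).flatMap fun q =>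
    if Nat.ble 2 (p * q) then
      if Nat.beq ((z + p) % (p * q - 1)) 0 then [(p, q, (z + p) / (p * q - 1))] else []
    else []

/-- Divisors `u` of `z + 1`. -/
def divs (z : ℕ) : List ℕ :=
  (List.range 13).filter fun u => Nat.ble 1 u && Nat.beq ((z + 1) % u) 0

/-- Evaluation-forcing application (to help the kernel). -/
def fN {α : Type} (n : ℕ) (k : ℕ → α) : α :=
  match n with
  | 0 => k 0
  | m + 1 => k (m + 1)

theorem fN_eq {α : Type} (n : ℕ) (k : ℕ → α) : fN n k = k n := by
  cases n <;> rfl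

/-- One knitting step, in continuation passing style. -/
def stepK (q r t v u z : ℕ) (k : ℕ → ℕ → ℕ → ℕ → List (List ℕ)) : List (List ℕ) :=
  if Nat.beq ((1 + (q * r - 1) * (t * v - 1) * u) % z) 0 then
    fN ((1 + (q * r - 1) * (t * v - 1) * u) / z) fun z' =>
    fN ((z' + t) / (t * v - 1)) fun r' =>
    fN ((z' + q) / (q * r - 1)) fun v' =>
    fN ((1 + z') / u) fun u' => k r' v' u' z'
  else []

def gA (l : List ℕ) (i : ℕ) : ℕ := l.getD (i % 7) 0
def gD (l : List ℕ) (i : ℕ) : ℕ := l.getD (7 + i % 7) 0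
def gB (l : List ℕ) (i : ℕ) : ℕ := gA l i * gA l (i + 1) - gD l (i + 1)

/-- The local relations of a frieze. -/
def chk (l : List ℕ) : Bool :=
  Nat.beq l.length 14 && (List.range 7).all fun i =>
    Nat.ble 1 (gA l i) && Nat.ble 1 (gB l i) && Nat.ble 1 (gD l i) &&
    Nat.beq (gA l i * gA l (i + 1)) (gB l i + gD l (i + 1)) &&
    Nat.beq (gD l (i + 4) * gD l (i + 5)) (gB l i + gA l (i + 4)) &&
    Nat.beq (gB l i * gB l (i + 1)) (gB l (i + 4) + gD l (i + 5) * gA l (i + 1))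

/-- All entries from the initial ones. -/
def knit (d0 a1 d3 a3 d5 a6 b3 z0 : ℕ) : List (List ℕ) :=
  stepK a1 d3 d5 a6 b3 z0 fun d1 a4 b1 z5 =>
  stepK a6 d1 d3 a4 b1 z5 fun d6 a2 b6 z3 =>
  stepK a4 d6 d1 a2 b6 z3 fun d4 a0 b4 z1 =>
  stepK a2 d4 d6 a0 b4 z1 fun d2 a5 _ _ =>
    [[a0, a1, a2, a3, a4, a5, a6, d0, d1, d2, d3, d4, d5, d6]]

/-- The friezes with `Z₀ ≤ 11`. -/
def base : List (List ℕ) :=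
  (List.range 12).flatMap fun z => if Nat.beq z 0 then [] else
    (triples z).flatMap fun x => (triples z).flatMap fun y => (divs z).flatMap fun u =>
      knit x.1 x.2.1 x.2.2 y.1 y.2.1 y.2.2 u z

def rot1 : List ℕ → List ℕ
  | [a0, a1, a2, a3, a4, a5, a6, d0, d1, d2, d3, d4, d5, d6] =>
    [a6, a0, a1, a2, a3, a4, a5, d6, d0, d1, d2, d3, d4, d5]
  | l => l

def Zof (l : List ℕ) : ℕ := gD l 0 * gA l 1 * gD l 3 - (gD l 0 + gD l 3)

def rots : ℕ → List ℕ → List (List ℕ)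
  | 0, l => if chk l then [l] else []
  | n + 1, l => if chk l then
      l :: (if Nat.ble (Zof (rot1 l)) 11 then [] else rots n (rot1 l)) else []

/-- All friezes. -/
def allW : List (List ℕ) := base.flatMap (rots 6)

def enc (l : List ℕ) : ℕ := l.foldl (fun s x => s * 32 + x) 0

def forceL : List ℕ → (List ℕ → Bool) → Bool
  | [], k => k []
  | x :: xs, k => fN x fun x' => forceL xs fun xs' => k (x' :: xs')

def nodupB : List ℕ → Bool
  | [] => true
  | x :: xs => xs.all (fun y => !Nat.beq x y) && nodupB xs

/-- Partition in continuation passing style. -/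
def part (p : ℕ → Bool) : List ℕ → (List ℕ → List ℕ → Bool) → Bool
  | [], k => k [] []
  | x :: xs, k => part p xs fun y n => if p x then k (x :: y) n else k y (x :: n)

/-- Radix test for absence of duplicates. -/
def nodupR : ℕ → List ℕ → Bool
  | 0, l => nodupB l
  | n + 1, l => part (fun x => Nat.beq (x % 1009 / 2 ^ n % 2) 0) l fun y z =>
      nodupR n y && nodupR n z

theorem big_check :
    forceL (allW.map enc) (fun l => Nat.beq l.length 868 && nodupR 7 l) = true := by
  decide +kernel
theorem desn (x : Fin 4 → Fin 4 → ℤ)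
    (m1 : x 1 1 * (x 2 2 * x 3 3 - x 2 3 * x 3 2) - x 1 2 * (x 2 1 * x 3 3 - x 2 3 * x 3 1)
        + x 1 3 * (x 2 1 * x 3 2 - x 2 2 * x 3 1) = 1)
    (m2 : x 0 0 * (x 1 1 * x 2 2 - x 1 2 * x 2 1) - x 0 1 * (x 1 0 * x 2 2 - x 1 2 * x 2 0)
        + x 0 2 * (x 1 0 * x 2 1 - x 1 1 * x 2 0) = 1)
    (m3 : x 1 0 * (x 2 1 * x 3 2 - x 2 2 * x 3 1) - x 1 1 * (x 2 0 * x 3 2 - x 2 2 * x 3 0)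
        + x 1 2 * (x 2 0 * x 3 1 - x 2 1 * x 3 0) = 1)
    (m4 : x 0 1 * (x 1 2 * x 2 3 - x 1 3 * x 2 2) - x 0 2 * (x 1 1 * x 2 3 - x 1 3 * x 2 1)
        + x 0 3 * (x 1 1 * x 2 2 - x 1 2 * x 2 1) = 1)
    (hc : x 1 1 * x 2 2 - x 1 2 * x 2 1 ≠ 0) : Matrix.det (Matrix.of x) = 0 := by
  apply mul_left_cancel₀ hc
  rw [mul_zero, det4]
  linear_combination (x 0 0 * (x 1 1 * x 2 2 - x 1 2 * x 2 1)
    - x 0 1 * (x 1 0 * x 2 2 - x 1 2 * x 2 0)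
    + x 0 2 * (x 1 0 * x 2 1 - x 1 1 * x 2 0)) * m1 + m2
    - (x 0 1 * (x 1 2 * x 2 3 - x 1 3 * x 2 2) - x 0 2 * (x 1 1 * x 2 3 - x 1 3 * x 2 1)
        + x 0 3 * (x 1 1 * x 2 2 - x 1 2 * x 2 1)) * m3 - m4

/-- The local relations imply the frieze conditions. -/
theorem diag_of_rel {A B D : ℤ → ℤ} (pA : ∀ i, 1 ≤ A i) (pB : ∀ i, 1 ≤ B i) (pD : ∀ i, 1 ≤ D i)
    (perA : ∀ i, A (i+7) = A i) (perB : ∀ i, B (i+7) = B i) (perD : ∀ i, D (i+7) = D i)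
    (R1 : ∀ i, A i * A (i+1) = B i + D (i+1))
    (R2 : ∀ i, B i * B (i+1) = B (i+4) + D (i+5) * A (i+1))
    (R3 : ∀ i, D (i+4) * D (i+5) = B i + A (i+4)) : Diag A B (fun i => D (i+5)) := by
  have d0 : ∀ i, A i * (A (i+1) * A (i+2) - B (i+1)) - B i * A (i+2) + D (i+5) = 1 := by
    intro i
    have h1 := R1 i
    have h2 := R1 (i+1)
    have h3 := R2 i
    have h4 := R3 (i+4)
    have h5 := perD (i+1)
    have h6 := perD (i+2)
    have h7 := perA (i+1)
    simp only [add_assoc] at *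
    norm_num at *
    rw [h5, h6, h7] at h4
    have := pA (i+1)
    apply mul_left_cancel₀ (show A (i+1) ≠ 0 by omega)
    linear_combination (A (i+1) * A (i+2) - B (i+1)) * h1 - h3 + D (i+1) * h2 + h4
  have d1 : ∀ i, B i * (B (i+1) * B (i+2) - D (i+6) * A (i+2))
      - D (i+5) * (A (i+1) * B (i+2) - D (i+6)) + (A (i+1) * A (i+2) - B (i+1)) = 1 := by
    intro i
    have h1 := R2 i
    have h2 := R2 (i+1)
    have h3 := R1 (i+1)
    have h4 := R3 (i+1)
    have h5 := R2 (i+4)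
    have h6 := perB (i+1)
    have h7 := perD (i+2)
    simp only [add_assoc] at *
    norm_num at *
    rw [h6, h7] at h5
    have := pB (i+1)
    apply mul_left_cancel₀ (show B (i+1) ≠ 0 by omega)
    linear_combination (B (i+1) * B (i+2) - D (i+6) * A (i+2)) * h1 + B (i+4) * h2
      + (B (i+1) - D (i+5) * D (i+6)) * h3 - D (i+2) * h4 + h5
  have d2 : ∀ i, D (i+5) * (D (i+6) * D i - B (i+2)) - (B (i+1) * D i - A (i+2)) = 1 := by
    intro i
    have h1 := R3 (i+1)
    have h2 := R3 (i+2)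
    have h3 := R2 (i+1)
    have h4 := R1 (i+5)
    have h5 := perD i
    simp only [add_assoc] at *
    norm_num at *
    rw [h5] at h2
    have := pD (i+6)
    apply mul_left_cancel₀ (show D (i+6) ≠ 0 by omega)
    linear_combination (D (i+6) * D i - B (i+2)) * h1 + A (i+5) * h2 - h3 + h4
  have k0 : ∀ i, A (i+1) * A (i+2) - B (i+1) = D (i+2) := by
    intro i
    have h1 := R1 (i+1)
    simp only [add_assoc] at *
    norm_num at *
    linarith
  have k1 : ∀ i, B (i+1) * B (i+2) - D (i+6) * A (i+2) = B (i+5) := by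
    intro i
    have h1 := R2 (i+1)
    simp only [add_assoc] at *
    norm_num at *
    linarith
  have k2 : ∀ i, D (i+6) * D i - B (i+2) = A (i+6) := by
    intro i
    have h1 := R3 (i+2)
    have h5 := perD i
    simp only [add_assoc] at *
    norm_num at *
    rw [h5] at h1
    linarith
  have e2 : ∀ i, D (i+2+5) = D i := fun i => by rw [add_assoc]; exact perD i
  have e3 : ∀ i, D (i+3+5) = D (i+1) := fun i => by
    rw [← perD (i+1)]; congr 1; ring
  have e1 : ∀ i, D (i+1+5) = D (i+6) := fun i => by congr 1; ring
  have s2 : ∀ i : ℤ, i+1+1 = i+2 := fun i => by ring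
  have s3 : ∀ i : ℤ, i+1+2 = i+3 := fun i => by ring
  have s6 : ∀ i, D (i+1+6) = D i := fun i => by
    rw [← perD i]; congr 1; ring
  refine ⟨pA, pB, fun i => pD _, d0, ?_, ?_, ?_, ?_, ?_⟩
  · intro i; simp only [e1]; exact d1 i
  · intro i; simp only [e1, e2]; exact d2 i
  · intro i
    have t0 := d0 i
    have t0' := d0 (i+1)
    have t1 := d1 i
    have hk := k0 i
    have hp := pD (i+2)
    simp only [e1, e2, e3, s2, s3] at *
    apply desn <;> simp <;> linarith
  · intro i
    have t0 := d1 i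
    have t0' := d1 (i+1)
    have t1 := d0 (i+1)
    have t2 := d2 i
    have hk := k1 i
    have hp := pB (i+5)
    simp only [e1, e2, e3, s2, s3, s6] at *
    apply desn <;> simp <;> linarith
  · intro i
    have t0 := d2 i
    have t0' := d2 (i+1)
    have t1 := d1 (i+1)
    have hk := k2 i
    have hp := pA (i+6)
    simp only [e1, e2, e3, s2, s3, s6] at *
    apply desn <;> simp <;> linarith
theorem forceL_eq (l : List ℕ) (k : List ℕ → Bool) : forceL l k = k l := by
  induction l generalizing k with
  | nil => rfl
  | cons x xs ih => rw [forceL, fN_eq, ih]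

theorem part_eq (p : ℕ → Bool) (l : List ℕ) (k : List ℕ → List ℕ → Bool) :
    part p l k = k (l.filter p) (l.filter fun x => !p x) := by
  induction l generalizing k with
  | nil => rfl
  | cons x xs ih =>
    rw [part, ih]
    cases h : p x <;> simp [h]

theorem nodupB_sound (l : List ℕ) (h : nodupB l = true) : l.Nodup := by
  induction l with
  | nil => simp
  | cons x xs ih =>
    simp only [nodupB, Bool.and_eq_true, List.all_eq_true] at h
    refine List.nodup_cons.2 ⟨fun hx => ?_, ih h.2⟩
    have := h.1 x hx
    simp at this

theorem nodup_of_filter (p : ℕ → Bool) (l : List ℕ) (h1 : (l.filter p).Nodup)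
    (h2 : (l.filter fun x => !p x).Nodup) : l.Nodup := by
  induction l with
  | nil => simp
  | cons x xs ih =>
    cases h : p x
    · simp [h] at h1 h2
      exact List.nodup_cons.2 ⟨fun hx => h2.1 hx, ih h1 h2.2⟩
    · simp [h] at h1 h2
      exact List.nodup_cons.2 ⟨fun hx => h1.1 hx, ih h1.2 h2⟩

theorem nodupR_sound (n : ℕ) (l : List ℕ) (h : nodupR n l = true) : l.Nodup := by
  induction n generalizing l with
  | zero => exact nodupB_sound l h
  | succ n ih =>
    rw [nodupR, part_eq, Bool.and_eq_true] at h
    exact nodup_of_filter _ l (ih _ h.1) (ih _ h.2)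

theorem allW_facts : allW.Nodup ∧ allW.length = 868 := by
  have h := big_check
  rw [forceL_eq, Bool.and_eq_true] at h
  refine ⟨List.Nodup.of_map enc (nodupR_sound _ _ h.2), ?_⟩
  have := Nat.eq_of_beq_eq_true h.1
  rwa [List.length_map] at this

theorem chk_iff (l : List ℕ) : chk l = true ↔ l.length = 14 ∧ ∀ i < 7,
    1 ≤ gA l i ∧ 1 ≤ gB l i ∧ 1 ≤ gD l i ∧
    gA l i * gA l (i + 1) = gB l i + gD l (i + 1) ∧
    gD l (i + 4) * gD l (i + 5) = gB l i + gA l (i + 4) ∧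
    gB l i * gB l (i + 1) = gB l (i + 4) + gD l (i + 5) * gA l (i + 1) := by
  simp only [chk, Bool.and_eq_true, List.all_eq_true, List.mem_range, Nat.beq_eq, Nat.ble_eq,
    and_assoc]

/-- Fourteen consecutive entries of a frieze. -/
def keyS (A D : ℤ → ℤ) (n : ℤ) : List ℕ :=
  [(A n).toNat, (A (n+1)).toNat, (A (n+2)).toNat, (A (n+3)).toNat, (A (n+4)).toNat,
    (A (n+5)).toNat, (A (n+6)).toNat, (D n).toNat, (D (n+1)).toNat, (D (n+2)).toNat,
    (D (n+3)).toNat, (D (n+4)).toNat, (D (n+5)).toNat, (D (n+6)).toNat]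

theorem mod_aux (i : ℤ) (k : ℕ) : ((i + k) % 7).toNat % 7 = ((i % 7).toNat + k) % 7 := by omega

theorem gA_mod (l : List ℕ) (m n : ℕ) (h : m % 7 = n % 7) : gA l m = gA l n := by
  simp only [gA, h]
theorem gD_mod (l : List ℕ) (m n : ℕ) (h : m % 7 = n % 7) : gD l m = gD l n := by
  simp only [gD, h]
theorem gB_mod (l : List ℕ) (m n : ℕ) (h : m % 7 = n % 7) : gB l m = gB l n := by
  simp only [gB, gA_mod l m n h, gA_mod l (m+1) (n+1) (by omega),
    gD_mod l (m+1) (n+1) (by omega)]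

theorem diag_of_chk (l : List ℕ) (h : chk l = true) :
    ∃ A B D : ℤ → ℤ, Diag A B (fun i => D (i+5)) ∧ (∀ i, D (i+7) = D i) ∧ keyS A D 0 = l := by
  rw [chk_iff] at h
  obtain ⟨hl, h⟩ := h
  let A : ℤ → ℤ := fun i => (gA l (i % 7).toNat : ℤ)
  let B : ℤ → ℤ := fun i => (gB l (i % 7).toNat : ℤ)
  let D : ℤ → ℤ := fun i => (gD l (i % 7).toNat : ℤ)
  have eA : ∀ (i : ℤ) (k : ℕ), A (i + k) = (gA l ((i % 7).toNat + k) : ℤ) := fun i k => by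
    show (gA l _ : ℤ) = _
    rw [gA_mod _ _ _ (mod_aux i k)]
  have eB : ∀ (i : ℤ) (k : ℕ), B (i + k) = (gB l ((i % 7).toNat + k) : ℤ) := fun i k => by
    show (gB l _ : ℤ) = _
    rw [gB_mod _ _ _ (mod_aux i k)]
  have eD : ∀ (i : ℤ) (k : ℕ), D (i + k) = (gD l ((i % 7).toNat + k) : ℤ) := fun i k => by
    show (gD l _ : ℤ) = _
    rw [gD_mod _ _ _ (mod_aux i k)]
  have hi : ∀ i : ℤ, (i % 7).toNat < 7 := fun i => by omega
  have m7 : ∀ i : ℤ, (i + 7) % 7 = i % 7 := fun i => by omega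
  have perD : ∀ i, D (i+7) = D i := fun i => by simp only [D, m7]
  refine ⟨A, B, D, ?_, perD, ?_⟩
  · apply diag_of_rel
    · intro i; have := (h _ (hi i)).1; simp only [A]; exact_mod_cast this
    · intro i; have := (h _ (hi i)).2.1; simp only [B]; exact_mod_cast this
    · intro i; have := (h _ (hi i)).2.2.1; simp only [D]; exact_mod_cast this
    · intro i; simp only [A, m7]
    · intro i; simp only [B, m7]
    · exact perD
    · intro i
      have := (h _ (hi i)).2.2.2.1
      have e1 := eA i 1
      have e2 := eD i 1
      push_cast at e1 e2
      rw [e1, e2]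
      simp only [A, B]
      exact_mod_cast this
    · intro i
      have := (h _ (hi i)).2.2.2.2.2
      have e1 := eB i 1
      have e2 := eB i 4
      have e3 := eD i 5
      have e4 := eA i 1
      push_cast at e1 e2 e3 e4
      rw [e1, e2, e3, e4]
      simp only [B]
      exact_mod_cast this
    · intro i
      have := (h _ (hi i)).2.2.2.2.1
      have e1 := eD i 4
      have e2 := eD i 5
      have e3 := eA i 4
      push_cast at e1 e2 e3
      rw [e1, e2, e3]
      simp only [B]
      exact_mod_cast this
  · simp only [keyS, A, D]
    clear eA eB eD h m7 hi perD
    clear A B D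
    match l, hl with
    | [x0, x1, x2, x3, x4, x5, x6, x7, x8, x9, x10, x11, x12, x13], _ =>
      simp [gA, gD]

/-- The frieze with given diagonals. -/
def mkF (a b c : ℤ → ℤ) : SL3Dom 3 → ℤ := fun p => ent a b c p.1.1 (p.1.2 - p.1.1)

theorem extF_mkF (a b c : ℤ → ℤ) (i j : ℤ) : extF 3 (mkF a b c) i j = ent a b c i (j - i) := by
  unfold extF
  split_ifs with h
  · rfl
  · unfold ent
    push_cast at h
    split_ifs <;> first | rfl | (exfalso; omega)

/-- Diagonals of a frieze. -/
def dA (F : SL3Dom 3 → ℤ) (i : ℤ) : ℤ := extF 3 F i i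
def dB (F : SL3Dom 3 → ℤ) (i : ℤ) : ℤ := extF 3 F i (i+1)
def dC (F : SL3Dom 3 → ℤ) (i : ℤ) : ℤ := extF 3 F i (i+2)
def dD (F : SL3Dom 3 → ℤ) (i : ℤ) : ℤ := dC F (i+2)

theorem extF_frieze {F : SL3Dom 3 → ℤ} (h : IsSL3Frieze 3 F) (i j : ℤ) :
    extF 3 F i j = ent (dA F) (dB F) (dC F) i (j - i) := by
  obtain ⟨h1, h2, -⟩ := h
  push_cast at h1 h2
  unfold ent
  split_ifs with g1 g2 g3 g4 g5
  · exact h2 _ _ (Or.inl g1)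
  · rw [show j = i by omega]; rfl
  · rw [show j = i+1 by omega]; rfl
  · rw [show j = i+2 by omega]; rfl
  · exact h2 _ _ (Or.inr g5)
  · by_cases h : -3 ≤ j - i ∧ j - i ≤ 5
    · exact h1 _ _ (by omega)
    · unfold extF
      rw [dif_neg (by push_cast; omega)]

theorem frieze_frel {F : SL3Dom 3 → ℤ} (h : IsSL3Frieze 3 F) : FRel (dA F) (dB F) (dD F) :=
  ((frieze_iff F _ _ _ (extF_frieze h)).1 h).frel

/-- The key of a frieze. -/
def keyF (F : SL3Dom 3 → ℤ) : List ℕ := keyS (dA F) (dD F) 0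

theorem exists_of_chk (l : List ℕ) (h : chk l = true) :
    ∃ F, IsSL3Frieze 3 F ∧ keyF F = l := by
  obtain ⟨A, B, D, g, per, hk⟩ := diag_of_chk l h
  refine ⟨mkF A B (fun i => D (i+5)), (frieze_iff _ _ _ _ (extF_mkF _ _ _)).2 g, ?_⟩
  have e1 : dA (mkF A B (fun i => D (i+5))) = A := by
    funext i; simp [dA, extF_mkF, ent]
  have e2 : dD (mkF A B (fun i => D (i+5))) = D := by
    funext i
    rw [← per i]
    simp only [dD, dC, extF_mkF, ent]
    simp
    congr 1; ring
  rw [keyF, e1, e2, hk]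

theorem per_mod {f : ℤ → ℤ} (h : ∀ i, f (i+7) = f i) (i : ℤ) : f i = f (i % 7) := by
  have : Function.Periodic f 7 := h
  conv_lhs => rw [← Int.emod_add_mul_ediv i 7]
  have := this.int_mul (i / 7) (i % 7)
  rw [← this]; congr 1; push_cast; ring

theorem keyF_inj {F G : SL3Dom 3 → ℤ} (hF : IsSL3Frieze 3 F) (hG : IsSL3Frieze 3 G)
    (h : keyF F = keyF G) : F = G := by
  have f := frieze_frel hF
  have g := frieze_frel hG
  simp only [keyF, keyS, List.cons.injEq, zero_add, and_true] at h
  have inj : ∀ {x y : ℤ}, 1 ≤ x → 1 ≤ y → x.toNat = y.toNat → x = y := by intros; omega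
  obtain ⟨a0, a1, a2, a3, a4, a5, a6, d0, d1, d2, d3, d4, d5, d6⟩ := h
  have eA : ∀ i, dA F i = dA G i := by
    intro i
    rw [per_mod f.perA i, per_mod g.perA i]
    have h0 : 0 ≤ i % 7 := by omega
    have h7 : i % 7 < 7 := by omega
    generalize i % 7 = r at *
    apply inj (f.pA _) (g.pA _)
    interval_cases r <;> assumption
  have eD : ∀ i, dD F i = dD G i := by
    intro i
    rw [per_mod f.perD i, per_mod g.perD i]
    have h0 : 0 ≤ i % 7 := by omega
    have h7 : i % 7 < 7 := by omega
    generalize i % 7 = r at *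
    apply inj (f.pD _) (g.pD _)
    interval_cases r <;> assumption
  have eB : ∀ i, dB F i = dB G i := by
    intro i
    have h1 := f.R1 i
    have h2 := g.R1 i
    rw [eA, eA, eD] at h1
    linarith
  have eC : ∀ i, dC F i = dC G i := by
    intro i
    have := eD (i-2)
    simpa [dD] using this
  funext p
  obtain ⟨⟨i, j⟩, hp⟩ := p
  have h1 := extF_frieze hF i j
  have h2 := extF_frieze hG i j
  have : extF 3 F i j = extF 3 G i j := by
    rw [h1, h2, funext eA, funext eB, funext eC]
  unfold extF at this
  rwa [dif_pos hp, dif_pos hp] at this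
theorem stepK_eq {q r t v u z r' v' u' z' : ℤ} (k : ℕ → ℕ → ℕ → ℕ → List (List ℕ))
    (hq : 1 ≤ q) (hr : 1 ≤ r) (ht : 1 ≤ t) (hv : 1 ≤ v) (hu : 1 ≤ u) (hz : 1 ≤ z)
    (hr' : 1 ≤ r') (hv' : 1 ≤ v') (hu' : 1 ≤ u') (hz' : 1 ≤ z')
    (hqr : 1 ≤ q * r - 1) (htv : 1 ≤ t * v - 1)
    (h1 : z * z' = 1 + (q * r - 1) * (t * v - 1) * u)
    (h2 : t * v * r' = z' + t + r') (h3 : v' * q * r = z' + v' + q)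
    (h4 : u' * u = 1 + z') :
    stepK q.toNat r.toNat t.toNat v.toNat u.toNat z.toNat k =
      k r'.toNat v'.toNat u'.toNat z'.toNat := by
  lift q to ℕ using by omega
  lift r to ℕ using by omega
  lift t to ℕ using by omega
  lift v to ℕ using by omega
  lift u to ℕ using by omega
  lift z to ℕ using by omega
  lift r' to ℕ using by omega
  lift v' to ℕ using by omega
  lift u' to ℕ using by omega
  lift z' to ℕ using by omega
  simp only [Int.toNat_natCast]
  obtain ⟨e, he⟩ : ∃ e : ℕ, q * r = e + 1 := ⟨q * r - 1, by zify at *; omega⟩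
  obtain ⟨f, hf⟩ : ∃ f : ℕ, t * v = f + 1 := ⟨t * v - 1, by zify at *; omega⟩
  have he' : (q : ℤ) * r = e + 1 := by exact_mod_cast he
  have hf' : (t : ℤ) * v = f + 1 := by exact_mod_cast hf
  rw [he'] at h1 hqr
  rw [hf'] at h1 h2 htv
  have g1 : 1 + e * f * u = z * z' := by zify; linear_combination -h1
  have g2 : z' + t = f * r' := by zify; linear_combination -h2
  have g3 : z' + q = e * v' := by zify; linear_combination v' * he' - h3
  have g4 : 1 + z' = u * u' := by zify; linear_combination -h4
  have pe : 0 < e := by omega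
  have pf : 0 < f := by omega
  have pz : 0 < z := by omega
  have pu : 0 < u := by omega
  unfold stepK
  simp only [he, hf, Nat.add_sub_cancel, g1, fN_eq, Nat.mul_mod_right, Nat.beq_eq,
    Nat.mul_div_cancel_left _ pz, g2, g3, g4, Nat.mul_div_cancel_left _ pf,
    Nat.mul_div_cancel_left _ pe, Nat.mul_div_cancel_left _ pu, if_true]

theorem mem_triples {p q r z : ℤ} (hp : 1 ≤ p) (hq : 1 ≤ q) (hr : 1 ≤ r) (hz : z ≤ 11)
    (hz1 : 1 ≤ z) (hpq : 1 ≤ p * q - 1) (hqr : 1 ≤ q * r - 1) (h : p * q * r = z + p + r) :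
    (p.toNat, q.toNat, r.toNat) ∈ triples z.toNat := by
  have h1 : (p * q - 1) * r = z + p := by linarith
  have h2 : p * (q * r - 1) = z + r := by linarith
  have p13 : p ≤ 13 := by
    by_contra hc
    rcases le_or_gt q 1 with hq1 | hq1
    · have : q = 1 := by omega
      subst this
      have : (p - 1) * (r - 1) = z + 1 := by linarith
      have : 2 ≤ r := by linarith
      nlinarith
    · nlinarith
  have q13 : q ≤ 13 := by
    by_contra hc
    rcases le_or_gt p 1 with hp1 | hp1
    · have : p = 1 := by omega
      subst this
      nlinarith
    · have : 2 ≤ p := hp1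
      nlinarith [mul_le_mul hr (le_refl p) (by omega) (by omega)]
  lift p to ℕ using by omega
  lift q to ℕ using by omega
  lift r to ℕ using by omega
  lift z to ℕ using by omega
  simp only [Int.toNat_natCast]
  obtain ⟨e, he⟩ : ∃ e : ℕ, p * q = e + 1 := ⟨p * q - 1, by zify at *; omega⟩
  have he' : (p : ℤ) * q = e + 1 := by exact_mod_cast he
  have g1 : z + p = e * r := by zify; rw [← h1, he']; ring
  have pe : 0 < e := by rw [he'] at hpq; omega
  simp only [triples, List.mem_flatMap, List.mem_range]
  refine ⟨p, by omega, q, by omega, ?_⟩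
  rw [if_pos (by rw [Nat.ble_eq, he]; omega), he, Nat.add_sub_cancel, g1,
    Nat.mul_div_cancel_left _ pe, Nat.mul_mod_right]
  simp

theorem mem_divs {u w z : ℤ} (hu : 1 ≤ u) (hw : 1 ≤ w) (hz : z ≤ 11) (hz1 : 1 ≤ z)
    (h : u * w = 1 + z) : u.toNat ∈ divs z.toNat := by
  have : u ≤ 12 := by nlinarith
  lift u to ℕ using by omega
  lift w to ℕ using by omega
  lift z to ℕ using by omega
  simp only [Int.toNat_natCast]
  have g : z + 1 = u * w := by zify; linarith
  simp only [divs, List.mem_filter, List.mem_range, g, Nat.mul_mod_right, Bool.and_eq_true,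
    Nat.ble_eq, Nat.beq_eq, and_true]
  omega

section fw
variable {A B D : ℤ → ℤ}

theorem FRel.knit_eq (h : FRel A B D) (n : ℤ) :
    knit (D n).toNat (A (n+1)).toNat (D (n+3)).toNat (A (n+3)).toNat (D (n+5)).toNat
      (A (n+6)).toNat (B (n+3)).toNat (zz B n).toNat = [keyS A D n] := by
  have Z := h.zrel
  have pA := h.pA
  have pB := h.pB
  have pD := h.pD
  have pE := Z.pE
  have pQ := Z.pQ
  have pZ := Z.pZ
  have step : ∀ (m : ℤ) (k : ℕ → ℕ → ℕ → ℕ → List (List ℕ)),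
      stepK (A (m+1)).toNat (D (m+3)).toNat (D (m+5)).toNat (A (m+6)).toNat (B (m+3)).toNat
        (zz B m).toNat k =
      k (D (m+1)).toNat (A (m+4)).toNat (B (m+1)).toNat (zz B (m+5)).toNat := by
    intro m k
    have e1 : D (m+5+3) = D (m+1) := by rw [← h.perD (m+1)]; congr 1; ring
    have e2 : A (m+5+3) = A (m+1) := by rw [← h.perA (m+1)]; congr 1; ring
    have e3 : D (m+5+5) = D (m+3) := by rw [← h.perD (m+3)]; congr 1; ring
    have e4 : A (m+5+6) = A (m+4) := by rw [← h.perA (m+4)]; congr 1; ring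
    have e5 : B (m+5+3) = B (m+1) := by rw [← h.perB (m+1)]; congr 1; ring
    have e6 : B (m+5+5) = B (m+3) := by rw [← h.perB (m+3)]; congr 1; ring
    have e7 : A (m+5+1) = A (m+6) := by congr 1; ring
    have e8 : A (m+1) * D (m+1+2) = A (m+1) * D (m+3) := by congr 2; ring
    have h2 := Z.ZE (m+5)
    have h3 := Z.ZQ (m+5)
    have h4 := Z.BB (m+5)
    have h5 := pE (m+5)
    have h6 := pQ (m+1)
    rw [e7, e1] at h2
    rw [e2, e3, e4] at h3
    rw [e5, e6] at h4
    rw [e7] at h5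
    rw [e8] at h6
    exact stepK_eq k (pA _) (pD _) (pD _) (pA _) (pB _) (pZ _) (pD _) (pA _) (pB _) (pZ _) h6 h5
      (Z.ZZ m) h2 (by linarith) h4
  have zA : ∀ m m' : ℤ, m = m' + 7 → A m = A m' := fun m m' e => by rw [e, h.perA]
  have zB : ∀ m m' : ℤ, m = m' + 7 → B m = B m' := fun m m' e => by rw [e, h.perB]
  have zD : ∀ m m' : ℤ, m = m' + 7 → D m = D m' := fun m m' e => by rw [e, h.perD]
  have s1 := step (n+5)
  have s2 := step (n+3)
  have s3 := step (n+1)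
  have z1 : zz B (n+3+5) = zz B (n+1) := by rw [← Z.perZ (n+1)]; congr 1; ring
  rw [zA (n+5+4) (n+2) (by ring), zB (n+5+3) (n+1) (by ring), zD (n+5+3) (n+1) (by ring),
    zD (n+5+5) (n+3) (by ring), zA (n+5+6) (n+4) (by ring)] at s1
  rw [zA (n+3+4) n (by ring), zD (n+3+5) (n+1) (by ring), zA (n+3+6) (n+2) (by ring), z1] at s2
  rw [zA (n+1+6) n (by ring)] at s3
  have z3 : zz B (n+5+5) = zz B (n+3) := by rw [← Z.perZ (n+3)]; congr 1; ring
  rw [z3] at s1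
  simp only [add_assoc] at s1 s2 s3
  norm_num at s1 s2 s3
  unfold knit
  rw [step n, s1, s2, s3]
  rfl

theorem FRel.mem_base (h : FRel A B D) (n : ℤ) (hn : zz B n ≤ 11) : keyS A D n ∈ base := by
  have Z := h.zrel
  have pz := Z.pZ n
  simp only [base, List.mem_flatMap, List.mem_range]
  refine ⟨(zz B n).toNat, by omega, ?_⟩
  rw [if_neg (by rw [Nat.beq_eq]; omega)]
  simp only [List.mem_flatMap]
  have q1 := Z.pQ (n+1)
  have q2 := Z.pQ (n+3)
  have q3 := Z.pE (n+5)
  simp only [add_assoc] at q1 q2 q3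
  norm_num at q1 q2 q3
  refine ⟨_, mem_triples (h.pD n) (h.pA (n+1)) (h.pD (n+3)) hn pz (Z.pE n) (by omega) (Z.ZE n),
    _, mem_triples (h.pA (n+3)) (h.pD (n+5)) (h.pA (n+6)) hn pz (by omega) (by omega) (Z.ZQ n),
    _, mem_divs (h.pB (n+3)) (h.pB (n+5)) hn pz (Z.BB n), ?_⟩
  rw [h.knit_eq n]
  simp

theorem FRel.rot (h : FRel A B D) (n : ℤ) : rot1 (keyS A D (n+1)) = keyS A D n := by
  have e1 : A (n+1+6) = A n := by rw [← h.perA n]; congr 1; ring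
  have e2 : D (n+1+6) = D n := by rw [← h.perD n]; congr 1; ring
  simp only [keyS, rot1, e1, e2]
  simp only [add_assoc]
  norm_num

theorem FRel.Zof_key (h : FRel A B D) (n : ℤ) : Zof (keyS A D n) = (zz B n).toNat := by
  have Z := h.zrel
  have h1 := Z.ZE n
  have h2 := h.pD n
  have h3 := h.pA (n+1)
  have h4 := h.pD (n+3)
  have h5 := Z.pZ n
  simp only [Zof, keyS, gA, gD]
  simp
  generalize D n = x at *
  generalize A (n+1) = y at *
  generalize D (n+3) = w at *
  generalize zz B n = z at *
  lift x to ℕ using by omega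
  lift y to ℕ using by omega
  lift w to ℕ using by omega
  lift z to ℕ using by omega
  simp only [Int.toNat_natCast]
  have : x * y * w = z + x + w := by exact_mod_cast h1
  omega

theorem FRel.chk_key (h : FRel A B D) (n : ℤ) : chk (keyS A D n) = true := by
  rw [chk_iff]
  refine ⟨rfl, ?_⟩
  have cA : ∀ i : ℤ, ((A i).toNat : ℤ) = A i := fun i => Int.toNat_of_nonneg (by have := h.pA i; omega)
  have cD : ∀ i : ℤ, ((D i).toNat : ℤ) = D i := fun i => Int.toNat_of_nonneg (by have := h.pD i; omega)
  have kA0 : ∀ k : ℕ, k < 7 → (gA (keyS A D n) k : ℤ) = A (n + k) := by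
    intro k hk
    interval_cases k <;> simp [gA, keyS, cA]
  have kD0 : ∀ k : ℕ, k < 7 → (gD (keyS A D n) k : ℤ) = D (n + k) := by
    intro k hk
    interval_cases k <;> simp [gD, keyS, cD]
  have kA : ∀ k : ℕ, (gA (keyS A D n) k : ℤ) = A (n + k) := by
    intro k
    rw [gA_mod _ k (k % 7) (by omega), kA0 _ (by omega), per_mod h.perA (n+k),
      per_mod h.perA (n + (k % 7 : ℕ))]
    congr 1; omega
  have kD : ∀ k : ℕ, (gD (keyS A D n) k : ℤ) = D (n + k) := by
    intro k
    rw [gD_mod _ k (k % 7) (by omega), kD0 _ (by omega), per_mod h.perD (n+k),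
      per_mod h.perD (n + (k % 7 : ℕ))]
    congr 1; omega
  have kB : ∀ k : ℕ, (gB (keyS A D n) k : ℤ) = B (n + k) := by
    intro k
    have h1 := kA k
    have h2 := kA (k+1)
    have h3 := kD (k+1)
    have h4 := h.R1 (n+k)
    have h5 := h.pB (n+k)
    push_cast at h2 h3
    rw [← add_assoc] at h2 h3
    rw [← h1, ← h2, ← h3] at h4
    unfold gB
    rw [Nat.cast_sub]
    · push_cast; linarith
    · zify; linarith
  intro i _
  zify
  simp only [kA, kB, kD]
  push_cast
  simp only [← add_assoc]
  exact ⟨h.pA _, h.pB _, h.pD _, h.R1 _, h.R3 _, h.R2 _⟩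

theorem FRel.mem_rots (h : FRel A B D) (i m : ℕ) (him : i ≤ m)
    (hz : ∀ j < i, 11 < zz B j) : keyS A D 0 ∈ rots m (keyS A D i) := by
  induction i generalizing m with
  | zero =>
    cases m <;> simp [rots, h.chk_key]
  | succ i ih =>
    obtain ⟨m, rfl⟩ : ∃ k, m = k + 1 := ⟨m - 1, by omega⟩
    push_cast
    rw [rots, h.rot, if_pos (h.chk_key _), h.Zof_key, if_neg]
    · exact List.mem_cons_of_mem _ (ih m (by omega) fun j hj => hz j (by omega))
    · rw [Nat.ble_eq]
      have := hz i (by omega)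
      omega

theorem FRel.mem_allW (h : FRel A B D) : keyS A D 0 ∈ allW := by
  have ex := exists_small h
  classical
  have hs := Nat.find_spec ex
  have hm := fun j => Nat.find_min (m := j) ex
  generalize Nat.find ex = i at hs hm
  refine List.mem_flatMap.2 ⟨keyS A D i, h.mem_base _ hs.2, h.mem_rots i 6 (by omega) ?_⟩
  intro j hj
  have := hm j hj
  have h7 : j < 7 := by omega
  simp only [h7, true_and] at this
  omega

end fw

theorem chk_of_rots (m : ℕ) (l k : List ℕ) (h : k ∈ rots m l) : chk k = true := by
  induction m generalizing l with
  | zero =>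
    rw [rots] at h
    split_ifs at h with hc
    · simp at h; rw [h]; exact hc
    · simp at h
  | succ m ih =>
    rw [rots] at h
    split_ifs at h with hc hd
    · simp at h; rw [h]; exact hc
    · rcases List.mem_cons.1 h with h | h
      · rw [h]; exact hc
      · exact ih _ h
    · simp at h

theorem image_key : Set.image keyF {F : SL3Dom 3 → ℤ | IsSL3Frieze 3 F} =
    (allW.toFinset : Set (List ℕ)) := by
  ext l
  simp only [Set.mem_image, Set.mem_ofPred_eq, List.coe_toFinset]
  constructor
  · rintro ⟨F, hF, rfl⟩
    exact (frieze_frel hF).mem_allW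
  · intro h
    obtain ⟨k, -, hk⟩ := List.mem_flatMap.1 h
    exact exists_of_chk l (chk_of_rots _ _ _ hk)

theorem statement9 :
    {F : SL3Dom 3 → ℤ | IsSL3Frieze 3 F}.Finite ∧
    {F : SL3Dom 3 → ℤ | IsSL3Frieze 3 F}.ncard = 868 := by
  have inj : Set.InjOn keyF {F : SL3Dom 3 → ℤ | IsSL3Frieze 3 F} :=
    fun F hF G hG h => keyF_inj hF hG h
  constructor
  · apply Set.Finite.of_finite_image _ inj
    rw [image_key]
    exact Finset.finite_toSet _
  · rw [← Set.InjOn.ncard_image inj, image_key, Set.ncard_coe_finset,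
      List.toFinset_card_of_nodup allW_facts.1, allW_facts.2]
end

section
/- Let k, n be integers with 2 ≤ k ≤ n/2. Let A(k,n) be the ℂ-subalgebra of the polynomial ring ℂ[x_{cd} : 1 ≤ c ≤ k, 1 ≤ d ≤ n] generated by all maximal minors P(I) of the generic k × n matrix (x_{cd}), where I ranges over all k-subsets of ℤ/nℤ. Then the ideal J of A(k,n) generated by the set {P(I) − 1 : I a consecutive k-subset of ℤ/nℤ} is a prime ideal; equivalently, the quotient ring A(k,n)/J is an integral domain. -/
/-- Representative of `x : ZMod n` in `{1, …, n}`. -/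
def rep (n : ℕ) (x : ZMod n) : ℕ := if x.val = 0 then n else x.val

/-- The cyclic segment `[r]^ℓ = {r, r+1, …, r+ℓ-1}` in `ZMod n`. -/
def cSeg (n : ℕ) (r : ZMod n) (ℓ : ℕ) : Finset (ZMod n) :=
  (Finset.range ℓ).image (fun t : ℕ => r + (t : ZMod n))

/-- The cyclic closed interval `[a,b] = {a, a+1, …, b}` in `ZMod n`. -/
def cIcc (n : ℕ) (a b : ZMod n) : Finset (ZMod n) := cSeg n a ((b - a).val + 1)

/-- The Plücker coordinate `P(I)`: the determinant of the `k × k` submatrix of `M` on the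
columns indexed by `I`, taken in increasing order of the representatives in `{1,…,n}`;
it is `0` if `I` is not a `k`-subset. -/
noncomputable def pluck {R : Type*} [CommRing R] {k n : ℕ}
    (M : Matrix (Fin k) (ZMod n) R) (I : Finset (ZMod n)) : R :=
  if h : (I.image (rep n)).card = k ∧ I.card = k then
    Matrix.det (Matrix.of fun i j : Fin k =>
      M i ((((I.image (rep n)).orderIsoOfFin h.1 j : ℕ) : ZMod n)))
  else 0

/-- The generic `k × n` matrix of indeterminates. -/
noncomputable def genericM (k n : ℕ) :
    Matrix (Fin k) (ZMod n) (MvPolynomial (Fin k × ZMod n) ℂ) :=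
  fun c d => MvPolynomial.X (c, d)

/-- The homogeneous coordinate ring `A(k,n)` of the Grassmannian: the `ℂ`-subalgebra of
the polynomial ring generated by the maximal minors `P(I)` of the generic `k × n` matrix,
for `I` ranging over the `k`-subsets of `ZMod n`. -/
noncomputable def grA (k n : ℕ) : Subalgebra ℂ (MvPolynomial (Fin k × ZMod n) ℂ) :=
  Algebra.adjoin ℂ
    {x | ∃ I : Finset (ZMod n), I.card = k ∧ x = pluck (genericM k n) I}

lemma pluck_mem_grA (k n : ℕ) (I : Finset (ZMod n)) :
    pluck (genericM k n) I ∈ grA k n := by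
  by_cases h : (I.image (rep n)).card = k ∧ I.card = k
  · exact Algebra.subset_adjoin ⟨I, h.2, rfl⟩
  · rw [pluck, dif_neg h]
    exact zero_mem _

/-- The Plücker coordinate `P(I)` as an element of `A(k,n)`. -/
noncomputable def grP (k n : ℕ) (I : Finset (ZMod n)) : grA k n :=
  ⟨pluck (genericM k n) I, pluck_mem_grA k n I⟩

/-- The ideal `J` of `A(k,n)` generated by `P(I) - 1` for `I` a consecutive `k`-subset. -/
noncomputable def grJ (k n : ℕ) : Ideal (grA k n) :=
  Ideal.span {y | ∃ r : ZMod n, y = grP k n (cSeg n r k) - 1}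


theorem adjoinRoot_linear_domain {R : Type} [CommRing R] [IsDomain R] (a b : R) (ha : a ≠ 0)
    (hb : b ≠ 0) (H : ∀ f, b ∣ a * f → b ∣ f) :
    IsDomain (AdjoinRoot (Polynomial.C a * Polynomial.X - Polynomial.C b)) := by
  have reg : ∀ g, a ∣ b * g → a ∣ g := by
    rintro g ⟨h, hh⟩
    obtain ⟨c, hc⟩ := H h ⟨g, hh.symm⟩
    refine ⟨c, mul_left_cancel₀ hb ?_⟩
    rw [hh, hc]; ring
  have regp : ∀ (n : ℕ) g, a ∣ b ^ n * g → a ∣ g := by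
    intro n
    induction n with
    | zero => intro g h; simpa using h
    | succ n ih =>
      intro g h
      apply ih
      apply reg
      rw [pow_succ] at h
      convert h using 1; ring
  set K := FractionRing R with hK
  let e : Polynomial R →+* K := Polynomial.eval₂RingHom (algebraMap R K)
    (algebraMap R K b / algebraMap R K a)
  have ha' : algebraMap R K a ≠ 0 := by
    simpa using ha
  set ℓ := (Polynomial.C a * Polynomial.X - Polynomial.C b) with hℓ
  have heℓ : e ℓ = 0 := by
    simp only [e, hℓ, Polynomial.coe_eval₂RingHom, Polynomial.eval₂_sub, Polynomial.eval₂_mul,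
      Polynomial.eval₂_C, Polynomial.eval₂_X]
    rw [mul_div_cancel₀ _ ha', sub_self]
  have key : ∀ (d : ℕ) (h : Polynomial R), h.natDegree ≤ d → e h = 0 → ℓ ∣ h := by
    intro d
    induction d with
    | zero =>
      intro h hd he
      rw [Polynomial.eq_C_of_natDegree_le_zero hd] at he ⊢
      have : h.coeff 0 = 0 := by simpa [e] using he
      rw [this]; simp
    | succ d ih =>
      intro h hd he
      have h1 : a ∣ h.coeff (d+1) := by
        apply regp (d+1)
        have hsum : h = ∑ i ∈ Finset.range (d+2), Polynomial.C (h.coeff i) * Polynomial.X ^ i :=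
          h.as_sum_range_C_mul_X_pow' (by omega)
        have h2 : ∑ i ∈ Finset.range (d+2), h.coeff i * b ^ i * a ^ (d+1-i) = 0 := by
          apply IsFractionRing.injective R K
          rw [map_zero, ← mul_zero ((algebraMap R K a)^(d+1)), ← he]
          conv_rhs => rw [hsum]
          rw [map_sum, map_sum, Finset.mul_sum]
          apply Finset.sum_congr rfl
          intro i hi
          have hi' : i ≤ d+1 := by simp at hi; omega
          simp only [e, Polynomial.coe_eval₂RingHom, Polynomial.eval₂_mul,
            Polynomial.eval₂_C, Polynomial.eval₂_X, map_mul, map_pow, Polynomial.eval₂_pow]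
          obtain ⟨j, hj⟩ := Nat.exists_eq_add_of_le hi'
          rw [hj, Nat.add_sub_cancel_left, pow_add, div_pow]
          have h5 := mul_div_cancel₀ ((algebraMap R K b) ^ i) (pow_ne_zero i ha')
          linear_combination (-(algebraMap R K (h.coeff i) * (algebraMap R K a) ^ j)) * h5
        rw [Finset.sum_range_succ] at h2
        have h3 : b ^ (d+1) * h.coeff (d+1) =
            - ∑ i ∈ Finset.range (d+1), h.coeff i * b ^ i * a ^ (d+1-i) := by
          simp at h2
          linear_combination h2
        rw [h3]
        apply (dvd_neg).2
        apply Finset.dvd_sum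
        intro i hi
        simp at hi
        apply Dvd.dvd.mul_left
        exact dvd_pow_self a (by omega)
      obtain ⟨c, hc⟩ := h1
      have h4 : ℓ ∣ h - ℓ * (Polynomial.C c * Polynomial.X ^ d) := by
        apply ih
        · rw [Polynomial.natDegree_le_iff_coeff_eq_zero]
          intro N hN
          have hexp : ℓ * (Polynomial.C c * Polynomial.X ^ d) =
              Polynomial.C (a * c) * Polynomial.X ^ (d+1) - Polynomial.C (b*c) * Polynomial.X ^ d := by
            rw [hℓ]; simp only [map_mul]; ring
          rw [hexp]
          simp only [Polynomial.coeff_sub, Polynomial.coeff_C_mul, Polynomial.coeff_X_pow]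
          by_cases hN1 : N = d+1
          · subst hN1; simp [hc]
          · have : h.coeff N = 0 := Polynomial.coeff_eq_zero_of_natDegree_lt (by omega)
            simp [this, hN1, show N ≠ d by omega]
        · rw [map_sub, map_mul, heℓ, he]; simp
      have := dvd_add h4 (Dvd.intro (Polynomial.C c * Polynomial.X ^ d) rfl : ℓ ∣ ℓ * (Polynomial.C c * Polynomial.X ^ d))
      simpa using this
  have hker : Ideal.span {ℓ} = RingHom.ker e := by
    ext h
    rw [Ideal.mem_span_singleton, RingHom.mem_ker]
    refine ⟨?_, fun h0 => key _ h le_rfl h0⟩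
    rintro ⟨c, rfl⟩
    rw [map_mul, heℓ, zero_mul]
  have hp : (Ideal.span {ℓ}).IsPrime := by
    rw [hker]; exact RingHom.ker_isPrime e
  exact (Ideal.Quotient.isDomain_iff_prime _).2 hp


namespace GrPf

/-- the sign `(-1)^κ` -/
def eps (κ : ℕ) (R : Type*) [CommRing R] : R := (-1) ^ κ

/-- prepend a new first column, dropping the last one -/
def upd {κ : ℕ} {R : Type*} [CommRing R] (M : Matrix (Fin (κ+1)) (Fin (κ+1)) R) (x : Fin κ → R) :
    Matrix (Fin (κ+1)) (Fin (κ+1)) R :=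
  Matrix.of fun i => Fin.cons (M.mulVec (Fin.snoc x (eps κ R)) i) (fun j => M i j.castSucc)

/-- parameters -/
@[ext] structure Pt (κ : ℕ) (R : Type*) where
  a : ℕ → Fin κ → R
  p : Fin (κ+1) → Fin (κ+1) → R
  q : Fin (κ+1) → Fin (κ+1) → R
  t : Fin (κ+1) → R

/-- push forward of parameters -/
def Pt.map {κ : ℕ} {R S : Type*} (P : Pt κ R) (f : R → S) : Pt κ S :=
  ⟨fun m x => f (P.a m x), fun i j => f (P.p i j), fun i j => f (P.q i j), fun j => f (P.t j)⟩

/-- product of companion matrices -/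
def gM {κ : ℕ} {R : Type*} [CommRing R] (a : ℕ → Fin κ → R) :
    ℕ → Matrix (Fin (κ+1)) (Fin (κ+1)) R
  | 0 => 1
  | m+1 => upd (gM a m) (a m)

def upM {κ : ℕ} {R : Type*} [CommRing R] (p : Fin (κ+1) → Fin (κ+1) → R) :
    Matrix (Fin (κ+1)) (Fin (κ+1)) R :=
  Matrix.of fun i j => if i = j then 1 else if i < j then p i j else 0

def loM {κ : ℕ} {R : Type*} [CommRing R] (q : Fin (κ+1) → Fin (κ+1) → R) (t : Fin (κ+1) → R) :
    Matrix (Fin (κ+1)) (Fin (κ+1)) R :=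
  Matrix.of fun l j => if l = j then 1 else if j < l then
    (if l = Fin.last κ then t j else q l j) else 0

def Wm {κ : ℕ} {R : Type*} [CommRing R] (s : ℕ) (P : Pt κ R) :
    Matrix (Fin (κ+1)) (Fin (κ+1)) R :=
  gM P.a s * upM P.p * loM P.q P.t

def base {κ : ℕ} {R : Type*} [CommRing R] (m : ℕ) (W : Matrix (Fin (κ+1)) (Fin (κ+1)) R) :
    Matrix (Fin (κ+1)) (Fin (κ+1)) R :=
  Matrix.of fun r l => if (l : ℕ) < m then W r l else if r = l then 1 else 0

def aelt {κ : ℕ} {R : Type*} [CommRing R] (i : Fin (κ+1)) (W : Matrix (Fin (κ+1)) (Fin (κ+1)) R) : R :=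
  ((base i W).updateCol i (fun r => W r (Fin.last κ))).det

def Sat {κ : ℕ} {R : Type*} [CommRing R] (s i : ℕ) (P : Pt κ R) : Prop :=
  ∀ m ≤ i, (base m (Wm s P)).det = eps κ R ^ m

lemma Pt.map_map {κ : ℕ} {R S T : Type*} (P : Pt κ R) (f : R → S) (g : S → T) :
    (P.map f).map g = P.map (g ∘ f) := rfl

section nat
variable {κ : ℕ} {R S : Type*} [CommRing R] [CommRing S] (f : R →+* S)

lemma map_eps : f (eps κ R) = eps κ S := by simp [eps]

lemma upd_map (M : Matrix (Fin (κ+1)) (Fin (κ+1)) R) (x : Fin κ → R) :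
    (upd M x).map f = upd (M.map f) (fun j => f (x j)) := by
  ext i j
  refine Fin.cases ?_ (fun j => ?_) j
  · simp only [upd, Matrix.map_apply, Matrix.of_apply, Fin.cons_zero, Matrix.mulVec, dotProduct,
      map_sum, map_mul]
    apply Finset.sum_congr rfl
    intro l _
    congr 1
    refine Fin.lastCases ?_ (fun l => ?_) l
    · simp [map_eps f]
    · simp
  · simp [upd]

lemma gM_map (a : ℕ → Fin κ → R) (m : ℕ) :
    (gM a m).map f = gM (fun m x => f (a m x)) m := by
  induction m with
  | zero => simp [gM]
  | succ m ih => simp [gM, upd_map, ih]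

lemma upM_map (p : Fin (κ+1) → Fin (κ+1) → R) :
    (upM p).map f = upM (fun i j => f (p i j)) := by
  ext i j
  simp only [upM, Matrix.map_apply, Matrix.of_apply]
  split_ifs <;> simp

lemma loM_map (q : Fin (κ+1) → Fin (κ+1) → R) (t : Fin (κ+1) → R) :
    (loM q t).map f = loM (fun i j => f (q i j)) (fun j => f (t j)) := by
  ext i j
  simp only [loM, Matrix.map_apply, Matrix.of_apply]
  split_ifs <;> simp

lemma Wm_map (s : ℕ) (P : Pt κ R) : Wm s (P.map f) = (Wm s P).map f := by
  simp only [Wm, Matrix.map_mul, gM_map, upM_map, loM_map, Pt.map]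

lemma base_map (m : ℕ) (W : Matrix (Fin (κ+1)) (Fin (κ+1)) R) :
    base m (W.map f) = (base m W).map f := by
  ext i j
  simp only [base, Matrix.map_apply, Matrix.of_apply]
  split_ifs <;> simp

lemma det_map' (M : Matrix (Fin (κ+1)) (Fin (κ+1)) R) : (M.map f).det = f M.det := by
  rw [RingHom.map_det]; rfl

lemma aelt_map (i : Fin (κ+1)) (W : Matrix (Fin (κ+1)) (Fin (κ+1)) R) :
    aelt i (W.map f) = f (aelt i W) := by
  rw [aelt, aelt, ← det_map' f, Matrix.map_updateCol, base_map]
  rfl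

lemma Sat.map {s i : ℕ} {P : Pt κ R} (h : Sat s i P) : Sat s i (P.map f) := by
  intro m hm
  rw [Wm_map, base_map, det_map', h m hm, map_pow, map_eps]

end nat

section step
variable {κ : ℕ} {R : Type*} [CommRing R]

lemma base_succ (i : Fin (κ+1)) (W : Matrix (Fin (κ+1)) (Fin (κ+1)) R) :
    base (i+1) W = (base i W).updateCol i (fun r => W r i) := by
  ext r c
  simp only [base, Matrix.of_apply, Matrix.updateCol_apply]
  by_cases hc : c = i
  · subst hc; simp
  · have : (c:ℕ) ≠ i := fun h => hc (Fin.ext h)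
    simp only [hc, if_false]
    congr 1
    simp; omega

lemma base_mul_transvection (i j : Fin (κ+1)) (m : ℕ) (hm : m ≤ j) (z : R)
    (W : Matrix (Fin (κ+1)) (Fin (κ+1)) R) :
    base m (W * Matrix.transvection i j z) = base m W := by
  ext r c
  simp only [base, Matrix.of_apply]
  split_ifs with h
  · rw [Matrix.mul_transvection_apply_of_ne]
    rintro rfl; omega
  · rfl
  · rfl

/-- change one `t` -/
def setT (P : Pt κ R) (i : Fin (κ+1)) (τ : R) : Pt κ R := { P with t := Function.update P.t i τ }

lemma Wm_setT (s : ℕ) (P : Pt κ R) (i : Fin (κ+1)) (hi : i ≠ Fin.last κ) (h0 : P.t i = 0) (τ : R) :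
    Wm s (setT P i τ) = Wm s P * Matrix.transvection (Fin.last κ) i τ := by
  rw [Wm, Wm, mul_assoc _ _ (Matrix.transvection _ _ _)]
  congr 1
  ext r c
  by_cases hc : c = i
  · subst hc
    rw [Matrix.mul_transvection_apply_same]
    simp only [loM, setT, Matrix.of_apply, Function.update_self, h0]
    by_cases hr : r = Fin.last κ
    · subst hr
      simp [hi.symm, Fin.lt_last_iff_ne_last.2 hi]
    · simp [hr, (Fin.le_last r).not_gt]
  · rw [Matrix.mul_transvection_apply_of_ne _ _ _ _ hc]
    simp [loM, setT, Function.update_of_ne hc]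

lemma det_setT (s : ℕ) (P : Pt κ R) (i : Fin (κ+1)) (hi : i ≠ Fin.last κ) (h0 : P.t i = 0) (τ : R) :
    (base (i+1) (Wm s (setT P i τ))).det = (base (i+1) (Wm s P)).det + τ * aelt i (Wm s P) := by
  rw [Wm_setT s P i hi h0, base_succ, base_succ, base_mul_transvection _ _ _ le_rfl, aelt,
    ← Matrix.det_updateCol_smul, ← Matrix.det_updateCol_add]
  congr 2
  ext r
  simp [Matrix.mul_transvection_apply_same]

lemma det_setT_le (s : ℕ) (P : Pt κ R) (i : Fin (κ+1)) (hi : i ≠ Fin.last κ) (h0 : P.t i = 0) (τ : R)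
    (m : ℕ) (hm : m ≤ i) :
    (base m (Wm s (setT P i τ))).det = (base m (Wm s P)).det := by
  rw [Wm_setT s P i hi h0, base_mul_transvection _ _ _ hm]

/-- the one-parameter deformation -/
def twist (P : Pt κ R) (i : Fin (κ+1)) (z : R) : Pt κ R :=
  { P with
    p := fun r c => P.p r c + if c = Fin.last κ then z * (upM P.p * loM P.q P.t) r i else 0
    q := fun l j => P.q l j - z * (if j = Fin.last κ then 0 else P.t j) * loM P.q P.t l i }

lemma twist_zero (P : Pt κ R) (i : Fin (κ+1)) : twist P i 0 = P := by
  ext <;> simp [twist]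

lemma twist_map {S : Type*} [CommRing S] (f : R →+* S) (P : Pt κ R) (i : Fin (κ+1)) (z : R) :
    (twist P i z).map f = twist (P.map f) i (f z) := by
  have h1 : loM (P.map f).q (P.map f).t = (loM P.q P.t).map f := by
    rw [loM_map]; rfl
  have h2 : upM (P.map f).p = (upM P.p).map f := by
    rw [upM_map]; rfl
  ext i j
  · rfl
  · simp only [twist, h1, h2, ← Matrix.map_mul]
    simp only [Pt.map, Matrix.map_apply]
    split_ifs <;> simp
  · simp only [twist, h1]
    simp only [Pt.map, Matrix.map_apply]
    split_ifs <;> simp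
  · rfl

lemma Wm_twist (s : ℕ) (P : Pt κ R) (i : Fin (κ+1)) (hi : i ≠ Fin.last κ)
    (h0 : ∀ j, i ≤ j → P.t j = 0) (z : R) :
    Wm s (twist P i z) = Wm s P * Matrix.transvection i (Fin.last κ) z := by
  have hil : i < Fin.last κ := Fin.lt_last_iff_ne_last.2 hi
  set Lo := loM P.q P.t with hLo
  set E : Matrix (Fin (κ+1)) (Fin (κ+1)) R :=
    Matrix.of fun l j => if j = Fin.last κ then z * Lo l i else 0 with hE
  have hX : (upM P.p * Lo) (Fin.last κ) i = 0 := by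
    rw [Matrix.mul_apply, Finset.sum_eq_single (Fin.last κ)]
    · simp [hLo, loM, hi.symm, hil, h0 i le_rfl]
    · intro b _ hb
      simp [upM, hb.symm, (Fin.le_last b).not_gt]
    · simp
  have hU : upM (twist P i z).p = upM P.p * (1 + E) := by
    rw [mul_add, mul_one]
    ext r c
    have hsum : (upM P.p * E) r c = if c = Fin.last κ then z * (upM P.p * Lo) r i else 0 := by
      simp only [Matrix.mul_apply, hE, Matrix.of_apply]
      split_ifs
      · rw [Finset.mul_sum]
        exact Finset.sum_congr rfl fun x _ => by ring
      · simp
    rw [Matrix.add_apply, hsum]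
    simp only [upM, Matrix.of_apply, twist]
    by_cases hc : c = Fin.last κ
    · subst hc
      by_cases hr : r = Fin.last κ
      · subst hr
        have := hX
        simp only [upM] at this
        simp [this]
      · simp [hr, Fin.lt_last_iff_ne_last.2 hr, upM, hLo]
    · simp [hc]
  have hL : (1 + E) * loM (twist P i z).q (twist P i z).t =
      Lo * Matrix.transvection i (Fin.last κ) z := by
    have hlow : ∀ l j : Fin (κ+1), loM (twist P i z).q (twist P i z).t l j =
        Lo l j - z * (if j = Fin.last κ then 0 else P.t j) * Lo l i := by
      intro l j
      by_cases hj : j = Fin.last κ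
      · subst hj
        simp only [loM, hLo, Matrix.of_apply, twist]
        simp
      by_cases hji : i ≤ j
      · simp only [loM, hLo, Matrix.of_apply, twist, h0 j hji]
        simp
      · simp only [hj, if_false]
        push Not at hji
        simp only [loM, hLo, Matrix.of_apply, twist]
        by_cases hl : l = Fin.last κ
        · subst hl
          have : P.t i = 0 := h0 i le_rfl
          simp [this, hi.symm]
        · by_cases hli : l < i
          · have h1 : l ≠ i := hli.ne
            have h2 : ¬ i < l := hli.not_gt
            simp [hl, h1, h2]
          · have h1 : l ≠ j := by rintro rfl; exact hli hji
            have h2 : j < l := lt_of_lt_of_le hji (not_lt.1 hli)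
            simp [hl, h1, h2, hj]
    rw [add_mul, one_mul]
    ext r c
    have hsum : (E * loM (twist P i z).q (twist P i z).t) r c =
        z * Lo r i * loM (twist P i z).q (twist P i z).t (Fin.last κ) c := by
      rw [Matrix.mul_apply, Finset.sum_eq_single (Fin.last κ)]
      · simp [hE]
      · intro b _ hb
        simp [hE, hb]
      · simp
    have hli : Lo (Fin.last κ) i = 0 := by
      simp [hLo, loM, hi.symm, h0 i le_rfl]
    rw [Matrix.add_apply, hsum, hlow, hlow, hli]
    by_cases hc : c = Fin.last κ
    · subst hc
      rw [Matrix.mul_transvection_apply_same]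
      have : Lo (Fin.last κ) (Fin.last κ) = 1 := by simp [hLo, loM]
      rw [this]; simp
    · rw [Matrix.mul_transvection_apply_of_ne _ _ _ _ hc]
      have : Lo (Fin.last κ) c = P.t c := by
        simp [hLo, loM, Ne.symm hc, Fin.lt_last_iff_ne_last.2 hc]
      rw [this]; simp only [hc, if_false]; ring
  rw [Wm, Wm, hU, mul_assoc, mul_assoc, mul_assoc, hL, mul_assoc, ← hLo]
  rfl

lemma aelt_twist (s : ℕ) (P : Pt κ R) (i : Fin (κ+1)) (hi : i ≠ Fin.last κ)
    (h0 : ∀ j, i ≤ j → P.t j = 0) (z : R) :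
    aelt i (Wm s (twist P i z)) = aelt i (Wm s P) + z * (base (i+1) (Wm s P)).det := by
  rw [Wm_twist s P i hi h0, aelt, base_mul_transvection _ _ _ (Fin.le_last i), base_succ, aelt,
    ← Matrix.det_updateCol_smul, ← Matrix.det_updateCol_add]
  congr 2
  ext r
  simp [Matrix.mul_transvection_apply_same]

lemma Sat_twist (s : ℕ) (P : Pt κ R) (i : Fin (κ+1)) (hi : i ≠ Fin.last κ)
    (h0 : ∀ j, i ≤ j → P.t j = 0) (z : R) (h : Sat s i P) : Sat s i (twist P i z) := by
  intro m hm
  rw [Wm_twist s P i hi h0, base_mul_transvection _ _ _ (hm.trans (Fin.le_last i)), h m hm]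

end step
end GrPf


namespace GrPf

/-- universal property -/
def IsUniv (κ s i : ℕ) (R : Type) [CommRing R] [Algebra ℂ R] (P : Pt κ R) : Prop :=
  Sat s i P ∧ (∀ j : Fin (κ+1), i ≤ (j:ℕ) → P.t j = 0) ∧
  (∀ (S : Type) [CommRing S] [Algebra ℂ S] (P' : Pt κ S), Sat s i P' →
    (∀ j : Fin (κ+1), i ≤ (j:ℕ) → P'.t j = 0) → ∃ f : R →ₐ[ℂ] S, P.map f = P') ∧
  (∀ (S : Type) [CommRing S] [Algebra ℂ S] (f g : R →ₐ[ℂ] S), P.map f = P.map g → f = g)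

lemma base_zero {κ : ℕ} {R : Type*} [CommRing R] (W : Matrix (Fin (κ+1)) (Fin (κ+1)) R) :
    base 0 W = 1 := by
  ext r c
  simp [base, Matrix.one_apply]

lemma tower_base (κ s : ℕ) : ∃ (R : Type) (_ : CommRing R) (_ : Algebra ℂ R) (P : Pt κ R),
    IsDomain R ∧ IsUniv κ s 0 R P := by
  let V := (ℕ × Fin κ) ⊕ ((Fin (κ+1) × Fin (κ+1)) ⊕ (Fin (κ+1) × Fin (κ+1)))
  let P : Pt κ (MvPolynomial V ℂ) :=
    ⟨fun m x => MvPolynomial.X (Sum.inl (m, x)), fun i j => MvPolynomial.X (Sum.inr (Sum.inl (i,j))),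
      fun i j => MvPolynomial.X (Sum.inr (Sum.inr (i,j))), fun _ => 0⟩
  refine ⟨MvPolynomial V ℂ, inferInstance, inferInstance, P, inferInstance, ?_, ?_, ?_, ?_⟩
  · intro m hm
    obtain rfl : m = 0 := by omega
    simp [base_zero]
  · intro j _; rfl
  · intro S _ _ P' _ ht
    let v : V → S := fun x => match x with
      | Sum.inl (m, x) => P'.a m x
      | Sum.inr (Sum.inl (i, j)) => P'.p i j
      | Sum.inr (Sum.inr (i, j)) => P'.q i j
    refine ⟨MvPolynomial.aeval v, ?_⟩
    ext i j
    · simp [Pt.map, P, v]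
    · simp [Pt.map, P, v]
    · simp [Pt.map, P, v]
    · simp [Pt.map, P, ht]
  · intro S _ _ f g h
    apply MvPolynomial.algHom_ext
    have ha := congrArg Pt.a h
    have hp := congrArg Pt.p h
    have hq := congrArg Pt.q h
    rintro (⟨m, x⟩ | ⟨i, j⟩ | ⟨i, j⟩)
    · exact congrFun (congrFun ha m) x
    · exact congrFun (congrFun hp i) j
    · exact congrFun (congrFun hq i) j

lemma eps_sq (κ : ℕ) (R : Type*) [CommRing R] : eps κ R * eps κ R = 1 := by
  rw [eps, ← mul_pow]; simp

lemma eps_pow_sq (κ m : ℕ) (R : Type*) [CommRing R] : eps κ R ^ m * eps κ R ^ m = 1 := by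
  rw [← mul_pow, eps_sq, one_pow]

lemma tower_H (κ s : ℕ) (i : Fin (κ+1)) (hi : i ≠ Fin.last κ) (R : Type) [CommRing R] [Algebra ℂ R]
    (P : Pt κ R) (hP : IsUniv κ s i R P) (f : R)
    (hf : (eps κ R ^ ((i:ℕ)+1) - (base (i+1) (Wm s P)).det) ∣ aelt i (Wm s P) * f) :
    (eps κ R ^ ((i:ℕ)+1) - (base (i+1) (Wm s P)).det) ∣ f := by
  set b := eps κ R ^ ((i:ℕ)+1) - (base (i+1) (Wm s P)).det with hb
  obtain ⟨hS, ht, hex, huniq⟩ := hP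
  let Q := R ⧸ Ideal.span {b}
  let mk : R →ₐ[ℂ] Q := Ideal.Quotient.mkₐ ℂ (Ideal.span {b})
  have mkb : mk b = 0 := by
    apply Ideal.Quotient.eq_zero_iff_mem.2
    exact Ideal.mem_span_singleton_self b
  let C : Q →ₐ[ℂ] Polynomial Q := Polynomial.CAlgHom
  let h : R →ₐ[ℂ] Polynomial Q := C.comp mk
  have hhb : h b = 0 := by
    change C (mk b) = 0
    rw [mkb, map_zero]
  let P1 := P.map h
  have ht1 : ∀ j, i ≤ j → P1.t j = 0 := by
    intro j hj
    change h (P.t j) = 0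
    rw [ht j hj, map_zero]
  have hS1 : Sat s i P1 := hS.map (h : R →+* Polynomial Q)
  obtain ⟨φ, hφ⟩ := hex (Polynomial Q) (twist P1 i Polynomial.X)
    (Sat_twist s P1 i hi ht1 _ hS1) (fun j hj => ht1 j hj)
  let ev : Polynomial Q →ₐ[ℂ] Q := (Polynomial.aeval (0:Q)).restrictScalars ℂ
  have hcomp : ev.comp φ = mk := by
    apply huniq
    have h1 : P.map (ev.comp φ) = (P.map φ).map ev := rfl
    have h2 := twist_map (ev : Polynomial Q →+* Q) P1 i Polynomial.X
    have h3 : (ev : Polynomial Q →+* Q) Polynomial.X = 0 := by simp [ev]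
    rw [h3, twist_zero] at h2
    rw [h1, hφ]
    refine Eq.trans h2 ?_
    have h4 : ∀ x, ev (h x) = mk x := by
      intro x; simp [ev, h, C]
    change P.map (fun x => ev (h x)) = _
    simp only [h4]
  have hW : Wm s (twist P1 i Polynomial.X) = (Wm s P).map φ := by
    rw [← hφ]; exact Wm_map (φ : R →+* Polynomial Q) s P
  have hφdet : (base (i+1) (Wm s P1)).det = h ((base (i+1) (Wm s P)).det) := by
    have := Wm_map (h : R →+* Polynomial Q) s P
    change Wm s P1 = _ at this
    rw [this, base_map, det_map']; rfl
  have hdet : h ((base (i+1) (Wm s P)).det) = eps κ (Polynomial Q) ^ ((i:ℕ)+1) := by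
    have h5 : (base (i+1) (Wm s P)).det = eps κ R ^ ((i:ℕ)+1) - b := by rw [hb]; ring
    rw [h5, map_sub, hhb, sub_zero, map_pow]
    congr 1
    exact map_eps (h : R →+* Polynomial Q)
  have hha : aelt i (Wm s P1) = Polynomial.C (mk (aelt i (Wm s P))) := by
    have := Wm_map (h : R →+* Polynomial Q) s P
    change Wm s P1 = _ at this
    rw [this, aelt_map]; rfl
  have hφa : φ (aelt i (Wm s P)) = Polynomial.C (mk (aelt i (Wm s P))) +
      Polynomial.X * eps κ (Polynomial Q) ^ ((i:ℕ)+1) := by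
    have h6 := aelt_map (φ : R →+* Polynomial Q) i (Wm s P)
    change aelt i ((Wm s P).map φ) = φ _ at h6
    rw [← h6, ← hW, aelt_twist s P1 i hi ht1, hφdet, hdet, hha]
  have hφb : φ b = 0 := by
    have h7 := base_map (φ : R →+* Polynomial Q) (i+1) (Wm s P)
    have h8 : (base (i+1) ((Wm s P).map φ)).det = φ ((base (i+1) (Wm s P)).det) := by
      rw [← RingHom.coe_coe, h7, det_map']
    have hb1 := congrArg φ hb
    rw [hb1, map_sub, ← h8, ← hW, base_succ, Wm_twist s P1 i hi ht1]
    rw [base_mul_transvection _ _ _ (Fin.le_last i)]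
    have h9 : (fun r => (Wm s P1 * Matrix.transvection i (Fin.last κ) (Polynomial.X : Polynomial Q) :
        Matrix (Fin (κ+1)) (Fin (κ+1)) (Polynomial Q)) r i) =
        fun r => Wm s P1 r i := by
      ext1 r
      rw [Matrix.mul_transvection_apply_of_ne _ _ _ _ hi]
    rw [h9, ← base_succ, hφdet, hdet, map_pow]
    rw [sub_eq_zero]
    congr 1
    exact map_eps (φ : R →+* Polynomial Q)
  have hφf : φ f = 0 := by
    obtain ⟨c, hc⟩ := hf
    have h10 : φ (aelt i (Wm s P)) * φ f = 0 := by
      rw [← map_mul, hc, map_mul, hφb, zero_mul]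
    rw [hφa] at h10
    have h11 : (Polynomial.X + Polynomial.C (eps κ Q ^ ((i:ℕ)+1) * mk (aelt i (Wm s P)))) * φ f = 0 := by
      have h12 : eps κ (Polynomial Q) = Polynomial.C (eps κ Q) := (map_eps _).symm
      have h13 := eps_pow_sq κ (i+1) (Polynomial Q)
      rw [map_mul, map_pow, ← h12]
      linear_combination (eps κ (Polynomial Q) ^ ((i:ℕ)+1)) * h10 - (Polynomial.X * φ f) * h13
    have hm := Polynomial.monic_X_add_C (eps κ Q ^ ((i:ℕ)+1) * mk (aelt i (Wm s P)))
    exact (hm.mul_right_eq_zero_iff).1 h11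
  have : mk f = 0 := by
    rw [← hcomp]
    change ev (φ f) = 0
    rw [hφf, map_zero]
  exact Ideal.mem_span_singleton.1 (Ideal.Quotient.eq_zero_iff_mem.1 this)

lemma tower_step (κ s : ℕ) (i : Fin (κ+1)) (hi : i ≠ Fin.last κ) (R : Type) [CommRing R] [Algebra ℂ R]
    [IsDomain R] (P : Pt κ R) (hP : IsUniv κ s i R P)
    (hA : ∃ P : Pt κ ℂ, Sat s i P ∧ (∀ j : Fin (κ+1), (i:ℕ) ≤ (j:ℕ) → P.t j = 0) ∧ aelt i (Wm s P) ≠ 0)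
    (hB : ∃ P : Pt κ ℂ, Sat s i P ∧ (∀ j : Fin (κ+1), (i:ℕ) ≤ (j:ℕ) → P.t j = 0) ∧
      (base (i+1) (Wm s P)).det ≠ eps κ ℂ ^ ((i:ℕ)+1)) :
    ∃ (R : Type) (_ : CommRing R) (_ : Algebra ℂ R) (P : Pt κ R),
      IsDomain R ∧ IsUniv κ s (i+1) R P := by
  have hP' := hP
  obtain ⟨hS, ht, hex, huniq⟩ := hP'
  set a := aelt i (Wm s P) with ha
  set b := eps κ R ^ ((i:ℕ)+1) - (base (i+1) (Wm s P)).det with hb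
  have ha0 : a ≠ 0 := by
    obtain ⟨P', h1, h2, h3⟩ := hA
    obtain ⟨f, rfl⟩ := hex ℂ P' h1 h2
    intro h0
    apply h3
    have h4 := Wm_map (f : R →+* ℂ) s P
    change Wm s (P.map f) = _ at h4
    rw [h4, aelt_map, ← ha, h0, map_zero]
  have hb0 : b ≠ 0 := by
    obtain ⟨P', h1, h2, h3⟩ := hB
    obtain ⟨f, rfl⟩ := hex ℂ P' h1 h2
    intro h0
    apply h3
    have h4 := Wm_map (f : R →+* ℂ) s P
    change Wm s (P.map f) = _ at h4
    rw [h4, base_map, det_map', ← sub_eq_zero.1 h0, map_pow, map_eps]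
  have hdom := adjoinRoot_linear_domain a b ha0 hb0 (tower_H κ s i hi R P hP)
  set ℓ := (Polynomial.C a * Polynomial.X - Polynomial.C b) with hℓ
  let ι : R →ₐ[ℂ] AdjoinRoot ℓ := (Algebra.ofId R (AdjoinRoot ℓ)).restrictScalars ℂ
  let P2 : Pt κ (AdjoinRoot ℓ) := P.map ι
  have hroot : ι a * AdjoinRoot.root ℓ = ι b := by
    have h1 := AdjoinRoot.eval₂_root ℓ
    rw [hℓ, Polynomial.eval₂_sub, Polynomial.eval₂_mul, Polynomial.eval₂_C, Polynomial.eval₂_X,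
      Polynomial.eval₂_C, sub_eq_zero] at h1
    exact h1
  have ht2 : P2.t i = 0 := by
    change ι (P.t i) = 0
    rw [ht i le_rfl, map_zero]
  have hW2 : Wm s P2 = (Wm s P).map ι := Wm_map (ι : R →+* AdjoinRoot ℓ) s P
  have ha2 : aelt i (Wm s P2) = ι a := by
    rw [hW2]; exact aelt_map (ι : R →+* AdjoinRoot ℓ) i (Wm s P)
  have hd2 : (base (i+1) (Wm s P2)).det = ι ((base (i+1) (Wm s P)).det) := by
    rw [hW2, ← RingHom.coe_coe, base_map, det_map']
  refine ⟨AdjoinRoot ℓ, inferInstance, inferInstance, setT P2 i (AdjoinRoot.root ℓ), hdom, ?_, ?_, ?_, ?_⟩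
  · intro m hm
    rcases Nat.lt_or_ge i m with h | h
    · obtain rfl : m = i+1 := by omega
      rw [det_setT s P2 i hi ht2, ha2, hd2, mul_comm, hroot, hb, map_sub, map_pow]
      have : ι (eps κ R) = _ := map_eps (ι : R →+* AdjoinRoot ℓ)
      rw [this]; ring
    · rw [det_setT_le s P2 i hi ht2 _ m h]
      exact (hS.map (ι : R →+* AdjoinRoot ℓ)) m h
  · intro j hj
    have hne : j ≠ i := by rintro rfl; omega
    simp only [setT, Function.update_of_ne hne]
    change ι (P.t j) = 0
    rw [ht j (by omega), map_zero]
  · intro S _ _ P' hS' ht'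
    let P3 := setT P' i 0
    have h30 : P3.t i = 0 := by simp [P3, setT]
    have h3 : P' = setT P3 i (P'.t i) := by
      ext <;> simp [P3, setT]
    have hS3 : Sat s i P3 := by
      intro m hm
      rw [← det_setT_le s P3 i hi h30 (P'.t i) m hm, ← h3]
      exact hS' m (by omega)
    have ht3 : ∀ j : Fin (κ+1), (i:ℕ) ≤ j → P3.t j = 0 := by
      intro j hj
      by_cases hne : j = i
      · rw [hne, h30]
      · simp only [P3, setT, Function.update_of_ne hne]
        apply ht'
        have : (i:ℕ) ≠ j := fun h => hne (Fin.ext h.symm)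
        omega
    obtain ⟨f, hf⟩ := hex S P3 hS3 ht3
    have hW3 : Wm s P3 = (Wm s P).map f := by
      rw [← hf]; exact Wm_map (f : R →+* S) s P
    have hfa : f a = aelt i (Wm s P3) := by
      rw [hW3]; exact (aelt_map (f : R →+* S) i (Wm s P)).symm
    have hfb : f b = eps κ S ^ ((i:ℕ)+1) - (base (i+1) (Wm s P3)).det := by
      rw [hW3, ← RingHom.coe_coe, base_map, det_map', hb, ← map_eps (f : R →+* S)]
      simp
    have hx : f a * P'.t i = f b := by
      have h5 := hS' (i+1) le_rfl
      rw [h3, det_setT s P3 i hi h30] at h5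
      rw [hfa, hfb]
      linear_combination h5
    let F : AdjoinRoot ℓ →ₐ[ℂ] S := AdjoinRoot.liftAlgHom ℓ f (P'.t i) (by
      rw [hℓ, Polynomial.eval₂_sub, Polynomial.eval₂_mul, Polynomial.eval₂_C, Polynomial.eval₂_X,
        Polynomial.eval₂_C, sub_eq_zero]
      exact hx)
    have hFι : ∀ x, F (ι x) = f x := fun x => AdjoinRoot.liftAlgHom_of _ _ _ _ _
    have hFr : F (AdjoinRoot.root ℓ) = P'.t i := AdjoinRoot.liftAlgHom_root _ _ _ _
    refine ⟨F, ?_⟩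
    rw [h3, ← hf]
    ext x y
    · exact hFι _
    · exact hFι _
    · exact hFι _
    · by_cases hne : x = i
      · subst hne
        simp only [Pt.map, setT, Function.update_self]
        rw [hFr]
      · simp only [Pt.map, setT, Function.update_of_ne hne]
        exact hFι _
  · intro S _ _ f g h
    apply AdjoinRoot.algHom_ext'
    · have : f.comp ι = g.comp ι := by
        apply huniq
        ext x y
        · exact congrFun (congrFun (congrArg Pt.a h) x) y
        · exact congrFun (congrFun (congrArg Pt.p h) x) y
        · exact congrFun (congrFun (congrArg Pt.q h) x) y
        · by_cases hne : x = i
          · subst hne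
            change f (ι _) = g (ι _)
            rw [ht x le_rfl]; simp
          · have := congrFun (congrArg Pt.t h) x
            simp only [Pt.map, setT, Function.update_of_ne hne] at this
            exact this
      exact this
    · have := congrFun (congrArg Pt.t h) i
      simp only [Pt.map, setT, Function.update_self] at this
      exact this

end GrPf


namespace GrPf

section tri
variable {κ : ℕ} {R : Type*} [CommRing R]

def IsUp (M : Matrix (Fin (κ+1)) (Fin (κ+1)) R) : Prop :=
  (∀ i j, j < i → M i j = 0) ∧ ∀ i, M i i = 1

def IsLo (M : Matrix (Fin (κ+1)) (Fin (κ+1)) R) : Prop :=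
  (∀ i j, i < j → M i j = 0) ∧ ∀ i, M i i = 1

lemma IsUp.mul {M N : Matrix (Fin (κ+1)) (Fin (κ+1)) R} (hM : IsUp M) (hN : IsUp N) :
    IsUp (M * N) := by
  constructor
  · intro i j hij
    rw [Matrix.mul_apply]
    apply Finset.sum_eq_zero
    intro l _
    rcases lt_or_ge l i with h | h
    · rw [hM.1 i l h, zero_mul]
    · rw [hN.1 l j (lt_of_lt_of_le hij h), mul_zero]
  · intro i
    rw [Matrix.mul_apply, Finset.sum_eq_single i, hM.2, hN.2, mul_one]
    · intro l _ hl
      rcases lt_or_gt_of_ne hl with h | h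
      · rw [hM.1 i l h, zero_mul]
      · rw [hN.1 l i h, mul_zero]
    · simp

lemma IsLo.transpose {M : Matrix (Fin (κ+1)) (Fin (κ+1)) R} (hM : IsLo M) : IsUp M.transpose :=
  ⟨fun i j h => hM.1 j i h, fun i => hM.2 i⟩

lemma IsUp.transpose {M : Matrix (Fin (κ+1)) (Fin (κ+1)) R} (hM : IsUp M) : IsLo M.transpose :=
  ⟨fun i j h => hM.1 j i h, fun i => hM.2 i⟩

lemma IsLo.mul {M N : Matrix (Fin (κ+1)) (Fin (κ+1)) R} (hM : IsLo M) (hN : IsLo N) :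
    IsLo (M * N) := by
  have := (hN.transpose.mul hM.transpose).transpose
  simpa using this

lemma IsUp.det {M : Matrix (Fin (κ+1)) (Fin (κ+1)) R} (hM : IsUp M) : M.det = 1 := by
  rw [Matrix.det_of_isUpperTriangular (fun i j h => hM.1 i j h)]
  simp [hM.2]

lemma IsLo.det {M : Matrix (Fin (κ+1)) (Fin (κ+1)) R} (hM : IsLo M) : M.det = 1 := by
  rw [← Matrix.det_transpose, hM.transpose.det]

lemma isUp_upM (p : Fin (κ+1) → Fin (κ+1) → R) : IsUp (upM p) := by
  constructor
  · intro i j h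
    simp [upM, h.ne', h.not_gt]
  · intro i; simp [upM]

lemma isLo_loM (q : Fin (κ+1) → Fin (κ+1) → R) (t : Fin (κ+1) → R) : IsLo (loM q t) := by
  constructor
  · intro i j h
    simp [loM, h.ne, h.not_gt]
  · intro i; simp [loM]

lemma IsUp.upM {M : Matrix (Fin (κ+1)) (Fin (κ+1)) R} (hM : IsUp M) : GrPf.upM (fun i j => M i j) = M := by
  ext i j
  simp only [GrPf.upM, Matrix.of_apply]
  split_ifs with h1 h2
  · rw [h1, hM.2]
  · rfl
  · rw [hM.1]; exact lt_of_le_of_ne (not_lt.1 h2) (Ne.symm h1)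

lemma IsLo.loM {M : Matrix (Fin (κ+1)) (Fin (κ+1)) R} (hM : IsLo M) (t : Fin (κ+1) → R)
    (ht : ∀ j, j ≠ Fin.last κ → t j = M (Fin.last κ) j) :
    GrPf.loM (fun i j => M i j) t = M := by
  ext i j
  simp only [GrPf.loM, Matrix.of_apply]
  split_ifs with h1 h2 h3
  · rw [h1, hM.2]
  · rw [ht, h3]; rintro rfl; exact h1 h3
  · rfl
  · rw [hM.1]; exact lt_of_le_of_ne (not_lt.1 h2) h1

lemma upd_eq_mul (M : Matrix (Fin (κ+1)) (Fin (κ+1)) R) (x : Fin κ → R) :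
    upd M x = M * upd 1 x := by
  ext i j
  rw [Matrix.mul_apply]
  refine Fin.cases ?_ (fun j => ?_) j
  · simp only [upd, Matrix.of_apply, Fin.cons_zero, Matrix.one_mulVec]
    rfl
  · simp [upd, Matrix.one_apply]

lemma gM_congr (a a' : ℕ → Fin κ → R) (m : ℕ) (h : ∀ l < m, a l = a' l) : gM a m = gM a' m := by
  induction m with
  | zero => rfl
  | succ m ih => rw [gM, gM, ih (fun l hl => h l (by omega)), h m (by omega)]

lemma det_base_mul (L Z : Matrix (Fin (κ+1)) (Fin (κ+1)) R) (hL : IsLo L) (m : ℕ) :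
    (base m (L * Z)).det = (base m Z).det := by
  let M : Matrix (Fin (κ+1)) (Fin (κ+1)) R :=
    Matrix.of fun r l => if (l:ℕ) < m then (if r = l then 1 else 0) else L r l
  have hM : IsLo M := by
    constructor
    · intro i j h
      simp only [M, Matrix.of_apply]
      split_ifs with h1 h2
      · exact absurd h2 h.ne
      · rfl
      · exact hL.1 i j h
    · intro i
      simp [M, hL.2]
  have key : base m (L * Z) * M = L * base m Z := by
    ext r c
    rw [Matrix.mul_apply, Matrix.mul_apply]
    by_cases hc : (c:ℕ) < m
    · simp [M, base, hc, Matrix.mul_apply]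
    · simp only [base, M, Matrix.of_apply, hc, if_false]
      rw [Finset.sum_eq_single r, Finset.sum_eq_single c]
      · by_cases hr : (r:ℕ) < m
        · simp [hr, hL.1 r c (by rw [Fin.lt_def]; omega)]
        · simp [hr]
      · intro b _ hb; simp [hb]
      · simp
      · intro b _ hb
        by_cases hbm : (b:ℕ) < m
        · simp [hL.1 b c (by rw [Fin.lt_def]; omega)]
        · simp [hbm, hb.symm]
      · simp
  have := congrArg Matrix.det key
  rw [Matrix.det_mul, Matrix.det_mul, hM.det, hL.det] at this
  simpa using this

/-- alternating upper triangular matrix -/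
lemma exists_comp : ∃ (x : Fin κ → R) (U : Matrix (Fin (κ+1)) (Fin (κ+1)) R),
    IsUp U ∧ IsLo (upd 1 x * U) := by
  let U : Matrix (Fin (κ+1)) (Fin (κ+1)) R :=
    Matrix.of fun i j => if i ≤ j then (-1) ^ ((i:ℕ)+j) else 0
  refine ⟨fun j => (-1)^(j:ℕ), U, ⟨?_, ?_⟩, ?_⟩
  · intro i j h; simp [U, h.not_ge]
  · intro i; simp [U, ← two_mul]
  have hent : ∀ l j, (upd (1 : Matrix (Fin (κ+1)) (Fin (κ+1)) R) (fun j => (-1)^(j:ℕ)) * U) l j =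
      if j ≤ l then (-1)^((l:ℕ)+j) else 0 := by
    intro l j
    rw [Matrix.mul_apply, Fin.sum_univ_succ]
    have h0 : upd (1 : Matrix (Fin (κ+1)) (Fin (κ+1)) R) (fun j => (-1)^(j:ℕ)) l 0 = (-1)^(l:ℕ) := by
      simp only [upd, Matrix.of_apply, Fin.cons_zero, Matrix.one_mulVec]
      refine Fin.lastCases ?_ (fun l => ?_) l
      · simp [eps]
      · simp
    have h1 : ∀ c : Fin κ, upd (1 : Matrix (Fin (κ+1)) (Fin (κ+1)) R) (fun j => (-1)^(j:ℕ)) l c.succ =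
        if l = c.castSucc then 1 else 0 := by
      intro c; simp [upd, Matrix.one_apply]
    rw [h0]
    simp only [h1]
    have hU0 : U 0 j = (-1)^(j:ℕ) := by simp [U]
    rw [hU0]
    induction l using Fin.lastCases with
    | last =>
      have : ∀ c : Fin κ, Fin.last κ ≠ c.castSucc := fun c => (Fin.castSucc_lt_last c).ne'
      simp [this, Fin.le_last, pow_add]
    | cast l =>
      simp only [Fin.castSucc_inj]
      rw [Finset.sum_eq_single l]
      · by_cases h : j ≤ l.castSucc
        · have h2 : ¬ l.succ ≤ j := by
            rw [Fin.le_def] at h ⊢; simp at h ⊢; omega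
          simp [U, h, h2, pow_add]
        · have h2 : l.succ ≤ j := by
            rw [Fin.le_def] at h ⊢; simp at h ⊢; omega
          simp [U, h, h2, pow_add]
      · intro b _ hb; simp [hb.symm]
      · simp
  constructor
  · intro i j h
    rw [hent]; simp [h.not_ge]
  · intro i
    rw [hent]; simp [← two_mul]

lemma exists_gM (s : ℕ) : ∃ (a : ℕ → Fin κ → R) (U : Matrix (Fin (κ+1)) (Fin (κ+1)) R),
    IsUp U ∧ IsLo (gM a s * U) := by
  induction s with
  | zero =>
    refine ⟨fun _ _ => 0, 1, ?_, ?_⟩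
    · constructor
      · intro i j h; simp [h.ne']
      · simp
    · constructor
      · intro i j h; simp [gM, h.ne]
      · simp [gM]
  | succ s ih =>
    obtain ⟨a, U, hU, hL⟩ := ih
    obtain ⟨x', U3, hU3, hL3⟩ := exists_comp (κ := κ) (R := R)
    let y := U.mulVec (Fin.snoc x' (eps κ R))
    let x : Fin κ → R := fun j => y j.castSucc
    have hyl : y (Fin.last κ) = eps κ R := by
      simp only [y, Matrix.mulVec, dotProduct]
      rw [Finset.sum_eq_single (Fin.last κ)]
      · simp [hU.2]
      · intro b _ hb
        rw [hU.1 _ _ (Fin.lt_last_iff_ne_last.2 hb), zero_mul]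
      · simp
    have hsn : (Fin.snoc x (eps κ R) : Fin (κ+1) → R) = y := by
      funext j
      refine Fin.lastCases ?_ (fun j => ?_) j
      · simp [hyl]
      · simp [x]
    let V : Matrix (Fin (κ+1)) (Fin (κ+1)) R := Matrix.of
      (Fin.cons (Fin.cons 1 (fun _ => 0)) (fun i => Fin.cons 0 (fun j => U i.castSucc j.castSucc)))
    have hV : IsUp V := by
      constructor
      · intro i j
        refine Fin.cases ?_ (fun i => ?_) i <;> refine Fin.cases ?_ (fun j => ?_) j
        · simp
        · simp
        · simp [V]
        · intro h
          simp only [V, Matrix.of_apply, Fin.cons_succ]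
          exact hU.1 _ _ (by simpa using h)
      · intro i
        refine Fin.cases ?_ (fun i => ?_) i
        · simp [V]
        · simp [V, hU.2]
    have hCV : upd 1 x * V = U * upd 1 x' := by
      rw [← upd_eq_mul]
      ext r c
      rw [Matrix.mul_apply, Fin.sum_univ_succ]
      refine Fin.cases ?_ (fun c => ?_) c
      · simp only [upd, Matrix.of_apply, Fin.cons_zero, Fin.cons_succ, Matrix.one_mulVec, hsn, V]
        simp [y]
      · simp only [upd, Matrix.of_apply, Fin.cons_zero, Fin.cons_succ, Matrix.one_mulVec, hsn, V]
        simp only [mul_zero, zero_add]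
        refine Fin.lastCases ?_ (fun r => ?_) r
        · rw [hU.1 _ _ (Fin.castSucc_lt_last c)]
          apply Finset.sum_eq_zero
          intro b _
          simp [Matrix.one_apply, (Fin.castSucc_lt_last b).ne']
        · rw [Finset.sum_eq_single r]
          · simp
          · intro b _ hb
            simp [Matrix.one_apply, hb.symm]
          · simp
    refine ⟨Function.update a s x, V * U3, hV.mul hU3, ?_⟩
    have : gM (Function.update a s x) (s+1) * (V * U3) = (gM a s * U) * (upd 1 x' * U3) := by
      rw [gM, upd_eq_mul, Function.update_self, gM_congr (Function.update a s x) a s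
        (fun l hl => Function.update_of_ne (by omega) _ _)]
      calc _ = gM a s * (upd 1 x * V) * U3 := by simp only [mul_assoc]
        _ = _ := by rw [hCV]; simp only [mul_assoc]
    rw [this]
    exact hL.mul hL3

lemma exists_F (κ s : ℕ) (R : Type*) [CommRing R] : ∃ F : Pt κ R → Pt κ R, (∀ P, (F P).t = P.t) ∧
    (∀ P i τ, F (setT P i τ) = setT (F P) i τ) ∧
    ∀ P m, (base m (Wm s (F P))).det = (base m (upM P.p * loM P.q P.t)).det := by
  obtain ⟨a, U, hU, hL⟩ := exists_gM (κ := κ) (R := R) s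
  refine ⟨fun P => ⟨a, fun i j => (U * upM P.p) i j, P.q, P.t⟩, fun _ => rfl, fun _ _ _ => rfl, ?_⟩
  intro P m
  rw [← det_base_mul _ (upM P.p * loM P.q P.t) hL m, Wm, (hU.mul (isUp_upM P.p)).upM]
  simp only [mul_assoc]

end tri
end GrPf


namespace GrPf
section pts
variable {κ : ℕ} {R : Type*} [CommRing R]

lemma det_rank1 (M : Matrix (Fin (κ+1)) (Fin (κ+1)) R) (u v : Fin (κ+1) → R)
    (h : ∀ r c, M r c = (if r = c then 1 else 0) + u r * v c) : M.det = 1 + ∑ c, v c * u c := by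
  have : M = 1 + Matrix.replicateCol (Fin 1) u * Matrix.replicateRow (Fin 1) v := by
    ext r c
    rw [h]
    simp [Matrix.one_apply, Matrix.mul_apply]
  rw [this]
  convert Matrix.det_one_add_replicateCol_mul_replicateRow (ι := Fin 1) u v
  rfl

lemma mul_loM_zero (U : Matrix (Fin (κ+1)) (Fin (κ+1)) R) (t : Fin (κ+1) → R) (r c : Fin (κ+1))
    (hc : c ≠ Fin.last κ) :
    (U * loM (fun _ _ => 0) t) r c = U r c + U r (Fin.last κ) * t c := by
  have : ∀ l, loM (fun _ _ => 0) t l c = (if l = c then 1 else 0) + (if l = Fin.last κ then t c else 0) := by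
    intro l
    simp only [loM, Matrix.of_apply]
    by_cases h1 : l = c
    · subst h1; simp [hc]
    · by_cases h2 : l = Fin.last κ
      · subst h2; simp [Ne.symm hc, Fin.lt_last_iff_ne_last.2 hc]
      · simp [h1, h2]
  rw [Matrix.mul_apply]
  simp [this, mul_add, Finset.sum_add_distrib]

lemma detA (t : Fin (κ+1) → R) (m : ℕ) (hm : m ≤ κ) :
    (base m (upM (fun _ c => if c = Fin.last κ then 1 else 0) * loM (fun _ _ => 0) t)).det =
      1 + ∑ c : Fin (κ+1), if (c:ℕ) < m then t c else 0 := by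
  rw [det_rank1 _ (fun _ => 1) (fun c => if (c:ℕ) < m then t c else 0)]
  · simp
  · intro r c
    simp only [base, Matrix.of_apply]
    by_cases hc : (c:ℕ) < m
    · have hcl : c ≠ Fin.last κ := by rintro rfl; simp at hc; omega
      rw [if_pos hc, if_pos hc, mul_loM_zero _ _ _ _ hcl]
      have h1 : (upM (fun _ c => if c = Fin.last κ then 1 else 0) : Matrix (Fin (κ+1)) (Fin (κ+1)) R) r (Fin.last κ) = 1 := by
        simp only [upM, Matrix.of_apply]
        by_cases hr : r = Fin.last κ
        · simp [hr]
        · simp [Fin.lt_last_iff_ne_last.2 hr]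
      have h2 : (upM (fun _ c => if c = Fin.last κ then 1 else 0) : Matrix (Fin (κ+1)) (Fin (κ+1)) R) r c = if r = c then 1 else 0 := by
        simp only [upM, Matrix.of_apply, hcl]
        simp
      rw [h1, h2]
    · simp [hc]

/-- telescoping sum -/
lemma tele (f : ℕ → R) (i m : ℕ) (hm : m ≤ κ + 1) :
    ∑ c : Fin (κ+1), (if (c:ℕ) < m then (if (c:ℕ) < i then f (c+1) - f c else 0) else 0) =
      f (min m i) - f 0 := by
  rw [Fin.sum_univ_eq_sum_range
    (fun c => if c < m then (if c < i then f (c+1) - f c else 0) else 0) (κ+1)]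
  have h1 : ∀ c, (if c < m then (if c < i then f (c+1) - f c else 0) else 0) =
      if c < min m i then f (c+1) - f c else 0 := by
    intro c
    by_cases h1 : c < m <;> by_cases h2 : c < i <;> simp [h1, h2]
  simp only [h1]
  rw [← Finset.sum_filter]
  have h2 : (Finset.range (κ+1)).filter (fun c => c < min m i) = Finset.range (min m i) := by
    ext c; simp; omega
  rw [h2, Finset.sum_range_sub]

lemma ptA (κ s : ℕ) (i : Fin (κ+1)) (hi : i ≠ Fin.last κ) :
    ∃ P : Pt κ ℂ, Sat s i P ∧ (∀ j : Fin (κ+1), (i:ℕ) ≤ (j:ℕ) → P.t j = 0) ∧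
      aelt i (Wm s P) ≠ 0 ∧ (base (i+1) (Wm s P)).det = eps κ ℂ ^ (i:ℕ) := by
  have hil : (i:ℕ) < κ := by
    have := Fin.lt_last_iff_ne_last.2 hi
    rwa [Fin.lt_def] at this
  obtain ⟨F, hF1, hF2, hF3⟩ := exists_F κ s ℂ
  let t : Fin (κ+1) → ℂ := fun j => if (j:ℕ) < i then eps κ ℂ ^ ((j:ℕ)+1) - eps κ ℂ ^ (j:ℕ) else 0
  let P : Pt κ ℂ := ⟨fun _ _ => 0, fun _ c => if c = Fin.last κ then 1 else 0, fun _ _ => 0, t⟩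
  have hd : ∀ m ≤ κ, (base m (Wm s (F P))).det = eps κ ℂ ^ (min m i) := by
    intro m hm
    rw [hF3]
    change (base m (upM (fun _ c => if c = Fin.last κ then 1 else 0) * loM (fun _ _ => 0) t)).det = _
    rw [detA t m hm]
    simp only [t]
    rw [tele (fun c => eps κ ℂ ^ c) i m (by omega)]
    simp
  have hti : P.t i = 0 := by simp [P, t]
  refine ⟨F P, ?_, ?_, ?_, ?_⟩
  · intro m hm
    rw [hd m (by omega), min_eq_left hm]
  · intro j hj
    rw [hF1]
    simp only [P, t]
    rw [if_neg (by omega)]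
  · have h1 := det_setT s (F P) i hi (by rw [hF1, hti]) 1
    rw [← hF2, hF3, hF3] at h1
    change (base (i+1) (upM (fun _ c => if c = Fin.last κ then 1 else 0) * loM (fun _ _ => 0)
      (Function.update t i 1))).det = (base (i+1) (upM (fun _ c => if c = Fin.last κ then 1 else 0) * loM (fun _ _ => 0) t)).det + _ at h1
    rw [detA _ _ (by omega), detA _ _ (by omega)] at h1
    have h2 : ∀ c : Fin (κ+1), (if (c:ℕ) < (i:ℕ)+1 then Function.update t i 1 c else 0) =
       (if (c:ℕ) < (i:ℕ)+1 then t c else 0) + if c = i then 1 else 0 := by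
      intro c
      by_cases hc : c = i
      · subst hc; simp [t]
      · simp [hc, Function.update_of_ne hc]
    simp only [h2, Finset.sum_add_distrib] at h1
    simp only [Finset.sum_ite_eq', Finset.mem_univ, if_true] at h1
    have h3 : aelt i (Wm s (F P)) = 1 := by linear_combination -h1
    rw [h3]; exact one_ne_zero
  · rw [hd _ (by omega)]; congr 1; omega

lemma ptB (κ s : ℕ) (i : Fin (κ+1)) (hi : i ≠ Fin.last κ) (hκ : 1 ≤ κ) :
    ∃ P : Pt κ ℂ, Sat s i P ∧ (∀ j : Fin (κ+1), (i:ℕ) ≤ (j:ℕ) → P.t j = 0) ∧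
      (base (i+1) (Wm s P)).det ≠ eps κ ℂ ^ ((i:ℕ)+1) := by
  have hil : (i:ℕ) < κ := by
    have := Fin.lt_last_iff_ne_last.2 hi
    rwa [Fin.lt_def] at this
  have heps : ∀ m, eps κ ℂ ^ m ≠ 0 := fun m => by
    have := eps_pow_sq κ m ℂ
    intro h; rw [h] at this; simp at this
  rcases Nat.even_or_odd κ with hev | hod
  swap
  · obtain ⟨P, h1, h2, -, h4⟩ := ptA κ s i hi
    refine ⟨P, h1, h2, ?_⟩
    rw [h4, pow_succ]
    have : eps κ ℂ = -1 := hod.neg_one_pow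
    intro h
    have h5 := heps i
    have h6 : (2:ℂ) * eps κ ℂ ^ (i:ℕ) = 0 := by
      rw [this] at h ⊢; linear_combination h
    rcases mul_eq_zero.1 h6 with h | h
    · norm_num at h
    · exact h5 h
  have he : eps κ ℂ = 1 := hev.neg_one_pow
  have hκ2 : 2 ≤ κ := by
    rcases hev with ⟨r, hr⟩; omega
  obtain ⟨F, hF1, hF2, hF3⟩ := exists_F κ s ℂ
  rw [he, one_pow]
  by_cases hi0 : (i:ℕ) = 0
  · let c0 : Fin (κ+1) := ⟨0, by omega⟩
    let c1 : Fin (κ+1) := ⟨1, by omega⟩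
    let P : Pt κ ℂ := ⟨fun _ _ => 0, fun r c => if r = c0 ∧ c = c1 then 1 else 0,
      fun r c => if r = c1 ∧ c = c0 then 1 else 0, fun _ => 0⟩
    refine ⟨F P, ?_, ?_, ?_⟩
    · intro m hm
      obtain rfl : m = 0 := by omega
      simp [base_zero]
    · intro j _; rw [hF1]
    · rw [hF3]
      have h01 : c0 ≠ c1 := by simp [c0, c1]
      have h1l : c1 ≠ Fin.last κ := by simp [c1, Fin.ext_iff]; omega
      have hlt : c0 < c1 := by rw [Fin.lt_def]; exact Nat.zero_lt_one
      have hloc : ∀ l, loM P.q P.t l c0 = (if l = c0 then 1 else 0) + (if l = c1 then 1 else 0) := by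
        intro l
        simp only [loM, Matrix.of_apply, P]
        by_cases h1 : l = c0
        · subst h1; simp [h01]
        · by_cases h2 : l = c1
          · subst h2; simp [Ne.symm h01, h1l, hlt]
          · simp [h1, h2]
      have hent : ∀ r, (upM P.p * loM P.q P.t) r c0 =
          (if r = c0 then 1 else 0) + (if r = c0 then 1 else if r = c1 then 1 else 0) := by
        intro r
        rw [Matrix.mul_apply]
        simp only [hloc, mul_add, Finset.sum_add_distrib]
        simp only [mul_ite, mul_one, mul_zero, Finset.sum_ite_eq', Finset.mem_univ, if_true]
        simp only [upM, Matrix.of_apply, P]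
        by_cases h1 : r = c0
        · subst h1; simp [h01, hlt]
        · by_cases h2 : r = c1
          · subst h2; simp [Ne.symm h01]
          · simp [h1, h2]
      rw [det_rank1 _ (fun r => if r = c0 then 1 else if r = c1 then 1 else 0)
        (fun c => if c = c0 then 1 else 0)]
      · simp only [ite_mul, one_mul, zero_mul, Finset.sum_ite_eq', Finset.mem_univ, if_true]
        norm_num
      · intro r c
        simp only [base, Matrix.of_apply, hi0]
        by_cases hc : c = c0
        · subst hc
          rw [if_pos (by simp [c0]), hent]; simp
        · have : ¬ (c:ℕ) < 0 + 1 := by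
            intro h; apply hc; apply Fin.ext; change (c:ℕ) = 0; omega
          rw [if_neg this]
          simp [hc]
  · let j0 : Fin (κ+1) := ⟨i-1, by omega⟩
    have hj0i : j0 ≠ i := by simp [j0, Fin.ext_iff]; omega
    have hj0l : j0 ≠ Fin.last κ := by simp [j0, Fin.ext_iff]; omega
    have hlt : j0 < i := by rw [Fin.lt_def]; change (i:ℕ) - 1 < i; omega
    have hltl : i < Fin.last κ := Fin.lt_last_iff_ne_last.2 hi
    let P : Pt κ ℂ := ⟨fun _ _ => 0,
      fun r c => if r = j0 ∧ c = i then 1 else if r = i ∧ c = Fin.last κ then 1 else 0,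
      fun r c => 0, fun c => if c = j0 then 1 else 0⟩
    have hul : ∀ r, upM P.p r (Fin.last κ) = if r = Fin.last κ then 1 else if r = i then 1 else 0 := by
      intro r
      simp only [upM, Matrix.of_apply, P]
      by_cases h1 : r = Fin.last κ
      · simp [h1]
      · by_cases h2 : r = i
        · subst h2; simp [h1, hltl]
        · simp [h1, h2, hi.symm]
    have hui : ∀ r c, c ≠ i → c ≠ Fin.last κ → upM P.p r c = if r = c then 1 else 0 := by
      intro r c h1 h2
      simp only [upM, Matrix.of_apply, P]
      simp [h1, h2]
    have hent : ∀ r c, c ≠ Fin.last κ → (upM P.p * loM P.q P.t) r c =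
        upM P.p r c + (if c = j0 then (if r = Fin.last κ then 1 else if r = i then 1 else 0) else 0) := by
      intro r c hc
      refine (mul_loM_zero (upM P.p) P.t r c hc).trans ?_
      rw [hul]
      simp [P]
    refine ⟨F P, ?_, ?_, ?_⟩
    · intro m hm
      rw [hF3, he, one_pow]
      rw [det_rank1 _ (fun r => if r = Fin.last κ then 1 else if r = i then 1 else 0)
        (fun c => if (c:ℕ) < m then (if c = j0 then 1 else 0) else 0)]
      · rw [Finset.sum_eq_zero, add_zero]
        intro c _
        by_cases hc : c = j0
        · subst hc; simp [hj0i, hj0l]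
        · simp [hc]
      · intro r c
        simp only [base, Matrix.of_apply]
        by_cases hc : (c:ℕ) < m
        · have hci : c ≠ i := by rintro rfl; omega
          have hcl : c ≠ Fin.last κ := by rintro rfl; simp at hc; omega
          rw [if_pos hc, if_pos hc, hent r c hcl, hui r c hci hcl]
          simp
        · simp [hc]
    · intro j hj
      rw [hF1]
      have : j ≠ j0 := by rintro rfl; simp only [j0] at hj; omega
      simp [P, this]
    · rw [hF3]
      rw [Matrix.det_zero_of_row_eq (i := j0) (j := i) hj0i]
      · exact zero_ne_one
      · funext c
        simp only [base, Matrix.of_apply]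
        by_cases hc : (c:ℕ) < (i:ℕ)+1
        · have hcl : c ≠ Fin.last κ := by rintro rfl; simp at hc; omega
          rw [if_pos hc, if_pos hc, hent _ c hcl, hent _ c hcl]
          by_cases hci : c = i
          · subst hci
            have : ∀ r, upM P.p r c = if r = c then 1 else if r = j0 then 1 else 0 := by
              intro r
              simp only [upM, Matrix.of_apply, P]
              by_cases h1 : r = c
              · simp [h1]
              · by_cases h2 : r = j0
                · subst h2; simp [h1, hlt]
                · simp [h1, h2]
            rw [this, this]
            simp [hj0i, hj0i.symm]
          · rw [hui _ c hci hcl, hui _ c hci hcl]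
            by_cases hcj : c = j0
            · subst hcj; simp [hj0i, hj0i.symm, hj0l]
            · simp [hcj, Ne.symm hcj, Ne.symm hci]
        · have h1 : j0 ≠ c := by rintro rfl; simp only [j0] at hc; omega
          have h2 : i ≠ c := by rintro rfl; omega
          simp [hc, h1, h2]

lemma tower (κ s : ℕ) (hκ : 1 ≤ κ) (i : ℕ) (hi : i ≤ κ) :
    ∃ (R : Type) (_ : CommRing R) (_ : Algebra ℂ R) (P : Pt κ R),
      IsDomain R ∧ IsUniv κ s i R P := by
  induction i with
  | zero => exact tower_base κ s
  | succ i ih =>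
    obtain ⟨R, _, _, P, _, hP⟩ := ih (by omega)
    have hne : (⟨i, by omega⟩ : Fin (κ+1)) ≠ Fin.last κ := by
      simp [Fin.ext_iff]; omega
    obtain ⟨PA, h1, h2, h3, -⟩ := ptA κ s ⟨i, by omega⟩ hne
    exact tower_step κ s ⟨i, by omega⟩ hne R P hP ⟨PA, h1, h2, h3⟩
      (ptB κ s ⟨i, by omega⟩ hne hκ)

end pts
end GrPf


namespace GrPf
section linalg
variable {κ : ℕ} {R : Type*} [CommRing R]

lemma det_updateCol_mulVec (M : Matrix (Fin (κ+1)) (Fin (κ+1)) R) (j : Fin (κ+1)) (y : Fin (κ+1) → R) :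
    (M.updateCol j (M.mulVec y)).det = y j * M.det := by
  rw [← Matrix.cramer_apply, Matrix.cramer_eq_adjugate_mulVec, Matrix.mulVec_mulVec,
    Matrix.adjugate_mul]
  simp [Matrix.smul_mulVec, mul_comm]

lemma sign_rot : ((Equiv.Perm.sign (finRotate (κ+1)) : ℤ) : R) = eps κ R := by
  rw [sign_finRotate]; simp [eps]

lemma rot_updateCol (M F : Matrix (Fin (κ+1)) (Fin (κ+1)) R) (y : Fin (κ+1) → R)
    (h0 : ∀ r, F r 0 = y r) (h1 : ∀ r (c : Fin κ), F r c.succ = M r c.castSucc) :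
    eps κ R * F.det = (M.updateCol (Fin.last κ) y).det := by
  rw [← sign_rot, ← Matrix.det_permute']
  congr 1
  ext r c
  refine Fin.lastCases ?_ (fun c => ?_) c
  · simp [h0]
  · rw [Matrix.updateCol_ne (Fin.castSucc_lt_last c).ne]
    simp [h1]

lemma det_upd (M : Matrix (Fin (κ+1)) (Fin (κ+1)) R) (x : Fin κ → R) :
    (upd M x).det = M.det := by
  have h := rot_updateCol M (upd M x) (M.mulVec (Fin.snoc x (eps κ R))) (by simp [upd]) (by simp [upd])
  rw [det_updateCol_mulVec, Fin.snoc_last] at h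
  have := eps_sq κ R
  linear_combination eps κ R * h + (M.det - (upd M x).det) * this

lemma det_gM (a : ℕ → Fin κ → R) (m : ℕ) : (gM a m).det = 1 := by
  induction m with
  | zero => simp [gM]
  | succ m ih => rw [gM, det_upd, ih]

lemma mulVec_adj (M : Matrix (Fin (κ+1)) (Fin (κ+1)) R) (hM : M.det = 1) (y : Fin (κ+1) → R) :
    M.mulVec (M.adjugate.mulVec y) = y := by
  rw [Matrix.mulVec_mulVec, Matrix.mul_adjugate, hM, one_smul, Matrix.one_mulVec]

lemma expand (M F : Matrix (Fin (κ+1)) (Fin (κ+1)) R) (hM : M.det = 1) (hF : F.det = 1)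
    (h1 : ∀ r (c : Fin κ), F r c.succ = M r c.castSucc) : ∃ x : Fin κ → R, F = upd M x := by
  let y := M.adjugate.mulVec (fun r => F r 0)
  have hy : M.mulVec y = fun r => F r 0 := mulVec_adj M hM _
  have h := rot_updateCol M F (M.mulVec y) (by simp [hy]) h1
  rw [det_updateCol_mulVec, hF, hM, mul_one, mul_one] at h
  refine ⟨fun j => y j.castSucc, ?_⟩
  have hs : (Fin.snoc (fun j => y j.castSucc) (eps κ R) : Fin (κ+1) → R) = y := by
    funext j
    refine Fin.lastCases ?_ (fun j => ?_) j
    · simp [h]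
    · simp
  ext r c
  refine Fin.cases ?_ (fun c => ?_) c
  · simp only [upd, Matrix.of_apply, Fin.cons_zero]
    rw [hs, hy]
  · simp [upd, h1]

/-- first `j` columns from `A`, the others from `B` -/
def mix (j : ℕ) (A B : Matrix (Fin (κ+1)) (Fin (κ+1)) R) : Matrix (Fin (κ+1)) (Fin (κ+1)) R :=
  Matrix.of fun r l => if (l:ℕ) < j then A r l else B r l

lemma base_eq_mix (m : ℕ) (W : Matrix (Fin (κ+1)) (Fin (κ+1)) R) : base m W = mix m W 1 := by
  ext r l
  simp [base, mix, Matrix.one_apply]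

lemma mul_mix (j : ℕ) (g A B : Matrix (Fin (κ+1)) (Fin (κ+1)) R) :
    g * mix j A B = mix j (g * A) (g * B) := by
  ext r l
  simp only [mix, Matrix.mul_apply, Matrix.of_apply]
  split_ifs <;> rfl

lemma rot_pow_val (r : ℕ) (c : Fin (κ+1)) : ((finRotate (κ+1) ^ r) c : ℕ) = (r + c) % (κ+1) := by
  induction r with
  | zero => simp [Nat.mod_eq_of_lt c.2]
  | succ r ih =>
    rw [pow_succ', Equiv.Perm.mul_apply, finRotate_apply, Fin.val_add, ih]
    rw [Fin.val_one', ← Nat.add_mod]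
    congr 1; ring

lemma det_rot (A B M : Matrix (Fin (κ+1)) (Fin (κ+1)) R) (r : ℕ) (hr : r ≤ κ + 1)
    (hB : ∀ i (c l : Fin (κ+1)), (l:ℕ) = r + c → M i c = B i l)
    (hA : ∀ i (c l : Fin (κ+1)), (l:ℕ) + (κ + 1) = r + c → M i c = A i l) :
    M.det = eps κ R ^ r * (mix r A B).det := by
  have hs : ((Equiv.Perm.sign (finRotate (κ+1) ^ r) : ℤ) : R) = eps κ R ^ r := by
    rw [map_pow]; push_cast; rw [sign_rot]
  rw [← hs, ← Matrix.det_permute']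
  congr 1
  ext i c
  have hv := rot_pow_val r c
  have hc := c.2
  simp only [Matrix.submatrix_apply, id, mix, Matrix.of_apply]
  by_cases h : r + c < κ + 1
  · rw [Nat.mod_eq_of_lt h] at hv
    rw [hB i c _ hv, if_neg (by omega)]
  · have hv2 : (r + c) % (κ+1) = r + c - (κ+1) := by
      rw [Nat.mod_eq_sub_mod (by omega), Nat.mod_eq_of_lt (by omega)]
    rw [hv2] at hv
    rw [hA i c ((finRotate (κ+1) ^ r) c) (by omega), if_pos (by omega)]

lemma IsUp.inv {M : Matrix (Fin (κ+1)) (Fin (κ+1)) R} (hM : IsUp M) : IsUp M⁻¹ := by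
  have hu : IsUnit M.det := by rw [hM.det]; exact isUnit_one
  let _ := Matrix.invertibleOfIsUnitDet M hu
  have hb : M.BlockTriangular id := fun i j h => hM.1 i j h
  have h1 := Matrix.blockTriangular_inv_of_blockTriangular hb
  refine ⟨fun i j h => h1 h, fun i => ?_⟩
  have h2 := congrFun (congrFun (Matrix.mul_nonsing_inv M hu) i) i
  rw [Matrix.mul_apply, Finset.sum_eq_single i, hM.2, one_mul] at h2
  · simpa using h2
  · intro l _ hl
    rcases lt_or_gt_of_ne hl with h | h
    · rw [hM.1 i l h, zero_mul]
    · have : M⁻¹ l i = 0 := h1 h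
      rw [this, mul_zero]
  · simp

lemma IsLo.inv {M : Matrix (Fin (κ+1)) (Fin (κ+1)) R} (hM : IsLo M) : IsLo M⁻¹ := by
  have := hM.transpose.inv.transpose
  rwa [Matrix.transpose_nonsing_inv, Matrix.transpose_transpose] at this

lemma LU (Z : Matrix (Fin (κ+1)) (Fin (κ+1)) R) (h : ∀ j ≤ κ, (mix j 1 Z).det = 1) :
    ∃ U L : Matrix (Fin (κ+1)) (Fin (κ+1)) R, IsUp U ∧ IsLo L ∧ Z = U * L := by
  have h' : ∀ j ≤ κ + 1, (mix j 1 Z).det = 1 := by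
    intro j hj
    by_cases hjk : j ≤ κ
    · exact h j hjk
    · have : mix j 1 Z = 1 := by
        ext r l
        have := l.2
        simp only [mix, Matrix.of_apply]
        rw [if_pos (by omega)]
      rw [this, Matrix.det_one]
  let y : Fin (κ+1) → Fin (κ+1) → R := fun j => (mix (j+1) 1 Z).adjugate.mulVec (fun r => Z r j)
  have hy : ∀ j : Fin (κ+1), (mix (j+1) 1 Z).mulVec (y j) = fun r => Z r j :=
    fun j => mulVec_adj _ (h' _ (by have := j.2; omega)) _
  have hyj : ∀ j, y j j = 1 := by
    intro j
    have h1 := det_updateCol_mulVec (mix (j+1) 1 Z) j (y j)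
    rw [h' _ (by have := j.2; omega), mul_one, hy] at h1
    rw [← h1, ← h' j (by have := j.2; omega)]
    congr 1
    ext r l
    simp only [mix, Matrix.updateCol_apply, Matrix.of_apply]
    by_cases hl : l = j
    · subst hl; simp
    · have : (l:ℕ) ≠ j := fun h => hl (Fin.ext h)
      rw [if_neg hl]
      by_cases h2 : (l:ℕ) < j
      · rw [if_pos h2, if_pos (by omega)]
      · rw [if_neg h2, if_neg (by omega)]
  let U : Matrix (Fin (κ+1)) (Fin (κ+1)) R := upM (fun r j => y j r)
  let N : Matrix (Fin (κ+1)) (Fin (κ+1)) R :=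
    Matrix.of fun l j => if l = j then 1 else if j < l then - y j l else 0
  have hN : IsLo N := by
    constructor
    · intro i j hij; simp [N, hij.ne, hij.not_gt]
    · intro i; simp [N]
  have hZN : Z * N = U := by
    ext r j
    have h1 := congrFun (hy j) r
    simp only [Matrix.mulVec, dotProduct] at h1
    have h2 : ∀ l, Z r l * N l j = (if l = j then Z r j else 0) -
        (if j < l then mix (j+1) 1 Z r l * y j l else 0) := by
      intro l
      simp only [N, mix, Matrix.of_apply]
      by_cases h3 : l = j
      · subst h3; simp
      · by_cases h4 : j < l
        · have : ¬ (l:ℕ) < j + 1 := by rw [Fin.lt_def] at h4; omega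
          simp [h3, h4, this]
        · simp [h3, h4]
    rw [Matrix.mul_apply]
    simp only [h2, Finset.sum_sub_distrib]
    rw [Finset.sum_ite_eq', if_pos (Finset.mem_univ _), ← h1, ← Finset.sum_sub_distrib]
    have h5 : ∀ l, (mix (j+1) 1 Z r l * y j l - if j < l then mix (j+1) 1 Z r l * y j l else 0) =
        if r = l then U r j else 0 := by
      intro l
      by_cases h4 : j < l
      · have : ¬ r = l ∨ U r j = 0 := by
          by_cases h6 : r = l
          · right; subst h6; exact (isUp_upM _).1 _ _ h4
          · left; exact h6
        rcases this with h6 | h6 <;> simp [h4, h6]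
      · have h7 : (l:ℕ) < j + 1 := by rw [Fin.lt_def] at h4; omega
        simp only [h4, if_false, sub_zero, mix, Matrix.of_apply, h7, if_true, Matrix.one_apply]
        by_cases h6 : r = l
        · subst h6
          simp only [if_true, one_mul, U, upM, Matrix.of_apply]
          by_cases h8 : r = j
          · subst h8; simp [hyj]
          · rw [if_neg h8, if_pos (lt_of_le_of_ne (not_lt.1 h4) h8)]
        · simp [h6]
    simp only [h5]
    simp
  refine ⟨U, N⁻¹, isUp_upM _, hN.inv, ?_⟩
  rw [← hZN, mul_assoc, Matrix.mul_nonsing_inv _ (by rw [hN.det]; exact isUnit_one), mul_one]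

lemma det_low_mul (U L : Matrix (Fin (κ+1)) (Fin (κ+1)) R) (hU : IsUp U) (hL : IsLo L) (m : ℕ) :
    (mix m 1 (U * L)).det = 1 := by
  have hM : IsUp (mix m U 1) := by
    constructor
    · intro i j h
      simp only [mix, Matrix.of_apply]
      split_ifs with h1
      · exact hU.1 i j h
      · simp [h.ne']
    · intro i
      simp [mix, hU.2]
  have hM2 : IsLo (mix m 1 L) := by
    constructor
    · intro i j h
      simp only [mix, Matrix.of_apply]
      split_ifs with h1
      · simp [h.ne]
      · exact hL.1 i j h
    · intro i
      simp [mix, hL.2]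
  have key : mix m 1 (U * L) * mix m U 1 = U * mix m 1 L := by
    rw [mul_mix, mul_mix, mul_one, mul_one]
    ext r c
    simp only [mix, Matrix.of_apply]
    by_cases hc : (c:ℕ) < m
    · simp only [hc, if_true]
      rw [Matrix.mul_apply, Finset.sum_eq_single r]
      · by_cases hr : (r:ℕ) < m
        · simp [hr]
        · simp [hU.1 r c (by rw [Fin.lt_def]; omega)]
      · intro b _ hb
        by_cases hbm : (b:ℕ) < m
        · simp [hbm, hb.symm]
        · simp [hU.1 b c (by rw [Fin.lt_def]; omega)]
      · simp
    · simp [hc]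
  have := congrArg Matrix.det key
  rw [Matrix.det_mul, Matrix.det_mul, hM.det, hM2.det, hU.det] at this
  simpa using this

lemma eps_pow_k : eps κ R ^ (κ+1) = 1 := by
  rw [eps, ← pow_mul]
  exact (Nat.even_mul_succ_self κ).neg_one_pow

lemma det_mix_smul (j : ℕ) (hj : j ≤ κ + 1) (A B : Matrix (Fin (κ+1)) (Fin (κ+1)) R) :
    (mix j (eps κ R • A) B).det = eps κ R ^ j * (mix j A B).det := by
  have : mix j (eps κ R • A) B = mix j A B *
      Matrix.diagonal (fun l : Fin (κ+1) => if (l:ℕ) < j then eps κ R else 1) := by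
    ext r l
    simp only [mix, Matrix.mul_diagonal, Matrix.of_apply, Matrix.smul_apply, smul_eq_mul]
    split_ifs
    · ring
    · ring
  rw [this, Matrix.det_mul, Matrix.det_diagonal, mul_comm]
  congr 1
  rw [Fin.prod_univ_eq_prod_range (fun l => if l < j then eps κ R else 1) (κ+1),
    ← Finset.prod_filter]
  have h2 : (Finset.range (κ+1)).filter (fun c => c < j) = Finset.range j := by
    ext c; simp; omega
  rw [h2]; simp

end linalg
end GrPf


namespace GrPf
section seq
variable {κ : ℕ} {R : Type*} [CommRing R]

def cN (M : Matrix (Fin (κ+1)) (Fin (κ+1)) R) (j : ℕ) (r : Fin (κ+1)) : R :=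
  if h : j < κ + 1 then M r ⟨j, h⟩ else 0

lemma cN_fin (M : Matrix (Fin (κ+1)) (Fin (κ+1)) R) (j : Fin (κ+1)) (r : Fin (κ+1)) :
    cN M j r = M r j := by
  rw [cN, dif_pos j.2]

lemma cN_of (M : Matrix (Fin (κ+1)) (Fin (κ+1)) R) (m : ℕ) (j : Fin (κ+1)) (h : m = j) (r : Fin (κ+1)) :
    cN M m r = M r j := by
  subst h; exact cN_fin M j r

/-- the sequence of columns attached to parameters -/
def vv (s : ℕ) (P : Pt κ R) (j : ℕ) (r : Fin (κ+1)) : R :=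
  if j < κ + 1 then cN 1 j r else if j < 2 * (κ+1) then cN (Wm s P) (j - (κ+1)) r
  else if j < 2 * (κ+1) + s then eps κ R * cN (gM P.a (2 * (κ+1) + s - j)) 0 r
  else eps κ R * cN 1 (j - (2 * (κ+1) + s)) r

def win (v : ℕ → Fin (κ+1) → R) (r : ℕ) : Matrix (Fin (κ+1)) (Fin (κ+1)) R :=
  Matrix.of fun i c => v (r + c) i

lemma vv_frame (s : ℕ) (P : Pt κ R) (t : ℕ) (ht : t ≤ s) :
    win (vv s P) (2 * (κ+1) + s - t) = eps κ R • gM P.a t := by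
  induction t with
  | zero =>
    ext r c
    simp only [win, Matrix.of_apply, Matrix.smul_apply, smul_eq_mul, gM, vv]
    rw [if_neg (by omega), if_neg (by omega), if_neg (by omega), cN_of _ _ c (by omega)]
  | succ t ih =>
    ext r c
    refine Fin.cases ?_ (fun c => ?_) c
    · have hz : ((0 : Fin (κ+1)) : ℕ) = 0 := rfl
      simp only [win, Matrix.of_apply, Matrix.smul_apply, smul_eq_mul, vv]
      rw [hz, add_zero]
      rw [if_neg (by omega), if_neg (by omega), if_pos (by omega), cN_of _ 0 (0 : Fin (κ+1)) rfl]
      congr 3; omega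
    · have h1 := congrFun (congrFun (ih (by omega)) r) c.castSucc
      simp only [win, Matrix.of_apply, Matrix.smul_apply, smul_eq_mul] at h1 ⊢
      have h2 : 2 * (κ+1) + s - (t+1) + (c.succ : ℕ) = 2 * (κ+1) + s - t + (c.castSucc : ℕ) := by
        simp; omega
      rw [h2, h1]
      simp [gM, upd]

lemma det_frame (g : Matrix (Fin (κ+1)) (Fin (κ+1)) R) (hg : g.det = 1) :
    (eps κ R • g).det = 1 := by
  rw [Matrix.det_smul, hg, Fintype.card_fin, eps_pow_k, mul_one]

lemma det_win_low (v : ℕ → Fin (κ+1) → R) (W : Matrix (Fin (κ+1)) (Fin (κ+1)) R)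
    (h0 : win v 0 = 1) (h1 : win v (κ+1) = W) (r : ℕ) (hr : r ≤ κ+1) :
    (win v r).det = eps κ R ^ r * (base r W).det := by
  rw [base_eq_mix]
  apply det_rot _ _ _ _ hr
  · intro i c l hl
    rw [← h0]; simp only [win, Matrix.of_apply, hl]; simp
  · intro i c l hl
    rw [← h1]; simp only [win, Matrix.of_apply]; congr 1; omega

lemma det_win_mid (v : ℕ → Fin (κ+1) → R) (g W : Matrix (Fin (κ+1)) (Fin (κ+1)) R)
    (h1 : win v (κ+1) = W) (h2 : win v (2*(κ+1)) = eps κ R • g) (j : ℕ) (hj : j ≤ κ+1) :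
    (win v (κ+1+j)).det = (mix j g W).det := by
  rw [det_rot (eps κ R • g) W (win v (κ+1+j)) j hj, det_mix_smul _ hj, ← mul_assoc, eps_pow_sq, one_mul]
  · intro i c l hl
    rw [← h1]; simp only [win, Matrix.of_apply]; congr 1; omega
  · intro i c l hl
    rw [← h2]; simp only [win, Matrix.of_apply]; congr 1; omega

lemma vv_low (s : ℕ) (P : Pt κ R) : win (vv s P) 0 = 1 := by
  ext i c
  have := c.2
  simp only [win, Matrix.of_apply, vv, zero_add]
  rw [if_pos this, cN_fin]

lemma vv_mid (s : ℕ) (P : Pt κ R) : win (vv s P) (κ+1) = Wm s P := by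
  ext i c
  have := c.2
  simp only [win, Matrix.of_apply, vv]
  rw [if_neg (by omega), if_pos (by omega), cN_of _ _ c (by omega)]

lemma vv_win (s : ℕ) (P : Pt κ R) (hP : Sat s κ P) (r : ℕ) (hr : r < 2 * (κ+1) + s) :
    (win (vv s P) r).det = 1 := by
  rcases Nat.lt_or_ge r (κ+1) with h | h
  · rw [det_win_low _ _ (vv_low s P) (vv_mid s P) r (by omega), hP r (by omega), eps_pow_sq]
  rcases Nat.lt_or_ge r (2*(κ+1)) with h' | h'
  · obtain ⟨j, rfl⟩ := Nat.exists_eq_add_of_le h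
    have h2 := vv_frame s P s le_rfl
    rw [Nat.add_sub_cancel] at h2
    rw [det_win_mid _ _ _ (vv_mid s P) h2 j (by omega)]
    have h3 : mix j (gM P.a s) (Wm s P) = gM P.a s * mix j 1 (upM P.p * loM P.q P.t) := by
      rw [mul_mix, mul_one, Wm, mul_assoc]
    rw [h3, Matrix.det_mul, det_gM, det_low_mul _ _ (isUp_upM _) (isLo_loM _ _), one_mul]
  · have h2 := vv_frame s P (2*(κ+1)+s-r) (by omega)
    have h3 : 2*(κ+1)+s - (2*(κ+1)+s-r) = r := by omega
    rw [h3] at h2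
    rw [h2, det_frame _ (det_gM _ _)]

lemma upd_smul (e : R) (M : Matrix (Fin (κ+1)) (Fin (κ+1)) R) (x : Fin κ → R) :
    upd (e • M) x = e • upd M x := by
  rw [upd_eq_mul, upd_eq_mul M, Matrix.smul_mul]

lemma vv_back (s : ℕ) (v : ℕ → Fin (κ+1) → R) (h0 : win v 0 = 1)
    (hn : win v (2*(κ+1)+s) = eps κ R • 1)
    (hw : ∀ r < 2*(κ+1)+s, (win v r).det = 1) :
    ∃ P : Pt κ R, Sat s κ P ∧ (∀ j : Fin (κ+1), κ ≤ (j:ℕ) → P.t j = 0) ∧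
      ∀ j < 2*(κ+1)+s, vv s P j = v j := by
  have hdet : ∀ t, (win v (2*(κ+1)+s-t)).det = 1 := by
    intro t
    rcases Nat.eq_zero_or_pos t with rfl | h
    · rw [Nat.sub_zero, hn, det_frame _ Matrix.det_one]
    · exact hw _ (by omega)
  have hx : ∀ t, ∃ x : Fin κ → R, t < s → win v (2*(κ+1)+s-(t+1)) = upd (win v (2*(κ+1)+s-t)) x := by
    intro t
    by_cases ht : t < s
    · obtain ⟨x, hx⟩ := expand (win v (2*(κ+1)+s-t)) (win v (2*(κ+1)+s-(t+1))) (hdet _) (hdet _) (by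
        intro r c
        simp only [win, Matrix.of_apply]
        congr 1; simp; omega)
      exact ⟨x, fun _ => hx⟩
    · exact ⟨fun _ => 0, fun h => absurd h ht⟩
  choose a ha using hx
  have hfr : ∀ t ≤ s, win v (2*(κ+1)+s-t) = eps κ R • gM a t := by
    intro t
    induction t with
    | zero => intro _; rw [Nat.sub_zero, hn]; rfl
    | succ t ih =>
      intro ht
      rw [ha t (by omega), ih (by omega), upd_smul]; rfl
  set g := gM a s with hg
  have hgd : g.det = 1 := det_gM a s
  have hgu : IsUnit g.det := by rw [hgd]; exact isUnit_one
  set W := win v (κ+1) with hW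
  have h2 : win v (2*(κ+1)) = eps κ R • g := by
    have := hfr s le_rfl
    rwa [Nat.add_sub_cancel] at this
  have hZ : ∀ j ≤ κ, (mix j 1 (g⁻¹ * W)).det = 1 := by
    intro j hj
    have h3 := det_win_mid v g W hW.symm h2 j (by omega)
    rw [hw _ (by omega)] at h3
    have h4 : mix j g W = g * mix j 1 (g⁻¹ * W) := by
      rw [mul_mix, mul_one, ← mul_assoc, Matrix.mul_nonsing_inv _ hgu, one_mul]
    rw [h4, Matrix.det_mul, hgd, one_mul] at h3
    exact h3.symm
  obtain ⟨U, L, hU, hL, hUL⟩ := LU _ hZ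
  let t : Fin (κ+1) → R := fun j => if j = Fin.last κ then 0 else L (Fin.last κ) j
  let P : Pt κ R := ⟨a, fun i j => U i j, fun i j => L i j, t⟩
  have hWP : Wm s P = W := by
    have h5 : upM P.p = U := hU.upM
    have h6 : loM P.q P.t = L := hL.loM t (fun j hj => by simp [t, hj])
    have h7 : gM P.a s = g := rfl
    rw [Wm, h5, h6, h7, mul_assoc, ← hUL, ← mul_assoc, Matrix.mul_nonsing_inv _ hgu, one_mul]
  refine ⟨P, ?_, ?_, ?_⟩
  · intro m hm
    have h8 := det_win_low v W h0 hW.symm m (by omega)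
    rw [hw m (by omega)] at h8
    rw [hWP]
    have h9 := eps_pow_sq κ m R
    linear_combination (-(base m W).det) * h9 - eps κ R ^ m * h8
  · intro j hj
    have : j = Fin.last κ := by
      apply Fin.ext; have := j.2; simp; omega
    simp [P, t, this]
  · intro j hj
    funext r
    simp only [vv]
    split_ifs with h10 h11
    · have := congrFun (congrFun h0 r) ⟨j, h10⟩
      rw [cN_of _ _ ⟨j, h10⟩ rfl, ← this]
      simp [win]
    · rw [hWP, cN_of _ _ ⟨j - (κ+1), by omega⟩ rfl, hW]
      simp only [win, Matrix.of_apply]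
      congr 1; omega
    · have h12 := congrFun (congrFun (hfr (2*(κ+1)+s-j) (by omega)) r) 0
      rw [cN_of _ 0 (0 : Fin (κ+1)) rfl]
      simp only [Matrix.smul_apply, smul_eq_mul, win, Matrix.of_apply, Fin.val_zero] at h12
      change eps κ R * gM a _ r 0 = _
      rw [← h12]
      congr 1; omega

lemma vv_map {S : Type*} [CommRing S] (f : R →+* S) (s : ℕ) (P : Pt κ R) (j : ℕ) (r : Fin (κ+1)) :
    vv s (P.map f) j r = f (vv s P j r) := by
  have hc : ∀ (M : Matrix (Fin (κ+1)) (Fin (κ+1)) R) j r, cN (M.map f) j r = f (cN M j r) := by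
    intro M j r
    simp only [cN]; split_ifs <;> simp
  have hg : ∀ m, gM (P.map f).a m = (gM P.a m).map f := fun m => (gM_map f P.a m).symm
  have h1 : (1 : Matrix (Fin (κ+1)) (Fin (κ+1)) S) = (1 : Matrix (Fin (κ+1)) (Fin (κ+1)) R).map f := by
    simp
  simp only [vv, Wm_map, hg, h1, hc, ← map_eps f]
  split_ifs <;> simp

end seq
end GrPf


namespace GrPf

lemma rep_cast (n m : ℕ) (h1 : 1 ≤ m) (h2 : m ≤ n) : rep n (m : ZMod n) = m := by
  have : NeZero n := ⟨by omega⟩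
  rw [rep, ZMod.val_natCast]
  rcases Nat.lt_or_ge m n with h | h
  · rw [Nat.mod_eq_of_lt h, if_neg (by omega)]
  · obtain rfl : m = n := by omega
    simp

lemma cast_rep (n : ℕ) (hn : 1 ≤ n) (x : ZMod n) : ((rep n x : ℕ) : ZMod n) = x := by
  have : NeZero n := ⟨by omega⟩
  rw [rep]
  split_ifs with h
  · rw [ZMod.natCast_self, eq_comm, ← ZMod.val_eq_zero]; exact h
  · exact ZMod.natCast_zmod_val x

lemma rep_pos (n : ℕ) (hn : 1 ≤ n) (x : ZMod n) : 1 ≤ rep n x := by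
  rw [rep]; split_ifs <;> omega

lemma rep_le (n : ℕ) (hn : 1 ≤ n) (x : ZMod n) : rep n x ≤ n := by
  have : NeZero n := ⟨by omega⟩
  rw [rep]; split_ifs
  · exact le_rfl
  · exact (ZMod.val_lt x).le

section pl
variable {R : Type*} [CommRing R] {k n : ℕ}

lemma pluck_image (N : Matrix (Fin k) (ZMod n) R) (I : Finset (ZMod n)) (h : Fin k → ℕ)
    (hmono : StrictMono h) (h1 : ∀ c, 1 ≤ h c) (h2 : ∀ c, h c ≤ n)
    (hI : I = Finset.univ.image (fun c => (h c : ZMod n))) :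
    pluck N I = (Matrix.of fun i c => N i (h c : ZMod n)).det := by
  have hrep : ∀ c, rep n (h c : ZMod n) = h c := fun c => rep_cast n _ (h1 c) (h2 c)
  have hinj : Function.Injective (fun c => (h c : ZMod n)) := by
    intro a b hab
    apply hmono.injective
    have := congrArg (rep n) hab
    simpa [hrep] using this
  have hc2 : I.card = k := by
    rw [hI, Finset.card_image_of_injective _ hinj]; simp
  have himg : I.image (rep n) = Finset.univ.image h := by
    rw [hI, Finset.image_image]
    congr 1; funext c; exact hrep c
  have hc1 : (I.image (rep n)).card = k := by
    rw [himg, Finset.card_image_of_injective _ hmono.injective]; simp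
  rw [pluck, dif_pos ⟨hc1, hc2⟩]
  congr 1
  ext i j
  simp only [Matrix.of_apply]
  have := Finset.orderEmbOfFin_unique hc1 (f := h) (by
    intro x; rw [himg]; exact Finset.mem_image_of_mem _ (Finset.mem_univ _)) hmono
  rw [Finset.coe_orderIsoOfFin_apply, ← this]

lemma pluck_mul (A : Matrix (Fin k) (Fin k) R) (N : Matrix (Fin k) (ZMod n) R) (I : Finset (ZMod n)) :
    pluck (A * N) I = A.det * pluck N I := by
  rw [pluck, pluck]
  split_ifs with h
  · rw [← Matrix.det_mul]; rfl
  · simp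

lemma pluck_map {S : Type*} [CommRing S] (f : R →+* S) (N : Matrix (Fin k) (ZMod n) R) (I : Finset (ZMod n)) :
    pluck (N.map f) I = f (pluck N I) := by
  rw [pluck, pluck]
  split_ifs with h
  · rw [RingHom.map_det]; rfl
  · simp

end pl

section tws
variable {R : Type*} [CommRing R] {κ n : ℕ}

/-- twisted periodic sequence of columns of a matrix -/
def tw (N : Matrix (Fin (κ+1)) (ZMod n) R) (j : ℕ) (i : Fin (κ+1)) : R :=
  if j < n then N i ((j+1 : ℕ) : ZMod n) else eps κ R * N i ((j - n + 1 : ℕ) : ZMod n)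

lemma mix_self (j : ℕ) (A : Matrix (Fin (κ+1)) (Fin (κ+1)) R) : mix j A A = A := by
  ext; simp [mix]

lemma pluck_cSeg (N : Matrix (Fin (κ+1)) (ZMod n) R) (hk : κ + 1 ≤ n) (r : ℕ) (hr : r < n) :
    pluck N (cSeg n ((r + 1 : ℕ) : ZMod n) (κ+1)) = (win (tw N) r).det := by
  set ρ := r + (κ+1) - n with hρ
  let h : Fin (κ+1) → ℕ := fun c => if (c:ℕ) < ρ then c + 1 else r + 1 + c - ρ
  have hmono : StrictMono h := by
    intro a b hab
    rw [Fin.lt_def] at hab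
    have := b.2
    simp only [h]
    split_ifs <;> omega
  have h1 : ∀ c, 1 ≤ h c := by
    intro c; have := c.2; simp only [h]; split_ifs <;> omega
  have h2 : ∀ c, h c ≤ n := by
    intro c; have := c.2; simp only [h]; split_ifs <;> omega
  rw [pluck_image N _ h hmono h1 h2]
  · rw [det_rot (eps κ R • (Matrix.of fun i c => N i (h c : ZMod n)))
      (Matrix.of fun i c => N i (h c : ZMod n)) (win (tw N) r) ρ (by omega), det_mix_smul _ (by omega),
      mix_self, ← mul_assoc, eps_pow_sq, one_mul]
    · intro i c l hl
      have := l.2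
      simp only [win, tw, Matrix.of_apply]
      rw [if_pos (by omega)]
      have : h l = r + c + 1 := by simp only [h]; rw [if_neg (by omega)]; omega
      rw [this]
    · intro i c l hl
      have := l.2
      have := c.2
      simp only [win, tw, Matrix.of_apply, Matrix.smul_apply, smul_eq_mul]
      rw [if_neg (by omega)]
      have : h l = r + c - n + 1 := by simp only [h]; rw [if_pos (by omega)]; omega
      rw [this]
  · ext x
    simp only [cSeg, Finset.mem_image, Finset.mem_range, Finset.mem_univ, true_and]
    constructor
    · rintro ⟨t, ht, rfl⟩
      by_cases hc : r + 1 + t ≤ n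
      · refine ⟨⟨t + ρ, by omega⟩, ?_⟩
        have : h ⟨t + ρ, by omega⟩ = r + 1 + t := by
          simp only [h]; rw [if_neg (by omega)]; omega
        rw [this]; push_cast; ring
      · refine ⟨⟨r + t - n, by omega⟩, ?_⟩
        have : h ⟨r + t - n, by omega⟩ = r + t - n + 1 := by
          simp only [h]; rw [if_pos (by omega)]
        rw [this]
        have h3 : r + 1 + t = (r + t - n + 1) + n := by omega
        have h4 : ((r + 1 : ℕ) : ZMod n) + (t : ZMod n) = ((r + 1 + t : ℕ) : ZMod n) := by push_cast; ring
        rw [h4, h3, Nat.cast_add _ n, ZMod.natCast_self, add_zero]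
    · rintro ⟨c, rfl⟩
      have := c.2
      by_cases hc : (c:ℕ) < ρ
      · refine ⟨n - r + c, by omega, ?_⟩
        have h3 : h c = c + 1 := by simp only [h]; rw [if_pos hc]
        have h4 : ((r + 1 : ℕ) : ZMod n) + ((n - r + c : ℕ) : ZMod n) = ((c + 1 + n : ℕ) : ZMod n) := by
          rw [← Nat.cast_add]; congr 1; omega
        rw [h3, h4, Nat.cast_add _ n, ZMod.natCast_self, add_zero]
      · refine ⟨c - ρ, by omega, ?_⟩
        have h3 : h c = r + 1 + (c - ρ) := by simp only [h]; rw [if_neg hc]; omega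
        rw [h3, ← Nat.cast_add]

lemma pluck_cSeg' (N : Matrix (Fin (κ+1)) (ZMod n) R) (hk : κ + 1 ≤ n) (x : ZMod n) :
    pluck N (cSeg n x (κ+1)) = (win (tw N) (rep n x - 1)).det := by
  have h1 := rep_pos n (by omega) x
  have h2 := rep_le n (by omega) x
  rw [← pluck_cSeg N hk (rep n x - 1) (by omega), Nat.sub_add_cancel h1, cast_rep n (by omega)]

end tws

lemma det_mem_grA (k n : ℕ) (hn : 1 ≤ n) (h : Fin k → ZMod n) :
    (Matrix.of fun i c => genericM k n i (h c)).det ∈ grA k n := by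
  by_cases hinj : Function.Injective h
  · let σ := Tuple.sort (fun c => rep n (h c))
    have hm : Monotone ((fun c => rep n (h c)) ∘ σ) := Tuple.monotone_sort _
    have hi : Function.Injective ((fun c => rep n (h c)) ∘ σ) := by
      apply Function.Injective.comp _ σ.injective
      intro a b hab
      apply hinj
      have := congrArg (fun m : ℕ => (m : ZMod n)) hab
      simpa [cast_rep n hn] using this
    have hp := pluck_image (genericM k n) _ _ (hm.strictMono_of_injective hi)
      (fun c => rep_pos n hn _) (fun c => rep_le n hn _) rfl
    have h3 : (Matrix.of fun i c => genericM k n i ((((fun c => rep n (h c)) ∘ σ) c : ℕ) : ZMod n)) =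
        (Matrix.of fun i c => genericM k n i (h c)).submatrix id σ := by
      ext1 i c
      simp [cast_rep n hn]
    rw [h3, Matrix.det_permute'] at hp
    have h4 := pluck_mem_grA k n (Finset.univ.image
      (fun c => ((((fun c => rep n (h c)) ∘ σ) c : ℕ) : ZMod n)))
    rw [hp] at h4
    rcases Int.units_eq_one_or (Equiv.Perm.sign σ) with h5 | h5
    · rw [h5] at h4; simpa using h4
    · rw [h5] at h4; simpa using h4
  · rw [Function.Injective] at hinj
    push Not at hinj
    obtain ⟨a, b, hab, hne⟩ := hinj
    rw [Matrix.det_zero_of_column_eq hne]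
    · exact zero_mem _
    · intro i; simp [hab]

end GrPf


namespace GrPf

/-- the first square block of the generic matrix -/
noncomputable def M0 (κ n : ℕ) :
    Matrix (Fin (κ+1)) (Fin (κ+1)) (MvPolynomial (Fin (κ+1) × ZMod n) ℂ) :=
  Matrix.of fun i c => genericM (κ+1) n i ((c + 1 : ℕ) : ZMod n)

lemma M0_det (κ n : ℕ) (h : κ + 1 ≤ n) :
    (M0 κ n).det = pluck (genericM (κ+1) n) (cSeg n ((0 + 1 : ℕ) : ZMod n) (κ+1)) := by
  rw [pluck_cSeg _ h 0 (by omega)]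
  congr 1
  ext1 i c
  have := c.2
  simp only [M0, win, tw, Matrix.of_apply]
  rw [if_pos (by omega), Nat.zero_add]

lemma adj_mem (κ n : ℕ) (h : κ + 1 ≤ n) (i : Fin (κ+1)) (d : ZMod n) :
    ((M0 κ n).adjugate * genericM (κ+1) n) i d ∈ grA (κ+1) n := by
  have h1 : ((M0 κ n).adjugate * genericM (κ+1) n) i d =
      ((M0 κ n).adjugate.mulVec (fun l => genericM (κ+1) n l d)) i := rfl
  rw [h1, ← Matrix.cramer_eq_adjugate_mulVec, Matrix.cramer_apply]
  have := det_mem_grA (κ+1) n (by omega)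
    (fun c : Fin (κ+1) => if c = i then d else ((c + 1 : ℕ) : ZMod n))
  convert this using 2
  ext1 l c
  rw [Matrix.updateCol_apply, Matrix.of_apply]
  split_ifs with hc
  · rfl
  · rfl

lemma exists_mat (κ n : ℕ) (h : κ + 1 ≤ n) :
    ∃ N : Matrix (Fin (κ+1)) (ZMod n) (grA (κ+1) n ⧸ grJ (κ+1) n),
      (∀ I, pluck N I = Ideal.Quotient.mk _ (grP (κ+1) n I)) ∧
      ∀ i c : Fin (κ+1), N i ((c + 1 : ℕ) : ZMod n) = if i = c then 1 else 0 := by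
  let Bg : Matrix (Fin (κ+1)) (ZMod n) (grA (κ+1) n) := fun i d => ⟨_, adj_mem κ n h i d⟩
  set P0 := grP (κ+1) n (cSeg n ((0 + 1 : ℕ) : ZMod n) (κ+1)) with hP0
  have hP0v : (P0 : MvPolynomial (Fin (κ+1) × ZMod n) ℂ) = (M0 κ n).det := (M0_det κ n h).symm
  have hP1 : Ideal.Quotient.mk (grJ (κ+1) n) P0 = 1 := by
    rw [← map_one (Ideal.Quotient.mk (grJ (κ+1) n)), Ideal.Quotient.eq]
    exact Ideal.subset_span ⟨_, rfl⟩
  have hBg : ∀ I, pluck Bg I = P0 ^ κ * grP (κ+1) n I := by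
    intro I
    apply Subtype.val_injective
    have h1 := pluck_map (grA (κ+1) n).val.toRingHom Bg I
    have h2 : Bg.map (grA (κ+1) n).val.toRingHom =
      (M0 κ n).adjugate * genericM (κ+1) n := rfl
    rw [h2, pluck_mul, Matrix.det_adjugate] at h1
    refine h1.symm.trans ?_
    rw [MulMemClass.coe_mul, SubmonoidClass.coe_pow, hP0v]
    simp [grP]
  refine ⟨Bg.map (Ideal.Quotient.mk _), ?_, ?_⟩
  · intro I
    rw [pluck_map, hBg, map_mul, map_pow, hP1, one_pow, one_mul]
  · intro i c
    have h3 : Bg i ((c + 1 : ℕ) : ZMod n) = if i = c then P0 else 0 := by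
      apply Subtype.val_injective
      have h4 : ((M0 κ n).adjugate * M0 κ n) i c = (if i = c then (M0 κ n).det else 0) := by
        rw [Matrix.adjugate_mul, Matrix.smul_apply, Matrix.one_apply]; simp
      refine Eq.trans (b := ((M0 κ n).adjugate * M0 κ n) i c) rfl ?_
      rw [h4]
      split_ifs
      · exact hP0v.symm
      · rfl
    rw [Matrix.map_apply, h3]
    split_ifs
    · exact hP1
    · simp

lemma tw_win_low {R : Type*} [CommRing R] {κ n : ℕ} (h : κ + 1 ≤ n)
    (N : Matrix (Fin (κ+1)) (ZMod n) R)
    (hN : ∀ i c : Fin (κ+1), N i ((c + 1 : ℕ) : ZMod n) = if i = c then 1 else 0) :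
    win (tw N) 0 = 1 := by
  ext1 i c
  have := c.2
  simp only [win, tw, Matrix.of_apply]
  rw [if_pos (by omega), Nat.zero_add, hN, Matrix.one_apply]

lemma tw_win_high {R : Type*} [CommRing R] {κ n : ℕ}
    (N : Matrix (Fin (κ+1)) (ZMod n) R)
    (hN : ∀ i c : Fin (κ+1), N i ((c + 1 : ℕ) : ZMod n) = if i = c then 1 else 0) :
    win (tw N) n = eps κ R • (1 : Matrix (Fin (κ+1)) (Fin (κ+1)) R) := by
  ext1 i c
  simp only [win, tw, Matrix.of_apply]
  rw [if_neg (by omega), Nat.add_sub_cancel_left, hN, Matrix.smul_apply, Matrix.one_apply,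
    smul_eq_mul]

/-- the matrix attached to a point -/
def NQ {R : Type*} [CommRing R] {κ : ℕ} (s : ℕ) (P : Pt κ R) :
    Matrix (Fin (κ+1)) (ZMod (2 * (κ+1) + s)) R :=
  fun i d => vv s P (rep (2 * (κ+1) + s) d - 1) i

lemma NQ_cast {R : Type*} [CommRing R] {κ : ℕ} (s : ℕ) (P : Pt κ R) (i : Fin (κ+1)) (j : ℕ)
    (hj : j < 2 * (κ+1) + s) : NQ s P i ((j + 1 : ℕ) : ZMod (2 * (κ+1) + s)) = vv s P j i := by
  rw [NQ, rep_cast _ _ (by omega) (by omega), Nat.add_sub_cancel]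

lemma NQ_low {R : Type*} [CommRing R] {κ : ℕ} (s : ℕ) (P : Pt κ R) (i c : Fin (κ+1)) :
    NQ s P i ((c + 1 : ℕ) : ZMod (2 * (κ+1) + s)) = if i = c then 1 else 0 := by
  have := c.2
  rw [NQ_cast s P i c (by omega)]
  have h := congrFun (congrFun (vv_low s P) i) c
  rw [win, Matrix.of_apply, Nat.zero_add, Matrix.one_apply] at h
  exact h

lemma tw_NQ {R : Type*} [CommRing R] {κ : ℕ} (s : ℕ) (P : Pt κ R) (i : Fin (κ+1)) (j : ℕ)
    (hj : j < 2 * (κ+1) + s + (κ+1)) : tw (NQ s P) j i = vv s P j i := by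
  by_cases h : j < 2 * (κ+1) + s
  · rw [tw, if_pos h, NQ_cast _ _ _ _ h]
  · obtain ⟨c, rfl⟩ : ∃ c, j = 2 * (κ+1) + s + c := ⟨j - (2 * (κ+1) + s), by omega⟩
    have h1 := congrFun (congrFun (tw_win_high (NQ s P) (NQ_low s P)) i) ⟨c, by omega⟩
    have h2 := congrFun (congrFun (vv_frame s P 0 (by omega)) i) ⟨c, by omega⟩
    exact h1.trans h2.symm

lemma NQ_cSeg {R : Type*} [CommRing R] {κ : ℕ} (s : ℕ) (P : Pt κ R) (hP : Sat s κ P)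
    (x : ZMod (2 * (κ+1) + s)) : pluck (NQ s P) (cSeg _ x (κ+1)) = 1 := by
  have h1 := rep_pos (2 * (κ+1) + s) (by omega) x
  have h2 := rep_le (2 * (κ+1) + s) (by omega) x
  rw [pluck_cSeg' _ (by omega), ← vv_win s P hP (rep (2 * (κ+1) + s) x - 1) (by omega)]
  congr 1
  ext1 i c
  have := c.2
  exact tw_NQ s P i _ (by omega)

lemma NQ_map {R S : Type*} [CommRing R] [CommRing S] {κ : ℕ} (f : R →+* S) (s : ℕ) (P : Pt κ R) :
    (NQ s P).map f = NQ s (P.map f) := by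
  ext1 i d
  simp only [NQ, Matrix.map_apply]
  rw [vv_map]

theorem main (κ s : ℕ) (hκ : 1 ≤ κ) : (grJ (κ+1) (2 * (κ+1) + s)).IsPrime := by
  set n := 2 * (κ+1) + s with hn
  obtain ⟨N, hN1, hN2⟩ := exists_mat κ n (by omega)
  have hw : ∀ r < n, (win (tw N) r).det = 1 := by
    intro r hr
    rw [← pluck_cSeg N (by omega) r hr, hN1,
      ← map_one (Ideal.Quotient.mk (grJ (κ+1) n)), Ideal.Quotient.eq]
    exact Ideal.subset_span ⟨_, rfl⟩
  obtain ⟨PD, hS, ht, hv⟩ := vv_back s (tw N) (tw_win_low (by omega) N hN2)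
    (tw_win_high N hN2) hw
  have hNPD : NQ s PD = N := by
    ext1 i d
    have h1 := rep_pos n (by omega) d
    have h2 := rep_le n (by omega) d
    change vv s PD (rep n d - 1) i = N i d
    rw [hv _ (by omega), tw, if_pos (by omega), Nat.sub_add_cancel h1, cast_rep n (by omega)]
  obtain ⟨Q, _, _, P, hdom, hsat, -, hex, -⟩ := tower κ s hκ κ le_rfl
  obtain ⟨f, hf⟩ := hex _ PD hS ht
  let φ : grA (κ+1) n →ₐ[ℂ] Q :=
    (MvPolynomial.aeval fun x : Fin (κ+1) × ZMod n => NQ s P x.1 x.2).comp (grA (κ+1) n).val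
  have hφ : ∀ I, φ (grP (κ+1) n I) = pluck (NQ s P) I := by
    intro I
    let g : MvPolynomial (Fin (κ+1) × ZMod n) ℂ →+* Q :=
      (MvPolynomial.aeval (R := ℂ) fun x : Fin (κ+1) × ZMod n => NQ s P x.1 x.2 : _ →ₐ[ℂ] Q)
    have h1 := pluck_map g (genericM (κ+1) n) I
    have h2 : (genericM (κ+1) n).map g = NQ s P := by
      ext1 i d
      simp [g, genericM]
    rw [h2] at h1
    exact h1.symm
  have hcomp : f.comp φ = Ideal.Quotient.mkₐ ℂ (grJ (κ+1) n) := by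
    apply AlgHom.ext_of_eq_adjoin (S := grA (κ+1) n) rfl
    rintro x ⟨I, hI, rfl⟩
    change f (φ (grP (κ+1) n I)) = Ideal.Quotient.mk _ (grP (κ+1) n I)
    rw [hφ, ← hN1, ← hNPD, ← hf]
    have h3 := NQ_map f.toRingHom s P
    have h4 := pluck_map f.toRingHom (NQ s P) I
    rw [h3] at h4
    exact h4.symm
  have hker : grJ (κ+1) n = RingHom.ker φ := by
    apply le_antisymm
    · refine Ideal.span_le.2 ?_
      rintro y ⟨r, rfl⟩
      change φ _ = 0
      rw [map_sub, map_one, hφ, NQ_cSeg s P hsat, sub_self]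
    · intro x hx
      rw [RingHom.mem_ker] at hx
      rw [← Ideal.Quotient.eq_zero_iff_mem]
      have := DFunLike.congr_fun hcomp x
      rw [AlgHom.comp_apply, hx, map_zero] at this
      exact this.symm
  rw [hker]
  exact RingHom.ker_isPrime φ

end GrPf


theorem statement14 (k n : ℕ) (hk : 2 ≤ k) (hkn : 2 * k ≤ n) :
    (grJ k n).IsPrime := by
  obtain ⟨s, rfl⟩ := Nat.exists_eq_add_of_le hkn
  obtain ⟨κ, rfl⟩ : ∃ κ, k = κ + 1 := ⟨k - 1, by omega⟩
  exact GrPf.main κ s (by omega)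
end
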